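/- arXiv:2503.16633 — 2 statements merged into one kernel-verified Lean document; each statement's English description precedes it below -/
import Mathlib

section
/- Convergence of the scaled supremum (reflected) processes (Lemma 4, heavy traffic). Assume that r_i(u) → 0 as u → ∞ for every i ∈ {1,…,n} and that the model satisfies H1, H2, N1, N2 and N3. Then, as u → ∞, the process X̄ᵟ_u(·), with components X̄ᵟ_{u,i}(t) = X̄_{u,i}(δ(r_i(u))t)/σ(δ(r_i(u))), converges in distribution in C([0,∞) → ℝⁿ) to 𝔛_α(·). -/
open MeasureTheory ProbabilityTheory Filter Topology

noncomputable section
/-- Covariance function of a centered Gaussian process with stationary increments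
and standard deviation function `σ`:
`Cov(J(t), J(s)) = (σ²(|t|) + σ²(|s|) − σ²(|t−s|))/2`. -/
def covFromStd (σ : ℝ → ℝ) : ℝ → ℝ → ℝ := fun t s =>
  (σ |t| ^ 2 + σ |s| ^ 2 - σ |t - s| ^ 2) / 2

/-- `X` is a real-valued centered Gaussian process (indexed by `ℝ`) with covariance
function `K`, under the measure `P`: every finite linear combination of its values is a
centered Gaussian real random variable with the variance prescribed by `K`. -/
def IsCenteredGaussian1 {Ω : Type*} [MeasurableSpace Ω] (P : Measure Ω)
    (X : ℝ → Ω → ℝ) (K : ℝ → ℝ → ℝ) : Prop :=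
  (∀ t, Measurable (X t)) ∧
  ∀ (k : ℕ) (t : Fin k → ℝ) (c : Fin k → ℝ),
    P.map (fun ω => ∑ a, c a * X (t a) ω)
      = gaussianReal 0 (∑ a, ∑ b, c a * c b * K (t a) (t b)).toNNReal

/-- `X` is an `n`-dimensional centered Gaussian process with matrix covariance function
`K` (`K i j t s = Cov(Xᵢ(t), Xⱼ(s))`) under the measure `P`. -/
def IsCenteredGaussianVec {Ω : Type*} [MeasurableSpace Ω] {n : ℕ} (P : Measure Ω)
    (X : ℝ → Ω → Fin n → ℝ) (K : Fin n → Fin n → ℝ → ℝ → ℝ) : Prop :=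
  (∀ t i, Measurable fun ω => X t ω i) ∧
  ∀ (k : ℕ) (t : Fin k → ℝ) (c : Fin k → Fin n → ℝ),
    P.map (fun ω => ∑ a, ∑ i, c a i * X (t a) ω i)
      = gaussianReal 0
          (∑ a, ∑ b, ∑ i, ∑ j, c a i * c b j * K i j (t a) (t b)).toNNReal

/-- Covariance of the limiting fractional-Brownian-type process with Hurst-type
parameter `h` and rate ratio `ρv`; the exponent `1/(h−1)` equals `−κ` in the
light-traffic case (`h = λ`, `κ = (1−λ)⁻¹`) and `ξ` in the heavy-traffic case (`h = α`). -/
def limCov (h ρv t s : ℝ) : ℝ :=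
  if 0 < ρv then
    (|t| ^ (2 * h) + |ρv ^ (1 / (h - 1)) * s| ^ (2 * h)
        - |t - ρv ^ (1 / (h - 1)) * s| ^ (2 * h)) / (2 * ρv ^ (1 / (h - 1) * h))
  else 0

/-- Matrix covariance function of the limiting `n`-dimensional Gaussian process `B`. -/
def limCovMat {n : ℕ} (h : ℝ) (ρ : Fin n → Fin n → ℝ) (i j : Fin n) (t s : ℝ) : ℝ :=
  if i ≤ j then limCov h (ρ i j) t s else limCov h (ρ j i) s t

/-- The stationary reflected (workload) map:
`X̄(t) = sup_{−∞ < s < t} (c (J(t) − J(s)) − rate (t − s))`. -/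
def XbarProc {Ω : Type*} (J : ℝ → Ω → ℝ) (c rate t : ℝ) (ω : Ω) : ℝ :=
  ⨆ s : Set.Iio t, (c * (J t ω - J (↑s) ω) - rate * (t - ↑s))

/-- Convergence in distribution, as `u → ∞`, of the processes `X u` (on `(Ω, P)`) to `Y`
(on `(Ω', P')`), viewed as random elements of the space of functions on `I` carrying the
topology of uniform convergence on compact subsets of `I`: the expectations of every
bounded continuous functional converge. -/
def TendstoInDistOnCompacts {Ω Ω' : Type*} [MeasurableSpace Ω] [MeasurableSpace Ω']
    (P : Measure Ω) (P' : Measure Ω') (I : Set ℝ) (n : ℕ)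
    (X : ℝ → Ω → ℝ → Fin n → ℝ) (Y : Ω' → ℝ → Fin n → ℝ) : Prop :=
  ∀ F : BoundedContinuousFunction
      (UniformOnFun ↥I (Fin n → ℝ) {K : Set ↥I | IsCompact K}) ℝ,
    Tendsto
      (fun u => ∫ ω, F (UniformOnFun.ofFun {K : Set ↥I | IsCompact K}
          (fun t : ↥I => X u ω ↑t)) ∂P)
      atTop
      (𝓝 (∫ ω, F (UniformOnFun.ofFun {K : Set ↥I | IsCompact K}
          (fun t : ↥I => Y ω ↑t)) ∂P'))




/-- Chaining: deterministic part. -/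
lemma chain_det (z : ℝ → ℝ) (hz : Continuous z) (a L : ℝ) (hL : 0 < L) (θ x : ℝ)
    (hθ0 : 0 ≤ θ) (hθ1 : θ < 1) (hx : 0 < x)
    (h : ∀ n j : ℕ, j < 2 ^ n →
      |z (a + L * ((j + 1 : ℕ) : ℝ) / 2 ^ n) - z (a + L * (j : ℝ) / 2 ^ n)| ≤ (1 - θ) * θ ^ n * x)
    (t : ℝ) (ht : t ∈ Set.Icc a (a + L)) : |z t - z a| ≤ x := by
  set y : ℝ := (t - a) / L with hy
  have hy0 : 0 ≤ y := div_nonneg (by linarith [ht.1]) hL.le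
  have hy1 : y ≤ 1 := by rw [hy, div_le_one hL]; linarith [ht.2]
  have hty : t = a + L * y := by rw [hy]; field_simp; ring
  let q : ℕ → ℕ := fun n => ⌊(2:ℝ) ^ n * y⌋₊
  let τ : ℕ → ℝ := fun n => a + L * (q n : ℝ) / 2 ^ n
  have hqle : ∀ n, (q n : ℝ) ≤ 2 ^ n * y := fun n => Nat.floor_le (by positivity)
  have hqlt : ∀ n, 2 ^ n * y < (q n : ℝ) + 1 := fun n => Nat.lt_floor_add_one _
  have hτ : Tendsto τ atTop (𝓝 t) := by
    have h1 : Tendsto (fun n : ℕ => L * (1 / 2 : ℝ) ^ n) atTop (𝓝 0) := by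
      simpa using (tendsto_pow_atTop_nhds_zero_of_lt_one (r := (1/2:ℝ)) (by norm_num)
        (by norm_num)).const_mul L
    rw [tendsto_iff_dist_tendsto_zero]
    refine squeeze_zero (fun _ => dist_nonneg) (fun n => ?_) h1
    rw [Real.dist_eq, abs_sub_comm, abs_of_nonneg]
    · have e : t - τ n = L * ((2 ^ n * y - q n) / 2 ^ n) := by
        simp only [τ]; rw [hty]; field_simp; ring
      rw [e]
      refine mul_le_mul_of_nonneg_left ?_ hL.le
      rw [one_div, inv_pow, ← one_div]
      gcongr
      linarith [hqlt n]
    · have e : t - τ n = L * ((2 ^ n * y - q n) / 2 ^ n) := by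
        simp only [τ]; rw [hty]; field_simp; ring
      rw [e]
      have := hqle n
      exact mul_nonneg hL.le (div_nonneg (by linarith) (by positivity))
  have hstep : ∀ n, |z (τ (n + 1)) - z (τ n)| ≤ (1 - θ) * θ ^ (n + 1) * x := by
    intro n
    have hpos : 0 ≤ (1 - θ) * θ ^ (n + 1) * x :=
      mul_nonneg (mul_nonneg (by linarith) (by positivity)) hx.le
    have h2 : (2:ℝ) ^ (n + 1) * y = 2 * (2 ^ n * y) := by ring
    have c1 : 2 * q n ≤ q (n + 1) := by
      apply Nat.le_floor
      push_cast
      rw [h2]; linarith [hqle n]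
    have c2 : q (n + 1) < 2 * q n + 2 := by
      have := hqle (n + 1)
      have h3 := hqlt n
      have : (q (n + 1) : ℝ) < 2 * q n + 2 := by rw [h2] at this; linarith
      exact_mod_cast this
    have c3 : τ n = a + L * ((2 * q n : ℕ) : ℝ) / 2 ^ (n + 1) := by
      simp only [τ]; push_cast; field_simp; ring
    rcases (by omega : q (n + 1) = 2 * q n ∨ q (n + 1) = 2 * q n + 1) with e | e
    · have : τ (n + 1) = τ n := by rw [c3]; simp only [τ, e]
      rw [this]; simpa using hpos
    · have hlt : 2 * q n < 2 ^ (n + 1) := by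
        have := hqle (n + 1)
        have h4 : (q (n + 1) : ℝ) ≤ 2 ^ (n + 1) := by
          refine this.trans ?_
          have : (2:ℝ) ^ (n + 1) * y ≤ 2 ^ (n + 1) * 1 := by gcongr
          linarith
        have : q (n + 1) ≤ 2 ^ (n + 1) := by exact_mod_cast h4
        omega
      have := h (n + 1) (2 * q n) hlt
      rw [← c3] at this
      have e2 : τ (n + 1) = a + L * ((2 * q n + 1 : ℕ) : ℝ) / 2 ^ (n + 1) := by
        simp only [τ, e]
      rw [e2]; exact this
  have h0 : |z (τ 0) - z a| ≤ (1 - θ) * x := by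
    have hpos : 0 ≤ (1 - θ) * x := mul_nonneg (by linarith) hx.le
    have hq : q 0 ≤ 1 := by
      have := hqle 0
      have : (q 0 : ℝ) ≤ 1 := by simp at this; linarith
      exact_mod_cast this
    rcases (by omega : q 0 = 0 ∨ q 0 = 1) with e | e
    · have : τ 0 = a := by simp [τ, e]
      rw [this]; simpa using hpos
    · have := h 0 0 (by norm_num)
      simpa [τ, e] using this
  have hsum : ∀ n, |z (τ n) - z a| ≤ (1 - θ ^ (n + 1)) * x := by
    intro n
    induction n with
    | zero => simpa using h0
    | succ n ih =>
      calc |z (τ (n + 1)) - z a| ≤ |z (τ (n + 1)) - z (τ n)| + |z (τ n) - z a| := abs_sub_le _ _ _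
        _ ≤ (1 - θ) * θ ^ (n + 1) * x + (1 - θ ^ (n + 1)) * x := add_le_add (hstep n) ih
        _ = _ := by ring
  have hlim : Tendsto (fun n => |z (τ n) - z a|) atTop (𝓝 |z t - z a|) :=
    (((hz.tendsto t).comp hτ).sub_const _).abs
  refine le_of_tendsto hlim (Eventually.of_forall fun n => (hsum n).trans ?_)
  have : 0 ≤ θ ^ (n + 1) := by positivity
  nlinarith

/-- Maximal inequality by dyadic chaining. -/
lemma max_ineq (γ : ℝ) (hγ : 0 < γ) (p : ℕ) (hp : 4 ≤ p * γ) :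
    ∃ D' : ℝ, 0 ≤ D' ∧ ∀ {Ω : Type*} [MeasurableSpace Ω] (P : Measure Ω)
      (Z : ℝ → Ω → ℝ) (_ : ∀ ω, Continuous fun t => Z t ω) (a L D : ℝ) (_ : 0 < L) (_ : 0 ≤ D)
      (_ : ∀ s ∈ Set.Icc a (a + L), ∀ t ∈ Set.Icc a (a + L), ∀ x, 0 < x →
        P {ω | x ≤ |Z t ω - Z s ω|} ≤ ENNReal.ofReal (D * (|t - s| ^ γ / x) ^ p))
      (x : ℝ) (_ : 0 < x),
      P {ω | ∃ t ∈ Set.Icc a (a + L), x < |Z t ω - Z a ω|} ≤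
        ENNReal.ofReal (D' * D * (L ^ γ / x) ^ p) := by
  set θ : ℝ := (2:ℝ) ^ (-(γ / 2)) with hθ
  have hθ0 : 0 < θ := by positivity
  have hθ1 : θ < 1 := Real.rpow_lt_one_of_one_lt_of_neg (by norm_num) (by linarith)
  have h1θ : 0 < 1 - θ := by linarith
  refine ⟨2 * ((1 - θ)⁻¹) ^ p, by positivity, ?_⟩
  intro Ω _ P Z hZ a L D hL hD hinc x hx
  have hsub : {ω | ∃ t ∈ Set.Icc a (a + L), x < |Z t ω - Z a ω|} ⊆
      ⋃ n : ℕ, ⋃ j ∈ Finset.range (2 ^ n), {ω | (1 - θ) * θ ^ n * x ≤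
        |Z (a + L * ((j + 1 : ℕ) : ℝ) / 2 ^ n) ω - Z (a + L * (j : ℝ) / 2 ^ n) ω|} := by
    rintro ω ⟨t, ht, htx⟩
    by_contra hcon
    simp only [Set.mem_iUnion, Set.mem_ofPred_eq, not_exists, not_le, Finset.mem_range] at hcon
    have := chain_det (fun t => Z t ω) (hZ ω) a L hL θ x hθ0.le hθ1 hx
      (fun n j hj => (hcon n j hj).le) t ht
    exact absurd this (not_le.mpr htx)
  have hθp : θ ^ p ≤ 1 / 4 := by
    rw [hθ, ← Real.rpow_natCast, ← Real.rpow_mul (by norm_num)]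
    calc (2:ℝ) ^ (-(γ / 2) * (p:ℝ)) ≤ 2 ^ (-2 : ℝ) :=
          Real.rpow_le_rpow_of_exponent_le (by norm_num) (by nlinarith)
      _ = 1 / 4 := by
          rw [Real.rpow_neg (by norm_num)]; norm_num
  have key : ∀ n j : ℕ, j ∈ Finset.range (2 ^ n) → P {ω | (1 - θ) * θ ^ n * x ≤
        |Z (a + L * ((j + 1 : ℕ) : ℝ) / 2 ^ n) ω - Z (a + L * (j : ℝ) / 2 ^ n) ω|} ≤
      ENNReal.ofReal (((1 - θ)⁻¹) ^ p * D * (L ^ γ / x) ^ p * (1 / 4) ^ n) := by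
    intro n j hj
    have hj' : j + 1 ≤ 2 ^ n := Finset.mem_range.mp hj
    have hj'' : ((j:ℝ) + 1) ≤ 2 ^ n := by exact_mod_cast hj'
    have m1 : a + L * (j : ℝ) / 2 ^ n ∈ Set.Icc a (a + L) := by
      constructor
      · have : 0 ≤ L * (j : ℝ) / 2 ^ n := by positivity
        linarith
      · have : L * (j : ℝ) / 2 ^ n ≤ L := by
          rw [div_le_iff₀ (by positivity)]; gcongr; linarith
        linarith
    have m2 : a + L * ((j + 1 : ℕ) : ℝ) / 2 ^ n ∈ Set.Icc a (a + L) := by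
      constructor
      · have : 0 ≤ L * ((j + 1 : ℕ) : ℝ) / 2 ^ n := by positivity
        linarith
      · have : L * ((j + 1 : ℕ) : ℝ) / 2 ^ n ≤ L := by
          rw [div_le_iff₀ (by positivity)]; gcongr; push_cast; linarith
        linarith
    refine (hinc _ m1 _ m2 _ (by positivity)).trans (ENNReal.ofReal_le_ofReal ?_)
    have e1 : a + L * ((j + 1 : ℕ) : ℝ) / 2 ^ n - (a + L * (j : ℝ) / 2 ^ n) = L / 2 ^ n := by
      push_cast; ring
    have e2 : |L / 2 ^ n| ^ γ = L ^ γ * (θ ^ n) ^ 2 := by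
      rw [abs_of_pos (by positivity), Real.div_rpow hL.le (by positivity), div_eq_mul_inv]
      congr 1
      rw [hθ, ← pow_mul, ← Real.rpow_natCast, ← Real.rpow_natCast, ← Real.rpow_mul (by norm_num),
        ← Real.rpow_mul (by norm_num), ← Real.rpow_neg (by norm_num)]
      congr 1
      push_cast; ring
    rw [e1, e2]
    have e3 : L ^ γ * (θ ^ n) ^ 2 / ((1 - θ) * θ ^ n * x) = (1 - θ)⁻¹ * (L ^ γ / x) * θ ^ n := by
      field_simp
    rw [e3, mul_pow, mul_pow, ← pow_mul, mul_comm n p, pow_mul]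
    have : (θ ^ p) ^ n ≤ (1 / 4) ^ n := by gcongr
    have h0 : 0 ≤ D * ((1 - θ)⁻¹ ^ p * (L ^ γ / x) ^ p) := by positivity
    nlinarith
  set Q := ((1 - θ)⁻¹) ^ p * D * (L ^ γ / x) ^ p with hQ
  have hQ0 : 0 ≤ Q := by positivity
  refine (measure_mono hsub).trans ((measure_iUnion_le _).trans ?_)
  have b1 : ∀ n : ℕ, P (⋃ j ∈ Finset.range (2 ^ n), {ω | (1 - θ) * θ ^ n * x ≤
        |Z (a + L * ((j + 1 : ℕ) : ℝ) / 2 ^ n) ω - Z (a + L * (j : ℝ) / 2 ^ n) ω|}) ≤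
        ENNReal.ofReal (Q * (1 / 2) ^ n) := by
    intro n
    refine (measure_biUnion_finset_le _ _).trans ((Finset.sum_le_sum (key n)).trans ?_)
    rw [Finset.sum_const, Finset.card_range, nsmul_eq_mul, ← ENNReal.ofReal_natCast,
      ← ENNReal.ofReal_mul (by positivity)]
    apply ENNReal.ofReal_le_ofReal
    push_cast
    have : (2:ℝ) ^ n * (1 / 4) ^ n = (1 / 2) ^ n := by rw [← mul_pow]; norm_num
    rw [← this]; apply le_of_eq; ring
  refine (ENNReal.tsum_le_tsum b1).trans ?_
  rw [← ENNReal.ofReal_tsum_of_nonneg (fun n => by positivity)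
    ((summable_geometric_of_lt_one (by norm_num) (by norm_num)).mul_left _), tsum_mul_left,
    tsum_geometric_of_lt_one (by norm_num) (by norm_num)]
  apply ENNReal.ofReal_le_ofReal
  apply le_of_eq
  rw [hQ]; norm_num; ring



/-- Uniform polynomial tail bound on increments. -/
def IncB {Ω : Type*} [MeasurableSpace Ω] (P : Measure Ω) (Z : ℝ → Ω → ℝ) (D : ℝ) (p : ℕ)
    (γ γ' : ℝ) : Prop :=
  ∀ s t x : ℝ, 0 < x → P {ω | x ≤ |Z t ω - Z s ω|} ≤
    ENNReal.ofReal (D * (max (|t - s| ^ γ) (|t - s| ^ γ') / x) ^ p)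

/-- Grid points. -/
def gridPt (m : ℕ) (q : ℕ) : ℝ := (q : ℝ) / 2 ^ m - 2 ^ m

lemma modulus_bound (γ γ' : ℝ) (hγ : 0 < γ) (hγγ : γ ≤ γ') (p : ℕ) (hp : 4 ≤ p * γ)
    (D : ℝ) (hD : 0 ≤ D) (η : ℝ) (hη : 0 < η) :
    ∃ b : ℕ → ℝ, Tendsto b atTop (𝓝 0) ∧ ∀ {Ω : Type*} [MeasurableSpace Ω] (P : Measure Ω)
      (Z : ℝ → Ω → ℝ) (_ : ∀ ω, Continuous fun t => Z t ω) (_ : IncB P Z D p γ γ') (m : ℕ),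
      P {ω | ∃ q < 2 * 4 ^ m, ∃ t ∈ Set.Icc (gridPt m q) (gridPt m q + 1 / 2 ^ m),
        η < |Z t ω - Z (gridPt m q) ω|} ≤ ENNReal.ofReal (b m) := by
  obtain ⟨D', hD', hmax⟩ := max_ineq γ hγ p hp
  have hr0 : 0 ≤ 4 * ((1 / 2 : ℝ) ^ γ) ^ p := by positivity
  have hr1 : 4 * ((1 / 2 : ℝ) ^ γ) ^ p < 1 := by
    have : ((1 / 2 : ℝ) ^ γ) ^ p ≤ (1 / 2 : ℝ) ^ (4:ℝ) := by
      rw [← Real.rpow_natCast, ← Real.rpow_mul (by norm_num)]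
      exact Real.rpow_le_rpow_of_exponent_ge (by norm_num) (by norm_num) (by linarith)
    norm_num at this ⊢
    linarith
  refine ⟨fun m => 2 * (D' * D * (1 / η) ^ p) * (4 * ((1 / 2 : ℝ) ^ γ) ^ p) ^ m, ?_, ?_⟩
  · simpa using (tendsto_pow_atTop_nhds_zero_of_lt_one hr0 hr1).const_mul
      (2 * (D' * D * (1 / η) ^ p))
  intro Ω _ P Z hZ hI m
  have hsub : {ω | ∃ q < 2 * 4 ^ m, ∃ t ∈ Set.Icc (gridPt m q) (gridPt m q + 1 / 2 ^ m),
        η < |Z t ω - Z (gridPt m q) ω|} ⊆ ⋃ q ∈ Finset.range (2 * 4 ^ m),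
        {ω | ∃ t ∈ Set.Icc (gridPt m q) (gridPt m q + 1 / 2 ^ m),
        η < |Z t ω - Z (gridPt m q) ω|} := by
    rintro ω ⟨q, hq, h⟩
    simp only [Set.mem_iUnion, Finset.mem_range]
    exact ⟨q, hq, h⟩
  refine (measure_mono hsub).trans ((measure_biUnion_finset_le _ _).trans ?_)
  have key : ∀ q ∈ Finset.range (2 * 4 ^ m),
      P {ω | ∃ t ∈ Set.Icc (gridPt m q) (gridPt m q + 1 / 2 ^ m),
        η < |Z t ω - Z (gridPt m q) ω|} ≤
      ENNReal.ofReal (D' * D * ((1 / 2 ^ m) ^ γ / η) ^ p) := by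
    intro q _
    refine hmax P Z hZ (gridPt m q) (1 / 2 ^ m) D (by positivity) hD ?_ η hη
    intro s hs t ht x hx
    refine (hI s t x hx).trans (ENNReal.ofReal_le_ofReal ?_)
    have hd : |t - s| ≤ 1 := by
      have h1 : (1:ℝ) / 2 ^ m ≤ 1 := by
        rw [div_le_one (by positivity)]; exact one_le_pow₀ (by norm_num)
      rw [abs_le]; constructor <;> linarith [hs.1, hs.2, ht.1, ht.2]
    have : max (|t - s| ^ γ) (|t - s| ^ γ') = |t - s| ^ γ := by
      apply max_eq_left
      rcases (abs_nonneg (t - s)).eq_or_lt with h | h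
      · rw [← h, Real.zero_rpow (by linarith), Real.zero_rpow (by linarith)]
      · exact Real.rpow_le_rpow_of_exponent_ge h hd hγγ
    rw [this]
  refine (Finset.sum_le_sum key).trans ?_
  rw [Finset.sum_const, Finset.card_range, nsmul_eq_mul, ← ENNReal.ofReal_natCast,
      ← ENNReal.ofReal_mul (by positivity)]
  apply ENNReal.ofReal_le_ofReal
  apply le_of_eq
  have : ((1:ℝ) / 2 ^ m) ^ γ = ((1 / 2 : ℝ) ^ γ) ^ m := by
    rw [show (1:ℝ) / 2 ^ m = (1 / 2) ^ m by rw [one_div_pow], ← Real.rpow_natCast,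
      ← Real.rpow_natCast, ← Real.rpow_mul (by norm_num), ← Real.rpow_mul (by norm_num), mul_comm]
  rw [this]
  push_cast
  rw [div_pow, one_div_pow, mul_pow, ← pow_mul, ← pow_mul, mul_comm m p]
  ring

lemma growth_bound (γ γ' : ℝ) (hγ : 0 < γ) (hγγ : γ ≤ γ') (hγ' : γ' < 1) (p : ℕ)
    (hp : 4 ≤ p * γ) (D : ℝ) (hD : 0 ≤ D) (η : ℝ) (hη : 0 < η) :
    ∃ b : ℕ → ℝ, Tendsto b atTop (𝓝 0) ∧ ∀ {Ω : Type*} [MeasurableSpace Ω] (P : Measure Ω)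
      (Z : ℝ → Ω → ℝ) (_ : ∀ ω, Continuous fun t => Z t ω) (_ : IncB P Z D p γ γ') (m : ℕ),
      P {ω | ∃ s : ℝ, η * max |s| (2 ^ m) < |Z s ω - Z 0 ω|} ≤ ENNReal.ofReal (b m) := by
  obtain ⟨D', hD', hmax⟩ := max_ineq γ hγ p hp
  set r : ℝ := ((2 : ℝ) ^ (γ' - 1)) ^ p with hr
  have hp0 : p ≠ 0 := by rintro rfl; norm_num at hp
  have hr0 : 0 ≤ r := by positivity
  have hr1 : r < 1 := by
    refine pow_lt_one₀ (by positivity) ?_ hp0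
    exact Real.rpow_lt_one_of_one_lt_of_neg (by norm_num) (by linarith)
  set Q : ℝ := D' * D * (2 ^ γ' * (4 / η)) ^ p with hQ
  have hQ0 : 0 ≤ Q := by positivity
  refine ⟨fun m => Q * (1 - r)⁻¹ * r ^ m, ?_, ?_⟩
  · simpa using (tendsto_pow_atTop_nhds_zero_of_lt_one hr0 hr1).const_mul (Q * (1 - r)⁻¹)
  intro Ω _ P Z hZ hI m
  have hsub : {ω | ∃ s : ℝ, η * max |s| (2 ^ m) < |Z s ω - Z 0 ω|} ⊆
      ⋃ k : ℕ, {ω | ∃ t ∈ Set.Icc (-2 ^ (m + k) : ℝ) (-2 ^ (m + k) + 2 ^ (m + k + 1)),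
        η * 2 ^ (m + k) / 4 < |Z t ω - Z (-2 ^ (m + k)) ω|} := by
    rintro ω ⟨s, hs⟩
    have hex : ∃ k : ℕ, |s| ≤ 2 ^ (m + k) := by
      obtain ⟨k, hk⟩ := pow_unbounded_of_one_lt |s| (by norm_num : (1:ℝ) < 2)
      exact ⟨k, hk.le.trans (pow_le_pow_right₀ (by norm_num) (by omega))⟩
    classical
    set k := Nat.find hex with hk
    have hk1 : |s| ≤ 2 ^ (m + k) := Nat.find_spec hex
    have hk2 : (2:ℝ) ^ (m + k) / 2 ≤ max |s| (2 ^ m) := by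
      rcases Nat.eq_zero_or_pos k with h0 | h0
      · rw [h0]; refine le_max_of_le_right ?_
        have : (0:ℝ) < 2 ^ m := by positivity
        simp only [add_zero]; linarith
      · refine le_max_of_le_left ?_
        have := Nat.find_min hex (m := k - 1) (by omega)
        rw [not_le] at this
        have e : (2:ℝ) ^ (m + k) = 2 ^ (m + (k - 1)) * 2 := by
          rw [← pow_succ]; congr 1; omega
        rw [e]; linarith
    have hpos : (0:ℝ) < 2 ^ (m + k) := by positivity
    have e2 : (2:ℝ) ^ (m + k + 1) = 2 * 2 ^ (m + k) := by rw [pow_succ]; ring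
    have hs2 : η * 2 ^ (m + k) / 2 < |Z s ω - Z 0 ω| := by
      refine lt_of_le_of_lt ?_ hs
      calc η * 2 ^ (m + k) / 2 = η * (2 ^ (m + k) / 2) := by ring
        _ ≤ _ := by gcongr
    simp only [Set.mem_iUnion]
    refine ⟨k, ?_⟩
    by_contra hcon
    simp only [Set.mem_ofPred_eq, not_exists, not_and, not_lt] at hcon
    have a1 := hcon s ⟨by linarith [(abs_le.mp hk1).1], by rw [e2]; linarith [(abs_le.mp hk1).2]⟩
    have a2 := hcon 0 ⟨by linarith, by rw [e2]; linarith⟩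
    have := abs_sub_le (Z s ω) (Z (-2 ^ (m + k)) ω) (Z 0 ω)
    rw [abs_sub_comm (Z (-2 ^ (m + k)) ω) (Z 0 ω)] at this
    linarith
  have key : ∀ k : ℕ, P {ω | ∃ t ∈ Set.Icc (-2 ^ (m + k) : ℝ) (-2 ^ (m + k) + 2 ^ (m + k + 1)),
        η * 2 ^ (m + k) / 4 < |Z t ω - Z (-2 ^ (m + k)) ω|} ≤
        ENNReal.ofReal (Q * r ^ m * r ^ k) := by
    intro k
    set l := m + k with hl
    set L : ℝ := 2 ^ (l + 1) with hL
    have hL1 : 1 ≤ L := one_le_pow₀ (by norm_num)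
    have hL0 : 0 < L := by linarith
    refine (hmax P Z hZ (-2 ^ l) L (D * (L ^ (γ' - γ)) ^ p) hL0 (by positivity) ?_
      (η * 2 ^ l / 4) (by positivity)).trans (ENNReal.ofReal_le_ofReal ?_)
    · intro s hs t ht x hx
      refine (hI s t x hx).trans (ENNReal.ofReal_le_ofReal ?_)
      have hd : |t - s| ≤ L := by
        rw [abs_le]; constructor <;> linarith [hs.1, hs.2, ht.1, ht.2]
      have : max (|t - s| ^ γ) (|t - s| ^ γ') ≤ L ^ (γ' - γ) * |t - s| ^ γ := by
        have g0 : 0 ≤ |t - s| ^ γ := by positivity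
        apply max_le
        · have : 1 ≤ L ^ (γ' - γ) := Real.one_le_rpow hL1 (by linarith)
          nlinarith
        · rcases (abs_nonneg (t - s)).eq_or_lt with h | h
          · rw [← h, Real.zero_rpow (by linarith), Real.zero_rpow (by linarith)]; simp
          · rw [show γ' = (γ' - γ) + γ by ring, Real.rpow_add h]
            simp only [add_sub_cancel_right]
            gcongr
      calc D * (max (|t - s| ^ γ) (|t - s| ^ γ') / x) ^ p
          ≤ D * ((L ^ (γ' - γ) * |t - s| ^ γ) / x) ^ p := by gcongr
        _ = _ := by rw [mul_div_assoc, mul_pow]; ring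
    · apply le_of_eq
      have e1 : r ^ m * r ^ k = ((2:ℝ) ^ l) ^ ((γ' - 1) * p) := by
        rw [← pow_add, ← hl, hr, ← Real.rpow_natCast, ← Real.rpow_natCast, ← Real.rpow_natCast,
          ← Real.rpow_mul (by positivity), ← Real.rpow_mul (by positivity),
          ← Real.rpow_mul (by positivity)]
        congr 1; ring
      rw [mul_assoc Q, e1, hQ]
      have e2 : L ^ (γ' - γ) * L ^ γ = 2 ^ γ' * ((2:ℝ) ^ l) ^ (γ' - 1) * 2 ^ l := by
        rw [← Real.rpow_add hL0, Real.rpow_sub_one (by positivity)]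
        rw [mul_assoc, div_mul_cancel₀ _ (by positivity), ← Real.mul_rpow (by norm_num)
          (by positivity)]
        congr 1
        · rw [hL, pow_succ]; ring
        · ring
      have e3 : ((2:ℝ) ^ l) ^ ((γ' - 1) * (p:ℝ)) = (((2:ℝ) ^ l) ^ (γ' - 1)) ^ p := by
        rw [Real.rpow_mul (by positivity), Real.rpow_natCast]
      rw [e3]
      have e4 : (L ^ (γ' - γ)) ^ p * (L ^ γ / (η * 2 ^ l / 4)) ^ p =
          (2 ^ γ' * (4 / η)) ^ p * (((2:ℝ) ^ l) ^ (γ' - 1)) ^ p := by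
        rw [← mul_pow, ← mul_pow, ← mul_div_assoc, e2]
        congr 1
        field_simp
      rw [mul_assoc (D' * D), ← e4]; ring
  refine (measure_mono hsub).trans ((measure_iUnion_le _).trans
    ((ENNReal.tsum_le_tsum key).trans ?_))
  rw [← ENNReal.ofReal_tsum_of_nonneg (fun n => by positivity)
    ((summable_geometric_of_lt_one hr0 hr1).mul_left _), tsum_mul_left,
    tsum_geometric_of_lt_one hr0 hr1]
  apply ENNReal.ofReal_le_ofReal
  apply le_of_eq; ring



/-- Piecewise linear interpolation of grid values. -/
def interp {n : ℕ} (m : ℕ) (v : Fin (2 * 4 ^ m + 1) → Fin n → ℝ) (t : ℝ) (i : Fin n) : ℝ :=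
  v 0 i + ∑ j : Fin (2 * 4 ^ m),
    max 0 (min 1 (2 ^ m * (t + 2 ^ m) - (j : ℕ))) * (v j.succ i - v j.castSucc i)

/-- Truncated reflected functional. -/
def supT (m : ℕ) (c : ℝ) (z : ℝ → ℝ) (t : ℝ) : ℝ :=
  sSup ((fun θ : ℝ => c * (z t - z (t - θ * (t + 2 ^ m))) - θ * (t + 2 ^ m)) '' Set.Icc 0 1)

/-- Full reflected functional. -/
def supF (c : ℝ) (z : ℝ → ℝ) (t : ℝ) : ℝ :=
  ⨆ s : Set.Iio t, (c * (z t - z (↑s)) - (t - ↑s))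

lemma continuous_interp {n : ℕ} (m : ℕ) (i : Fin n) :
    Continuous fun x : (Fin (2 * 4 ^ m + 1) → Fin n → ℝ) × ℝ => interp m x.1 x.2 i := by
  unfold interp; fun_prop

lemma continuous_supT_interp {n : ℕ} (m : ℕ) (c : Fin n → ℝ) :
    Continuous fun x : (Fin (2 * 4 ^ m + 1) → Fin n → ℝ) × ℝ =>
      fun i => supT m (c i) (fun s => interp m x.1 s i) x.2 := by
  refine continuous_pi fun i => ?_
  unfold supT
  apply IsCompact.continuous_sSup isCompact_Icc
  have h := continuous_interp (n := n) m i
  have h1 : Continuous fun y : ((Fin (2 * 4 ^ m + 1) → Fin n → ℝ) × ℝ) × ℝ =>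
      interp m y.1.1 y.1.2 i := h.comp continuous_fst
  have h2 : Continuous fun y : ((Fin (2 * 4 ^ m + 1) → Fin n → ℝ) × ℝ) × ℝ =>
      interp m y.1.1 (y.1.2 - y.2 * (y.1.2 + 2 ^ m)) i :=
    h.comp (f := fun y : ((Fin (2 * 4 ^ m + 1) → Fin n → ℝ) × ℝ) × ℝ =>
      (y.1.1, y.1.2 - y.2 * (y.1.2 + 2 ^ m))) (by fun_prop)
  change Continuous fun y : ((Fin (2 * 4 ^ m + 1) → Fin n → ℝ) × ℝ) × ℝ =>
    c i * (interp m y.1.1 y.1.2 i - interp m y.1.1 (y.1.2 - y.2 * (y.1.2 + 2 ^ m)) i)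
      - y.2 * (y.1.2 + 2 ^ m)
  fun_prop

lemma continuous_supT (m : ℕ) (c : ℝ) (z : ℝ → ℝ) (hz : Continuous z) :
    Continuous fun t => supT m c z t := by
  unfold supT
  apply IsCompact.continuous_sSup isCompact_Icc
  change Continuous fun y : ℝ × ℝ => c * (z y.1 - z (y.1 - y.2 * (y.1 + 2 ^ m)))
      - y.2 * (y.1 + 2 ^ m)
  fun_prop

lemma supT_bdd (m : ℕ) (c : ℝ) (z : ℝ → ℝ) (hz : Continuous z) (t : ℝ) :
    BddAbove ((fun θ : ℝ => c * (z t - z (t - θ * (t + 2 ^ m))) - θ * (t + 2 ^ m)) ''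
      Set.Icc 0 1) := by
  apply (isCompact_Icc.image _).bddAbove
  fun_prop

lemma supT_ge (m : ℕ) (c : ℝ) (z : ℝ → ℝ) (hz : Continuous z) (t θ : ℝ)
    (hθ : θ ∈ Set.Icc (0:ℝ) 1) :
    c * (z t - z (t - θ * (t + 2 ^ m))) - θ * (t + 2 ^ m) ≤ supT m c z t :=
  le_csSup (supT_bdd m c z hz t) ⟨θ, hθ, rfl⟩

lemma supT_sub_le (m : ℕ) (c : ℝ) (z z' : ℝ → ℝ) (hz' : Continuous z')
    (t : ℝ) (ht : 0 ≤ t) (ε : ℝ) (h : ∀ s ∈ Set.Icc (-2 ^ m : ℝ) t, |z s - z' s| ≤ ε) :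
    supT m c z t ≤ supT m c z' t + 2 * |c| * ε := by
  apply csSup_le (Set.Nonempty.image _ ⟨0, by simp⟩)
  rintro _ ⟨θ, hθ, rfl⟩
  have h1 := supT_ge m c z' hz' t θ hθ
  have hp : (0:ℝ) < 2 ^ m := by positivity
  have a1 := h t ⟨by linarith, le_rfl⟩
  have a2 := h (t - θ * (t + 2 ^ m)) ⟨by nlinarith [hθ.1, hθ.2], by nlinarith [hθ.1, hθ.2]⟩
  simp only at *
  set w := z (t - θ * (t + 2 ^ m))
  set w' := z' (t - θ * (t + 2 ^ m))
  have a3 : c * ((z t - z' t) - (w - w')) ≤ |c| * (2 * ε) := by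
    calc c * ((z t - z' t) - (w - w')) ≤ |c * ((z t - z' t) - (w - w'))| := le_abs_self _
      _ = |c| * |(z t - z' t) - (w - w')| := abs_mul _ _
      _ ≤ |c| * (2 * ε) := by
        gcongr
        have := abs_sub (z t - z' t) (w - w')
        linarith
  linarith

lemma supT_dist_le (m : ℕ) (c : ℝ) (z z' : ℝ → ℝ) (hz : Continuous z) (hz' : Continuous z')
    (t : ℝ) (ht : 0 ≤ t) (ε : ℝ) (h : ∀ s ∈ Set.Icc (-2 ^ m : ℝ) t, |z s - z' s| ≤ ε) :
    |supT m c z t - supT m c z' t| ≤ 2 * |c| * ε := by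
  rw [abs_le]
  have h1 := supT_sub_le m c z z' hz' t ht ε h
  have h2 := supT_sub_le m c z' z hz t ht ε (fun s hs => by rw [abs_sub_comm]; exact h s hs)
  constructor <;> linarith

lemma supF_eq_supT (m : ℕ) (c η : ℝ) (hη : |c| * η ≤ 1 / 4) (z : ℝ → ℝ) (hz : Continuous z)
    (h : ∀ s, |z s - z 0| ≤ η * max |s| (2 ^ m)) (t : ℝ) (ht : 0 ≤ t) (htm : t ≤ 2 ^ m) :
    supF c z t = supT m c z t := by
  have hp : (0:ℝ) < 2 ^ m := by positivity
  have hup : ∀ s : Set.Iio t, c * (z t - z (↑s)) - (t - ↑s) ≤ supT m c z t := by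
    rintro ⟨s, hs⟩
    have hs : s < t := hs
    simp only
    by_cases hsm : -2 ^ m ≤ s
    · have e : t - (t - s) / (t + 2 ^ m) * (t + 2 ^ m) = s := by
        rw [div_mul_cancel₀ _ (by positivity)]; ring
      have := supT_ge m c z hz t ((t - s) / (t + 2 ^ m))
        ⟨div_nonneg (by linarith) (by linarith), by rw [div_le_one (by linarith)]; linarith⟩
      rw [e, div_mul_cancel₀ _ (by positivity)] at this
      exact this
    · push Not at hsm
      have h0 := supT_ge m c z hz t 0 (by simp)
      simp only [zero_mul, sub_zero, sub_self, mul_zero] at h0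
      have b1 := h t
      have b2 := h s
      rw [abs_of_nonneg ht, max_eq_right htm] at b1
      rw [abs_of_neg (by linarith : s < 0), max_eq_left (by linarith)] at b2
      have b3 : c * (z t - z s) ≤ |c| * (η * 2 ^ m + η * -s) := by
        calc c * (z t - z s) ≤ |c * (z t - z s)| := le_abs_self _
          _ = |c| * |z t - z s| := abs_mul _ _
          _ ≤ _ := by
            gcongr
            have := abs_sub_le (z t) (z 0) (z s)
            rw [abs_sub_comm (z 0) (z s)] at this
            linarith
      have b4 : |c| * (η * 2 ^ m + η * -s) = |c| * η * (2 ^ m + -s) := by ring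
      have b5 : |c| * η * (2 ^ m + -s) ≤ 1 / 4 * (2 ^ m + -s) := by
        apply mul_le_mul_of_nonneg_right hη; linarith
      linarith
  haveI : Nonempty (Set.Iio t) := ⟨⟨t - 1, by simp⟩⟩
  have hbdd : BddAbove (Set.range fun s : Set.Iio t => c * (z t - z (↑s)) - (t - ↑s)) := by
    refine ⟨supT m c z t, ?_⟩
    rintro _ ⟨s, rfl⟩; exact hup s
  apply le_antisymm
  · exact ciSup_le hup
  · have hle : ∀ s, s < t → c * (z t - z s) - (t - s) ≤ supF c z t := fun s hs =>
      le_ciSup hbdd ⟨s, hs⟩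
    have hle' : ∀ s, s ≤ t → c * (z t - z s) - (t - s) ≤ supF c z t := by
      intro s hs
      rcases hs.lt_or_eq with h1 | h1
      · exact hle s h1
      · subst h1
        have hc : Tendsto (fun x => c * (z s - z x) - (s - x)) (𝓝[<] s)
            (𝓝 (c * (z s - z s) - (s - s))) := by
          have : Continuous (fun x => c * (z s - z x) - (s - x)) := by fun_prop
          exact (this.tendsto s).mono_left nhdsWithin_le_nhds
        exact le_of_tendsto hc (eventually_nhdsWithin_of_forall fun x hx => hle x hx)
    apply csSup_le (Set.Nonempty.image _ ⟨0, by simp⟩)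
    rintro _ ⟨θ, hθ, rfl⟩
    have := hle' (t - θ * (t + 2 ^ m)) (by nlinarith [hθ.1])
    simpa using this

lemma clamp_sum (d : ℕ → ℝ) (x : ℝ) (q N : ℕ) (hq : q < N) (h1 : (q:ℝ) ≤ x) (h2 : x ≤ q + 1) :
    ∑ j ∈ Finset.range N, max 0 (min 1 (x - (j : ℕ))) * d j =
      ∑ j ∈ Finset.range q, d j + (x - q) * d q := by
  rw [← Finset.sum_subset (Finset.range_mono hq : Finset.range (q + 1) ⊆ Finset.range N)]
  · rw [Finset.sum_range_succ]
    congr 1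
    · refine Finset.sum_congr rfl fun j hj => ?_
      have hj' : (j:ℝ) + 1 ≤ q := by exact_mod_cast Finset.mem_range.mp hj
      rw [min_eq_left (by linarith), max_eq_right (by norm_num), one_mul]
    · rw [min_eq_right (by linarith), max_eq_right (by linarith)]
  · intro j _ hj
    have hj' : ((q:ℝ) + 1) ≤ j := by
      have : q + 1 ≤ j := by simpa using hj
      exact_mod_cast this
    rw [max_eq_left ((min_le_right _ _).trans (by linarith)), zero_mul]

lemma interp_close {n : ℕ} (m : ℕ) (z : ℝ → Fin n → ℝ) (i : Fin n) (ε : ℝ)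
    (h : ∀ q < 2 * 4 ^ m, ∀ t ∈ Set.Icc (gridPt m q) (gridPt m q + 1 / 2 ^ m),
      |z t i - z (gridPt m q) i| ≤ ε)
    (t : ℝ) (ht : t ∈ Set.Icc (-2 ^ m : ℝ) (2 ^ m)) :
    |interp m (fun j => z (gridPt m j)) t i - z t i| ≤ 2 * ε := by
  have hp : (0:ℝ) < 2 ^ m := by positivity
  set x : ℝ := 2 ^ m * (t + 2 ^ m) with hx
  have h4 : (4:ℝ) ^ m = 2 ^ m * 2 ^ m := by rw [← mul_pow]; norm_num
  have hx0 : 0 ≤ x := mul_nonneg hp.le (by linarith [ht.1])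
  have hx1 : x ≤ 2 * 4 ^ m := by rw [h4, hx]; nlinarith [ht.2]
  have h4n : 0 < 4 ^ m := by positivity
  obtain ⟨q, hq, hq1, hq2⟩ : ∃ q : ℕ, q < 2 * 4 ^ m ∧ (q:ℝ) ≤ x ∧ x ≤ q + 1 := by
    by_cases hlt : x < 2 * 4 ^ m
    · refine ⟨⌊x⌋₊, ?_, Nat.floor_le hx0, (Nat.lt_floor_add_one x).le⟩
      rw [Nat.floor_lt hx0]; push_cast; exact hlt
    · have : x = 2 * 4 ^ m := le_antisymm hx1 (not_lt.mp hlt)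
      refine ⟨2 * 4 ^ m - 1, by omega, ?_, ?_⟩
      · rw [Nat.cast_sub (by omega)]; push_cast; linarith
      · rw [Nat.cast_sub (by omega)]; push_cast; linarith
  have e : interp m (fun j => z (gridPt m j)) t i =
      z (gridPt m q) i + (x - q) * (z (gridPt m (q + 1)) i - z (gridPt m q) i) := by
    unfold interp
    simp only [Fin.val_succ, Fin.val_castSucc, Fin.val_zero]
    rw [← hx, Fin.sum_univ_eq_sum_range (fun j : ℕ => max 0 (min 1 (x - (j : ℕ))) *
      (z (gridPt m (j + 1)) i - z (gridPt m j) i)), clamp_sum _ x q _ hq hq1 hq2,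
      Finset.sum_range_sub (fun j => z (gridPt m j) i)]
    ring
  have hg : gridPt m q + 1 / 2 ^ m = gridPt m (q + 1) := by
    unfold gridPt; push_cast; ring
  have a1 := h q hq (gridPt m (q + 1)) (by
    rw [← hg]; exact ⟨by have : (0:ℝ) < 1 / 2 ^ m := by positivity
                         linarith, le_rfl⟩)
  have htx : t = x / 2 ^ m - 2 ^ m := by rw [hx]; field_simp; ring
  have a2 := h q hq t (by
    constructor
    · rw [htx, gridPt]; gcongr
    · rw [hg, htx, gridPt]; push_cast; gcongr)
  rw [e]
  have a3 : |(x - q) * (z (gridPt m (q + 1)) i - z (gridPt m q) i)| ≤ ε := by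
    rw [abs_mul, abs_of_nonneg (by linarith)]
    have h0 := abs_nonneg (z (gridPt m (q + 1)) i - z (gridPt m q) i)
    nlinarith
  calc |z (gridPt m q) i + (x - q) * (z (gridPt m (q + 1)) i - z (gridPt m q) i) - z t i|
      = |(x - q) * (z (gridPt m (q + 1)) i - z (gridPt m q) i) - (z t i - z (gridPt m q) i)| := by
        congr 1; ring
    _ ≤ _ := abs_sub _ _
    _ ≤ 2 * ε := by linarith



lemma int_close {Ω E : Type*} [MeasurableSpace Ω] (P : Measure Ω) [IsProbabilityMeasure P]
    [PseudoMetricSpace E] [MeasurableSpace E] [BorelSpace E] (U W : Ω → E)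
    (hU : AEMeasurable U P) (hW : AEMeasurable W P) (f : E → ℝ) (C : ℝ)
    (hC : ∀ x y, dist (f x) (f y) ≤ C) (L : NNReal) (hL : LipschitzWith L f) (η b : ℝ)
    (hη : 0 ≤ η) (hb : 0 ≤ b)
    (h : P {ω | η ≤ dist (U ω) (W ω)} ≤ ENNReal.ofReal b) :
    |∫ ω, f (U ω) ∂P - ∫ ω, f (W ω) ∂P| ≤ L * η + C * b := by
  obtain ⟨ω₀⟩ : Nonempty Ω := nonempty_of_isProbabilityMeasure P
  have hC0 : 0 ≤ C := dist_nonneg.trans (hC (U ω₀) (U ω₀))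
  have hfm : Measurable f := hL.continuous.measurable
  have hbd : ∀ x, ‖f x‖ ≤ ‖f (U ω₀)‖ + C := fun x => by
    have := hC x (U ω₀)
    rw [dist_eq_norm] at this
    have := norm_le_norm_add_norm_sub' (f x) (f (U ω₀))
    linarith
  have hiU : Integrable (fun ω => f (U ω)) P :=
    Integrable.of_bound (hfm.comp_aemeasurable hU).aestronglyMeasurable _
      (Eventually.of_forall fun ω => hbd _)
  have hiW : Integrable (fun ω => f (W ω)) P :=
    Integrable.of_bound (hfm.comp_aemeasurable hW).aestronglyMeasurable _
      (Eventually.of_forall fun ω => hbd _)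
  rw [← integral_sub hiU hiW]
  set S := toMeasurable P {ω | η ≤ dist (U ω) (W ω)} with hS
  have hSm : MeasurableSet S := measurableSet_toMeasurable _ _
  have hSP : P.real S ≤ b := by
    rw [Measure.real, hS, measure_toMeasurable]
    exact ENNReal.toReal_le_of_le_ofReal hb h
  have hpt : ∀ ω, ‖f (U ω) - f (W ω)‖ ≤ L * η + S.indicator (fun _ => C) ω := by
    intro ω
    rw [← dist_eq_norm]
    by_cases hω : ω ∈ S
    · rw [Set.indicator_of_mem hω]
      have : 0 ≤ (L:ℝ) * η := by positivity
      linarith [hC (U ω) (W ω)]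
    · rw [Set.indicator_of_notMem hω]
      have : ¬ (η ≤ dist (U ω) (W ω)) := fun hh => hω (subset_toMeasurable _ _ hh)
      push Not at this
      have h2 := hL.dist_le_mul (U ω) (W ω)
      have : (L:ℝ) * dist (U ω) (W ω) ≤ L * η := by gcongr
      linarith
  have hii : Integrable (fun ω => L * η + S.indicator (fun _ => C) ω) P :=
    (integrable_const _).add ((integrable_const _).indicator hSm)
  have := norm_integral_le_of_norm_le hii (Eventually.of_forall hpt)
  rw [Real.norm_eq_abs] at this
  refine this.trans ?_
  rw [integral_add (integrable_const _) ((integrable_const _).indicator hSm),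
    integral_indicator_const _ hSm]
  simp only [integral_const, probReal_univ, smul_eq_mul, one_mul]
  nlinarith

lemma aemeas_of_approx {Ω E : Type*} [MeasurableSpace Ω] (P : Measure Ω) [IsProbabilityMeasure P]
    [PseudoMetricSpace E] [MeasurableSpace E] [BorelSpace E] (A : ℕ → Ω → E) (X : Ω → E)
    (hA : ∀ m, Measurable (A m))
    (h : ∀ ε > 0, ∃ b : ℕ → ℝ, Tendsto b atTop (𝓝 0) ∧
      ∀ m, P {ω | ε ≤ dist (A m ω) (X ω)} ≤ ENNReal.ofReal (b m)) : AEMeasurable X P := by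
  have : TendstoInMeasure P A atTop X := by
    rw [tendstoInMeasure_iff_dist]
    intro ε hε
    obtain ⟨b, hb, hb'⟩ := h ε hε
    have h0 : Tendsto (fun m => ENNReal.ofReal (b m)) atTop (𝓝 0) := by
      simpa using ENNReal.tendsto_ofReal hb
    exact tendsto_of_tendsto_of_tendsto_of_le_of_le tendsto_const_nhds h0 (fun _ => zero_le) hb'
  exact this.aemeasurable (fun m => (hA m).aemeasurable)

lemma approx_weak {Ω Ω' E : Type*} [MeasurableSpace Ω] [MeasurableSpace Ω']
    (P : Measure Ω) (P' : Measure Ω') [IsProbabilityMeasure P] [IsProbabilityMeasure P']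
    [PseudoMetricSpace E] [MeasurableSpace E] [BorelSpace E]
    (A : ℕ → ℕ → Ω → E) (A' : ℕ → Ω' → E) (X : ℕ → Ω → E) (Y : Ω' → E)
    (hA : ∀ m k, Measurable (A m k)) (hA' : ∀ m, Measurable (A' m))
    (h1 : ∀ m, ∀ f : BoundedContinuousFunction E ℝ,
      Tendsto (fun k => ∫ ω, f (A m k ω) ∂P) atTop (𝓝 (∫ ω, f (A' m ω) ∂P')))
    (h2 : ∀ ε > 0, ∃ b : ℕ → ℝ, Tendsto b atTop (𝓝 0) ∧
      ∀ m k, P {ω | ε ≤ dist (A m k ω) (X k ω)} ≤ ENNReal.ofReal (b m))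
    (h3 : ∀ ε > 0, ∃ b : ℕ → ℝ, Tendsto b atTop (𝓝 0) ∧
      ∀ m, P' {ω | ε ≤ dist (A' m ω) (Y ω)} ≤ ENNReal.ofReal (b m))
    (F : BoundedContinuousFunction E ℝ) :
    Tendsto (fun k => ∫ ω, F (X k ω) ∂P) atTop (𝓝 (∫ ω, F (Y ω) ∂P')) := by
  have hX : ∀ k, AEMeasurable (X k) P := fun k => by
    refine aemeas_of_approx P (fun m => A m k) (X k) (fun m => hA m k) fun ε hε => ?_
    obtain ⟨b, hb, hb'⟩ := h2 ε hε
    exact ⟨b, hb, fun m => hb' m k⟩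
  have hY : AEMeasurable Y P' := aemeas_of_approx P' A' Y hA' h3
  let μs : ℕ → ProbabilityMeasure E := fun k => ⟨P.map (X k), Measure.isProbabilityMeasure_map (hX k)⟩
  let μ : ProbabilityMeasure E := ⟨P'.map Y, Measure.isProbabilityMeasure_map hY⟩
  have main : Tendsto μs atTop (𝓝 μ) := by
    rw [tendsto_iff_forall_lipschitz_integral_tendsto]
    rintro f ⟨C, hC⟩ ⟨L, hL⟩
    have e1 : ∀ k, ∫ x, f x ∂(μs k : Measure E) = ∫ ω, f (X k ω) ∂P := fun k =>
      integral_map (hX k) hL.continuous.aestronglyMeasurable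
    have e2 : ∫ x, f x ∂(μ : Measure E) = ∫ ω, f (Y ω) ∂P' :=
      integral_map hY hL.continuous.aestronglyMeasurable
    simp_rw [e1]
    rw [e2, Metric.tendsto_atTop]
    intro ε hε
    set η : ℝ := ε / (8 * (L + 1)) with hη
    have hη0 : 0 < η := by positivity
    have hLη : L * η ≤ ε / 8 := by
      rw [hη, mul_div_assoc', div_le_div_iff₀ (by positivity) (by positivity)]
      nlinarith
    obtain ⟨b, hb, hb'⟩ := h2 η hη0
    obtain ⟨d, hd, hd'⟩ := h3 η hη0
    have hC0 : 0 ≤ |C| := abs_nonneg C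
    have hC' : ∀ x y, dist (f x) (f y) ≤ |C| := fun x y => (hC x y).trans (le_abs_self C)
    have hsmall : ∀ᶠ m in atTop, |C| * |b m| < ε / 8 ∧ |C| * |d m| < ε / 8 := by
      have t1 : Tendsto (fun m => |C| * |b m|) atTop (𝓝 0) := by
        simpa using hb.abs.const_mul |C|
      have t2 : Tendsto (fun m => |C| * |d m|) atTop (𝓝 0) := by
        simpa using hd.abs.const_mul |C|
      exact (t1.eventually_lt_const (by positivity)).and (t2.eventually_lt_const (by positivity))
    obtain ⟨m, hm1, hm2⟩ := hsmall.exists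
    obtain ⟨N, hN⟩ := Metric.tendsto_atTop.mp (h1 m (BoundedContinuousFunction.mkOfBound
      ⟨f, hL.continuous⟩ C hC)) (ε / 8) (by positivity)
    refine ⟨N, fun k hk => ?_⟩
    have c1 := int_close P (A m k) (X k) (hA m k).aemeasurable (hX k) f |C| hC' L hL η |b m|
      hη0.le (abs_nonneg _) ((hb' m k).trans (ENNReal.ofReal_le_ofReal (le_abs_self _)))
    have c2 := int_close P' (A' m) Y (hA' m).aemeasurable hY f |C| hC' L hL η |d m|
      hη0.le (abs_nonneg _) ((hd' m).trans (ENNReal.ofReal_le_ofReal (le_abs_self _)))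
    have c3 := hN k hk
    simp only [BoundedContinuousFunction.mkOfBound_coe, ContinuousMap.coe_mk, Real.dist_eq] at c3
    rw [Real.dist_eq]
    rw [abs_le] at c1 c2
    rw [abs_lt] at c3 ⊢
    constructor <;> linarith
  have := (ProbabilityMeasure.tendsto_iff_forall_integral_tendsto.mp main) F
  have e1 : ∀ k, ∫ x, F x ∂(μs k : Measure E) = ∫ ω, F (X k ω) ∂P := fun k =>
    integral_map (hX k) F.continuous.aestronglyMeasurable
  have e2 : ∫ x, F x ∂(μ : Measure E) = ∫ ω, F (Y ω) ∂P' :=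
    integral_map hY F.continuous.aestronglyMeasurable
  simp_rw [e1] at this
  rwa [e2] at this



lemma closeness {n : ℕ} (γ γ' : ℝ) (hγ : 0 < γ) (hγγ : γ ≤ γ') (hγ' : γ' < 1) (p : ℕ)
    (hp : 4 ≤ p * γ) (D : ℝ) (hD : 0 ≤ D) (c : Fin n → ℝ) (ε T : ℝ) (hε : 0 < ε) :
    ∃ b : ℕ → ℝ, Tendsto b atTop (𝓝 0) ∧ ∀ {Ω : Type*} [MeasurableSpace Ω] (P : Measure Ω)
      (_ : IsProbabilityMeasure P) (Z : ℝ → Ω → Fin n → ℝ)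
      (_ : ∀ ω i, Continuous fun t => Z t ω i)
      (_ : ∀ i, IncB P (fun t ω => Z t ω i) D p γ γ') (m : ℕ),
      P {ω | ∃ t ∈ Set.Icc 0 T, ∃ i, ε ≤ |supT m (c i)
        (fun s => interp m (fun j => Z (gridPt m j) ω) s i) t - supF (c i) (fun s => Z s ω i) t|}
        ≤ ENNReal.ofReal (b m) := by
  set M : ℝ := ∑ i, |c i| + 1 with hM
  have hM0 : 0 < M := by positivity
  have hcM : ∀ i, |c i| ≤ M := fun i => by
    have := Finset.single_le_sum (f := fun i => |c i|) (fun i _ => abs_nonneg _)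
      (Finset.mem_univ i)
    linarith
  obtain ⟨b1, hb1, hb1'⟩ := modulus_bound γ γ' hγ hγγ p hp D hD (ε / (8 * M)) (by positivity)
  obtain ⟨b2, hb2, hb2'⟩ := growth_bound γ γ' hγ hγγ hγ' p hp D hD (1 / (4 * M)) (by positivity)
  refine ⟨fun m => if T ≤ 2 ^ m then n * (|b1 m| + |b2 m|) else 1, ?_, ?_⟩
  · have h0 : Tendsto (fun m => (n:ℝ) * (|b1 m| + |b2 m|)) atTop (𝓝 0) := by
      simpa using (hb1.abs.add hb2.abs).const_mul (n:ℝ)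
    refine h0.congr' ?_
    have := (tendsto_pow_atTop_atTop_of_one_lt (by norm_num : (1:ℝ) < 2)).eventually_ge_atTop T
    filter_upwards [this] with m hm
    rw [if_pos hm]
  intro Ω _ P _ Z hZ hI m
  simp only
  split_ifs with hT
  swap
  · simpa using prob_le_one
  set E1 : Fin n → Set Ω := fun i => {ω | ∃ q < 2 * 4 ^ m,
    ∃ t ∈ Set.Icc (gridPt m q) (gridPt m q + 1 / 2 ^ m),
        ε / (8 * M) < |Z t ω i - Z (gridPt m q) ω i|} with hE1
  set E2 : Fin n → Set Ω := fun i =>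
    {ω | ∃ s : ℝ, 1 / (4 * M) * max |s| (2 ^ m) < |Z s ω i - Z 0 ω i|} with hE2
  have hsub : {ω | ∃ t ∈ Set.Icc 0 T, ∃ i, ε ≤ |supT m (c i)
        (fun s => interp m (fun j => Z (gridPt m j) ω) s i) t - supF (c i) (fun s => Z s ω i) t|}
        ⊆ ⋃ i, (E1 i ∪ E2 i) := by
    rintro ω ⟨t, ht, i, hi⟩
    by_contra hcon
    simp only [Set.mem_iUnion, Set.mem_union, not_exists, not_or] at hcon
    obtain ⟨n1, n2⟩ := hcon i
    simp only [hE1, hE2, Set.mem_ofPred_eq] at n1 n2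
    push Not at n1 n2
    have e1 := supF_eq_supT m (c i) (1 / (4 * M)) (by
      rw [mul_one_div, div_le_div_iff₀ (by positivity) (by norm_num)]
      linarith [hcM i]) (fun s => Z s ω i) (hZ ω i) n2 t ht.1 (ht.2.trans hT)
    rw [e1] at hi
    have hci := continuous_interp (n := n) m i
    have := supT_dist_le m (c i) (fun s => interp m (fun j => Z (gridPt m j) ω) s i)
      (fun s => Z s ω i) (by
        exact hci.comp ((continuous_const (y := fun j : Fin (2 * 4 ^ m + 1) => Z (gridPt m j) ω)).prodMk continuous_id)) (hZ ω i) t ht.1 (2 * (ε / (8 * M))) (by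
        intro s hs
        exact interp_close m (fun s => Z s ω) i _ n1 s ⟨hs.1, hs.2.trans (ht.2.trans hT)⟩)
    have h3 : 2 * |c i| * (2 * (ε / (8 * M))) ≤ ε / 2 := by
      have : 2 * |c i| * (2 * (ε / (8 * M))) = |c i| / M * (ε / 2) := by field_simp; ring
      rw [this]
      have : |c i| / M ≤ 1 := by rw [div_le_one hM0]; exact hcM i
      nlinarith
    linarith
  refine (measure_mono hsub).trans ((measure_iUnion_fintype_le _ _).trans ?_)
  calc ∑ i, P (E1 i ∪ E2 i) ≤ ∑ i : Fin n, ENNReal.ofReal (|b1 m| + |b2 m|) := by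
        refine Finset.sum_le_sum fun i _ => (measure_union_le _ _).trans ?_
        rw [ENNReal.ofReal_add (abs_nonneg _) (abs_nonneg _)]
        refine add_le_add ?_ ?_
        · exact (hb1' P _ (fun ω => hZ ω i) (hI i) m).trans
            (ENNReal.ofReal_le_ofReal (le_abs_self _))
        · exact (hb2' P _ (fun ω => hZ ω i) (hI i) m).trans
            (ENNReal.ofReal_le_ofReal (le_abs_self _))
    _ = ENNReal.ofReal (n * (|b1 m| + |b2 m|)) := by
        rw [ENNReal.ofReal_mul (by positivity)]
        simp

lemma ae_cont {Ω : Type*} [MeasurableSpace Ω] (γ γ' : ℝ) (hγ : 0 < γ) (hγγ : γ ≤ γ') (hγ' : γ' < 1)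
    (p : ℕ) (hp : 4 ≤ p * γ) (D : ℝ) (hD : 0 ≤ D) (c : ℝ) (P : Measure Ω)
    (Z : ℝ → Ω → ℝ) (hZ : ∀ ω, Continuous fun t => Z t ω) (hI : IncB P Z D p γ γ') :
    ∀ᵐ ω ∂P, ContinuousOn (fun t => supF c (fun s => Z s ω) t) (Set.Ici 0) := by
  set η : ℝ := 1 / (4 * (|c| + 1)) with hη
  have hη0 : 0 < η := by positivity
  obtain ⟨b, hb, hb'⟩ := growth_bound γ γ' hγ hγγ hγ' p hp D hD η hη0
  have hnull : P (⋂ m : ℕ, {ω | ∃ s : ℝ, η * max |s| (2 ^ m) < |Z s ω - Z 0 ω|}) = 0 := by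
    have h0 : Tendsto (fun m => ENNReal.ofReal (b m)) atTop (𝓝 0) := by
      simpa using ENNReal.tendsto_ofReal hb
    refine le_antisymm (ge_of_tendsto' h0 fun m => ?_) zero_le
    exact (measure_mono (Set.iInter_subset _ m)).trans (hb' P Z hZ hI m)
  rw [measure_eq_zero_iff_ae_notMem] at hnull
  filter_upwards [hnull] with ω hω
  simp only [Set.mem_iInter, not_forall, Set.mem_ofPred_eq] at hω
  obtain ⟨m0, hm0⟩ := hω
  push Not at hm0
  have hc : |c| * η ≤ 1 / 4 := by
    rw [hη, mul_one_div, div_le_div_iff₀ (by positivity) (by norm_num)]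
    linarith
  have key : ∀ m, m0 ≤ m → ∀ t, 0 ≤ t → t ≤ 2 ^ m →
      supF c (fun s => Z s ω) t = supT m c (fun s => Z s ω) t := by
    intro m hm t ht htm
    refine supF_eq_supT m c η hc _ (hZ ω) (fun s => (hm0 s).trans ?_) t ht htm
    gcongr
    norm_num
  intro t ht
  obtain ⟨m, hm, htm⟩ : ∃ m, m0 ≤ m ∧ t < 2 ^ m :=
    ((eventually_ge_atTop m0).and
      ((tendsto_pow_atTop_atTop_of_one_lt (by norm_num : (1:ℝ) < 2)).eventually_gt_atTop t)).exists
  have h1 := ((continuous_supT m c (fun s => Z s ω) (hZ ω)).continuousWithinAt (s := Set.Ici 0)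
    (x := t))
  refine h1.congr_of_eventuallyEq ?_ (key m hm t ht htm.le)
  filter_upwards [self_mem_nhdsWithin, mem_nhdsWithin_of_mem_nhds (Iio_mem_nhds htm)] with s hs hs'
  exact key m hm s hs (le_of_lt hs')

instance icc_lc : WeaklyLocallyCompactSpace (Set.Ici (0:ℝ)) :=
  haveI : LocallyCompactSpace (Set.Ici (0:ℝ)) :=
    (isClosed_Ici (a := (0:ℝ))).isClosedEmbedding_subtypeVal.locallyCompactSpace
  inferInstance

instance icc_sc : SigmaCompactSpace (Set.Ici (0:ℝ)) :=
  (isClosed_Ici (a := (0:ℝ))).isClosedEmbedding_subtypeVal.sigmaCompactSpace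

lemma entourage_dist {n : ℕ} :
    letI : PseudoMetricSpace C(Set.Ici (0:ℝ), Fin n → ℝ) := UniformSpace.pseudoMetricSpace _
    ∀ ε > 0, ∃ T η : ℝ, 0 < η ∧ ∀ f g : C(Set.Ici (0:ℝ), Fin n → ℝ),
      (∀ t : Set.Ici (0:ℝ), (t : ℝ) ≤ T → ∀ i, |f t i - g t i| < η) → dist f g < ε := by
  letI : PseudoMetricSpace C(Set.Ici (0:ℝ), Fin n → ℝ) := UniformSpace.pseudoMetricSpace _
  intro ε hε
  have h1 := Metric.dist_mem_uniformity (α := C(Set.Ici (0:ℝ), Fin n → ℝ)) hε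
  have hbas := Filter.HasBasis.compactConvergenceUniformity (α := Set.Ici (0:ℝ))
    (Metric.uniformity_basis_dist (α := Fin n → ℝ))
  obtain ⟨⟨K, η⟩, ⟨hK, hη⟩, hsub⟩ := hbas.mem_iff.1 h1
  simp only at hK hη hsub
  obtain ⟨T, hT⟩ := ((hK.image continuous_subtype_val).bddAbove)
  refine ⟨T, η, hη, fun f g hfg => ?_⟩
  have : (f, g) ∈ {p : C(Set.Ici (0:ℝ), Fin n → ℝ) × C(Set.Ici (0:ℝ), Fin n → ℝ) | dist p.1 p.2 < ε} := by
    apply hsub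
    intro x hx
    have hx' : (x : ℝ) ≤ T := hT ⟨x, hx, rfl⟩
    change dist (f x) (g x) < η
    rw [dist_pi_lt_iff hη]
    intro i
    rw [Real.dist_eq]
    exact hfg x hx' i
  exact this

open Classical in
/-- Path of the reflected process as a continuous map (zero if not continuous). -/
def pathMap {n : ℕ} (c : Fin n → ℝ) (z : ℝ → Fin n → ℝ) : C(Set.Ici (0:ℝ), Fin n → ℝ) :=
  if h : Continuous (fun (t : Set.Ici (0:ℝ)) i => supF (c i) (fun s => z s i) t) then ⟨_, h⟩ else 0

/-- Approximating path. -/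
def pathApprox {n : ℕ} (m : ℕ) (c : Fin n → ℝ) (v : Fin (2 * 4 ^ m + 1) → Fin n → ℝ) :
    C(Set.Ici (0:ℝ), Fin n → ℝ) :=
  ⟨fun t i => supT m (c i) (fun s => interp m v s i) t,
    (continuous_supT_interp m c).comp
      ((continuous_const (y := v)).prodMk continuous_subtype_val)⟩

lemma continuous_pathApprox {n : ℕ} (m : ℕ) (c : Fin n → ℝ) :
    Continuous (pathApprox (n := n) m c) := by
  apply ContinuousMap.continuous_of_continuous_uncurry
  exact (continuous_supT_interp m c).comp
    (continuous_fst.prodMk (continuous_subtype_val.comp continuous_snd))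

lemma approx_prob {n : ℕ} (γ γ' : ℝ) (hγ : 0 < γ) (hγγ : γ ≤ γ') (hγ' : γ' < 1) (p : ℕ)
    (hp : 4 ≤ p * γ) (D : ℝ) (hD : 0 ≤ D) (c : Fin n → ℝ) :
    letI : PseudoMetricSpace C(Set.Ici (0:ℝ), Fin n → ℝ) := UniformSpace.pseudoMetricSpace _
    ∀ ε > 0, ∃ b : ℕ → ℝ, Tendsto b atTop (𝓝 0) ∧ ∀ {Ω : Type*} [MeasurableSpace Ω]
      (P : Measure Ω)
      (_ : IsProbabilityMeasure P) (Z : ℝ → Ω → Fin n → ℝ)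
      (_ : ∀ ω i, Continuous fun t => Z t ω i)
      (_ : ∀ i, IncB P (fun t ω => Z t ω i) D p γ γ') (m : ℕ),
      P {ω | ε ≤ dist (pathApprox m c (fun j => Z (gridPt m j) ω)) (pathMap c (fun s => Z s ω))}
        ≤ ENNReal.ofReal (b m) := by
  letI : PseudoMetricSpace C(Set.Ici (0:ℝ), Fin n → ℝ) := UniformSpace.pseudoMetricSpace _
  intro ε hε
  obtain ⟨T, η, hη, hdist⟩ := entourage_dist (n := n) ε hε
  obtain ⟨b, hb, hb'⟩ := closeness γ γ' hγ hγγ hγ' p hp D hD c η T hη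
  refine ⟨b, hb, ?_⟩
  intro Ω _ P hP Z hZ hI m
  refine le_trans (measure_mono_ae ?_) (hb' P hP Z hZ hI m)
  have hall : ∀ᵐ ω ∂P, ∀ i, ContinuousOn (fun t => supF (c i) (fun s => Z s ω i) t) (Set.Ici 0) :=
    ae_all_iff.2 fun i => ae_cont γ γ' hγ hγγ hγ' p hp D hD (c i) P _ (fun ω => hZ ω i) (hI i)
  filter_upwards [hall] with ω hω h
  have h : ε ≤ dist (pathApprox m c (fun j => Z (gridPt m j) ω)) (pathMap c (fun s => Z s ω)) := h
  by_contra hcon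
  refine absurd h (not_le.2 (hdist _ _ fun t ht i => ?_))
  by_contra hlt
  refine hcon ⟨t, ⟨t.2, ht⟩, i, ?_⟩
  have hc : Continuous (fun (t : Set.Ici (0:ℝ)) i => supF (c i) (fun s => Z s ω i) t) :=
    continuous_pi fun i => continuousOn_iff_continuous_domRestrict.1 (hω i)
  rw [pathMap, dif_pos hc] at hlt
  exact not_lt.1 hlt

theorem weak_conv {Ω Ω' : Type*} [MeasurableSpace Ω] [MeasurableSpace Ω']
    (P : Measure Ω) (P' : Measure Ω') [IsProbabilityMeasure P] [IsProbabilityMeasure P']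
    {n : ℕ} (γ γ' : ℝ) (hγ : 0 < γ) (hγγ : γ ≤ γ') (hγ' : γ' < 1) (p : ℕ)
    (hp : 4 ≤ p * γ) (D : ℝ) (hD : 0 ≤ D) (c : Fin n → ℝ)
    (Z : ℕ → ℝ → Ω → Fin n → ℝ) (W : ℝ → Ω' → Fin n → ℝ)
    (hZm : ∀ k t, Measurable (Z k t)) (hWm : ∀ t, Measurable (W t))
    (hZ : ∀ k ω i, Continuous fun t => Z k t ω i) (hW : ∀ ω i, Continuous fun t => W t ω i)
    (hZI : ∀ k i, IncB P (fun t ω => Z k t ω i) D p γ γ')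
    (hWI : ∀ i, IncB P' (fun t ω => W t ω i) D p γ γ')
    (hfdd : ∀ (N : ℕ) (τ : Fin N → ℝ) (f : BoundedContinuousFunction (Fin N → Fin n → ℝ) ℝ),
      Tendsto (fun k => ∫ ω, f (fun a => Z k (τ a) ω) ∂P) atTop
        (𝓝 (∫ ω, f (fun a => W (τ a) ω) ∂P')))
    (F : BoundedContinuousFunction
      (UniformOnFun (Set.Ici (0:ℝ)) (Fin n → ℝ) {K : Set (Set.Ici (0:ℝ)) | IsCompact K}) ℝ) :
    Tendsto (fun k => ∫ ω, F (UniformOnFun.ofFun {K : Set (Set.Ici (0:ℝ)) | IsCompact K}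
          (fun (t : Set.Ici (0:ℝ)) i => supF (c i) (fun s => Z k s ω i) t)) ∂P)
      atTop
      (𝓝 (∫ ω, F (UniformOnFun.ofFun {K : Set (Set.Ici (0:ℝ)) | IsCompact K}
          (fun (t : Set.Ici (0:ℝ)) i => supF (c i) (fun s => W s ω i) t)) ∂P')) := by
  letI : PseudoMetricSpace C(Set.Ici (0:ℝ), Fin n → ℝ) := UniformSpace.pseudoMetricSpace _
  letI : MeasurableSpace C(Set.Ici (0:ℝ), Fin n → ℝ) := borel _
  haveI : BorelSpace C(Set.Ici (0:ℝ), Fin n → ℝ) := ⟨rfl⟩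
  let G : BoundedContinuousFunction C(Set.Ici (0:ℝ), Fin n → ℝ) ℝ :=
    F.compContinuous ⟨ContinuousMap.toUniformOnFunIsCompact,
      ContinuousMap.isUniformEmbedding_toUniformOnFunIsCompact.uniformContinuous.continuous⟩
  have hallZ : ∀ k, ∀ᵐ ω ∂P, ∀ i,
      ContinuousOn (fun t => supF (c i) (fun s => Z k s ω i) t) (Set.Ici 0) := fun k =>
    ae_all_iff.2 fun i =>
      ae_cont γ γ' hγ hγγ hγ' p hp D hD (c i) P _ (fun ω => hZ k ω i) (hZI k i)
  have hallW : ∀ᵐ ω ∂P', ∀ i,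
      ContinuousOn (fun t => supF (c i) (fun s => W s ω i) t) (Set.Ici 0) :=
    ae_all_iff.2 fun i =>
      ae_cont γ γ' hγ hγγ hγ' p hp D hD (c i) P' _ (fun ω => hW ω i) (hWI i)
  have hpt : ∀ z : ℝ → Fin n → ℝ,
      (∀ i, ContinuousOn (fun t => supF (c i) (fun s => z s i) t) (Set.Ici 0)) →
      G (pathMap c z) = F (UniformOnFun.ofFun {K : Set (Set.Ici (0:ℝ)) | IsCompact K}
          (fun (t : Set.Ici (0:ℝ)) i => supF (c i) (fun s => z s i) t)) := by
    intro z hz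
    have hc : Continuous (fun (t : Set.Ici (0:ℝ)) i => supF (c i) (fun s => z s i) t) :=
      continuous_pi fun i => continuousOn_iff_continuous_domRestrict.1 (hz i)
    rw [pathMap, dif_pos hc]
    rfl
  have eZ : ∀ k, ∫ ω, F (UniformOnFun.ofFun {K : Set (Set.Ici (0:ℝ)) | IsCompact K}
          (fun (t : Set.Ici (0:ℝ)) i => supF (c i) (fun s => Z k s ω i) t)) ∂P =
      ∫ ω, G (pathMap c (fun s => Z k s ω)) ∂P := fun k => by
    refine integral_congr_ae ?_
    filter_upwards [hallZ k] with ω hω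
    exact (hpt _ hω).symm
  have eW : ∫ ω, F (UniformOnFun.ofFun {K : Set (Set.Ici (0:ℝ)) | IsCompact K}
          (fun (t : Set.Ici (0:ℝ)) i => supF (c i) (fun s => W s ω i) t)) ∂P' =
      ∫ ω, G (pathMap c (fun s => W s ω)) ∂P' := by
    refine integral_congr_ae ?_
    filter_upwards [hallW] with ω hω
    exact (hpt _ hω).symm
  simp_rw [eZ]
  rw [eW]
  refine approx_weak P P' (fun m k ω => pathApprox m c (fun j => Z k (gridPt m j) ω))
    (fun m ω => pathApprox m c (fun j => W (gridPt m j) ω))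
    (fun k ω => pathMap c (fun s => Z k s ω)) (fun ω => pathMap c (fun s => W s ω))
    ?_ ?_ ?_ ?_ ?_ G
  · intro m k
    exact (continuous_pathApprox m c).measurable.comp (measurable_pi_lambda _ fun j => hZm k _)
  · intro m
    exact (continuous_pathApprox m c).measurable.comp (measurable_pi_lambda _ fun j => hWm _)
  · intro m f
    exact hfdd (2 * 4 ^ m + 1) (fun j => gridPt m j)
      (f.compContinuous ⟨pathApprox m c, continuous_pathApprox m c⟩)
  · intro ε hε
    obtain ⟨b, hb, hb'⟩ := approx_prob γ γ' hγ hγγ hγ' p hp D hD c ε hε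
    exact ⟨b, hb, fun m k => hb' P inferInstance (Z k) (hZ k) (hZI k) m⟩
  · intro ε hε
    obtain ⟨b, hb, hb'⟩ := approx_prob γ γ' hγ hγγ hγ' p hp D hD c ε hε
    exact ⟨b, hb, fun m => hb' P' inferInstance W hW hWI m⟩



lemma gauss_tail (p : ℕ) : ∃ M : ℝ, 0 ≤ M ∧ ∀ {Ω : Type*} [MeasurableSpace Ω] (P : Measure Ω)
    (X : Ω → ℝ) (_ : Measurable X) (v : NNReal) (_ : P.map X = gaussianReal 0 v) (s : ℝ)
    (_ : 0 ≤ s) (_ : (v : ℝ) ≤ s ^ 2) (x : ℝ) (_ : 0 < x),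
    P {ω | x ≤ |X ω|} ≤ ENNReal.ofReal (M * (s / x) ^ p) := by
  refine ⟨∫ y, |y| ^ p ∂(gaussianReal 0 1), integral_nonneg fun y => by positivity, ?_⟩
  intro Ω _ P X hX v hv s hs hvs x hx
  have hmeas : MeasurableSet {y : ℝ | x ≤ |y|} := measurableSet_le measurable_const measurable_id.abs
  have e1 : P {ω | x ≤ |X ω|} = (gaussianReal 0 v) {y : ℝ | x ≤ |y|} := by
    rw [← hv, Measure.map_apply hX hmeas]; rfl
  have e2 : gaussianReal 0 v = (gaussianReal 0 1).map (fun y => √v * y) := by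
    rw [gaussianReal_map_const_mul]
    congr 1
    · simp
    · ext; simp [Real.sq_sqrt]
  rw [e1, e2, Measure.map_apply (by fun_prop) hmeas]
  have hIntg : Integrable (fun y : ℝ => |s * y| ^ p) (gaussianReal 0 1) := by
    have h := (memLp_id_gaussianReal (μ := 0) (v := 1) (p : NNReal)).integrable_norm_pow'
    have h2 := h.const_mul (|s| ^ p)
    refine h2.congr (ae_of_all _ fun y => ?_)
    simp [abs_mul, mul_pow]
  have hsub : (fun y => √v * y) ⁻¹' {y : ℝ | x ≤ |y|} ⊆ {y : ℝ | x ^ p ≤ |s * y| ^ p} := by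
    intro y hy
    have hy : x ≤ |√v * y| := hy
    refine pow_le_pow_left₀ hx.le (hy.trans ?_) p
    rw [abs_mul, abs_mul, abs_of_nonneg (Real.sqrt_nonneg _), abs_of_nonneg hs]
    exact mul_le_mul_of_nonneg_right (Real.sqrt_le_iff.2 ⟨hs, hvs⟩) (abs_nonneg _)
  refine (measure_mono hsub).trans ?_
  have hmk := mul_meas_ge_le_integral_of_nonneg (ae_of_all _ fun y => by positivity) hIntg (x ^ p)
  rw [← ofReal_measureReal]
  refine ENNReal.ofReal_le_ofReal ?_
  have e3 : ∫ y, |s * y| ^ p ∂(gaussianReal 0 1) = s ^ p * ∫ y, |y| ^ p ∂(gaussianReal 0 1) := by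
    rw [← integral_const_mul]
    refine integral_congr_ae (ae_of_all _ fun y => ?_)
    simp [abs_mul, mul_pow, abs_of_nonneg hs]
  rw [e3] at hmk
  rw [div_pow, mul_div_assoc', le_div_iff₀ (by positivity)]
  linarith

lemma charFun_fdd {Ω₁ : Type*} [MeasurableSpace Ω₁] (Q : Measure Ω₁) {n : ℕ}
    (V : ℝ → Ω₁ → Fin n → ℝ) (KK : Fin n → Fin n → ℝ → ℝ → ℝ) (hV : IsCenteredGaussianVec Q V KK)
    (N : ℕ) (τ : Fin N → ℝ) (e : EuclideanSpace ℝ (Fin N × Fin n)) :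
    charFun (Q.map (fun ω => (WithLp.toLp 2 (fun q => V (τ q.1) ω q.2) :
        EuclideanSpace ℝ (Fin N × Fin n)))) e =
      Complex.exp (-((∑ a, ∑ b, ∑ i, ∑ j, e (a, i) * e (b, j) * KK i j (τ a) (τ b)).toNNReal : ℝ)
          / 2) := by
  have hm : Measurable (fun ω => (WithLp.toLp 2 (fun q => V (τ q.1) ω q.2) : EuclideanSpace ℝ (Fin N × Fin n))) :=
    (WithLp.measurable_toLp 2 _).comp (measurable_pi_lambda _ fun q => hV.1 _ _)
  have hg := hV.2 N τ (fun a i => e (a, i))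
  have hc := charFun_gaussianReal (μ := 0) (v := (∑ a, ∑ b, ∑ i, ∑ j,
    e (a, i) * e (b, j) * KK i j (τ a) (τ b)).toNNReal) 1
  rw [← hg, charFun_apply_real, integral_map (by
    refine Measurable.aemeasurable ?_
    refine Finset.measurable_sum _ fun a _ => Finset.measurable_sum _ fun i _ => ?_
    exact (hV.1 _ _).const_mul _) (by fun_prop)] at hc
  rw [charFun_apply, integral_map hm.aemeasurable (by fun_prop)]
  convert hc using 1
  · refine integral_congr_ae (ae_of_all _ fun ω => ?_)
    simp only [Complex.ofReal_one, one_mul]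
    congr 3
    rw [PiLp.inner_apply, Fintype.sum_prod_type]
    simp
  · simp [neg_div]

lemma fdd_conv {Ω Ω' : Type*} [MeasurableSpace Ω] [MeasurableSpace Ω']
    (P : Measure Ω) (P' : Measure Ω') [IsProbabilityMeasure P] [IsProbabilityMeasure P']
    {n : ℕ} (Z : ℕ → ℝ → Ω → Fin n → ℝ) (W : ℝ → Ω' → Fin n → ℝ)
    (K : ℕ → Fin n → Fin n → ℝ → ℝ → ℝ) (K' : Fin n → Fin n → ℝ → ℝ → ℝ)
    (hZ : ∀ k, IsCenteredGaussianVec P (Z k) (K k)) (hW : IsCenteredGaussianVec P' W K')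
    (hK : ∀ i j t s, Tendsto (fun k => K k i j t s) atTop (𝓝 (K' i j t s)))
    (N : ℕ) (τ : Fin N → ℝ) (f : BoundedContinuousFunction (Fin N → Fin n → ℝ) ℝ) :
    Tendsto (fun k => ∫ ω, f (fun a => Z k (τ a) ω) ∂P) atTop
        (𝓝 (∫ ω, f (fun a => W (τ a) ω) ∂P')) := by
  let E := EuclideanSpace ℝ (Fin N × Fin n)
  let X : ℕ → Ω → E := fun k ω => WithLp.toLp 2 (fun q => Z k (τ q.1) ω q.2)
  let Y : Ω' → E := fun ω => WithLp.toLp 2 (fun q => W (τ q.1) ω q.2)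
  have hX : ∀ k, Measurable (X k) := fun k =>
    (WithLp.measurable_toLp 2 _).comp (measurable_pi_lambda _ fun q => (hZ k).1 _ _)
  have hY : Measurable Y :=
    (WithLp.measurable_toLp 2 _).comp (measurable_pi_lambda _ fun q => hW.1 _ _)
  let μs : ℕ → ProbabilityMeasure E := fun k =>
    ⟨P.map (X k), Measure.isProbabilityMeasure_map (hX k).aemeasurable⟩
  let μ : ProbabilityMeasure E := ⟨P'.map Y, Measure.isProbabilityMeasure_map hY.aemeasurable⟩
  have main : Tendsto μs atTop (𝓝 μ) := by
    rw [ProbabilityMeasure.tendsto_iff_tendsto_charFun]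
    intro e
    change Tendsto (fun k => charFun (P.map (X k)) e) atTop (𝓝 (charFun (P'.map Y) e))
    have e1 := fun k => charFun_fdd P (Z k) (K k) (hZ k) N τ e
    have e2 := charFun_fdd P' W K' hW N τ e
    change ∀ k, charFun (P.map (X k)) e = _ at e1
    change charFun (P'.map Y) e = _ at e2
    simp_rw [e1, e2]
    refine (Complex.continuous_exp.tendsto _).comp (Tendsto.div_const (Tendsto.neg ?_) _)
    refine (Complex.continuous_ofReal.tendsto _).comp ?_
    refine (NNReal.continuous_coe.tendsto _).comp ?_
    refine (continuous_real_toNNReal.tendsto _).comp ?_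
    refine tendsto_finsetSum _ fun a _ => tendsto_finsetSum _ fun b _ =>
      tendsto_finsetSum _ fun i _ => tendsto_finsetSum _ fun j _ => ?_
    exact (hK i j _ _).const_mul _
  have hL : Continuous fun (x : E) (a : Fin N) (i : Fin n) => x (a, i) :=
    continuous_pi fun a => continuous_pi fun i =>
      (continuous_apply (a, i)).comp (PiLp.continuous_ofLp 2 _)
  have h := (ProbabilityMeasure.tendsto_iff_forall_integral_tendsto.1 main)
    (f.compContinuous ⟨_, hL⟩)
  have e1 : ∀ k, ∫ x, (f.compContinuous ⟨_, hL⟩) x ∂(μs k : Measure E) =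
      ∫ ω, f (fun a => Z k (τ a) ω) ∂P := fun k =>
    integral_map (hX k).aemeasurable (f.compContinuous ⟨_, hL⟩).continuous.aestronglyMeasurable
  have e2 : ∫ x, (f.compContinuous ⟨_, hL⟩) x ∂(μ : Measure E) =
      ∫ ω, f (fun a => W (τ a) ω) ∂P' :=
    integral_map hY.aemeasurable (f.compContinuous ⟨_, hL⟩).continuous.aestronglyMeasurable
  simp_rw [e1, e2] at h
  exact h



lemma gauss_sq {Ω : Type*} [MeasurableSpace Ω] (P : Measure Ω) (X : Ω → ℝ) (hX : Measurable X)
    (v : NNReal) (h : P.map X = gaussianReal 0 v) : MemLp X 2 P ∧ ∫ ω, X ω ^ 2 ∂P = v := by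
  have h1 : MemLp id 2 (P.map X) := by
    rw [h]; exact memLp_id_gaussianReal' 2 (by norm_num)
  have h2 : MemLp X 2 P := by
    have := (memLp_map_measure_iff (by fun_prop) hX.aemeasurable).1 h1
    simpa using this
  refine ⟨h2, ?_⟩
  have h3 : ∫ y, y ^ 2 ∂(P.map X) = ∫ ω, X ω ^ 2 ∂P := integral_map hX.aemeasurable (by fun_prop)
  rw [← h3, h]
  have h4 := variance_id_gaussianReal (μ := 0) (v := v)
  rw [variance_eq_integral (by fun_prop)] at h4
  simpa using h4

lemma sig_CS {Ω : Type*} [MeasurableSpace Ω] (P : Measure Ω) [IsProbabilityMeasure P]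
    (σ : ℝ → ℝ) (hσ0 : σ 0 = 0) (hσpos : ∀ t > (0:ℝ), 0 < σ t)
    (J : ℝ → Ω → ℝ) (hJ : IsCenteredGaussian1 P J (covFromStd σ)) (a b c d : ℝ) :
    |σ |a - d| ^ 2 + σ |b - c| ^ 2 - σ |a - c| ^ 2 - σ |b - d| ^ 2| ≤
      2 * σ |a - b| * σ |c - d| := by
  have hnn : ∀ t, 0 ≤ σ |t| := fun t => by
    rcases (abs_nonneg t).eq_or_lt with h | h
    · rw [← h, hσ0]
    · exact (hσpos _ h).le
  have hdiff : ∀ t s, MemLp (fun ω => J t ω - J s ω) 2 P ∧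
      ∫ ω, (J t ω - J s ω) ^ 2 ∂P = σ |t - s| ^ 2 := by
    intro t s
    have h := hJ.2 2 ![t, s] ![1, -1]
    have e : (∑ x : Fin 2, ∑ y : Fin 2, (![1, -1] : Fin 2 → ℝ) x * (![1, -1] : Fin 2 → ℝ) y *
        covFromStd σ ((![t, s] : Fin 2 → ℝ) x) ((![t, s] : Fin 2 → ℝ) y)) = σ |t - s| ^ 2 := by
      simp [Fin.sum_univ_two, covFromStd, hσ0, abs_sub_comm s t]
      ring
    rw [e] at h
    have e2 : (fun ω => ∑ x : Fin 2, (![1, -1] : Fin 2 → ℝ) x * J ((![t, s] : Fin 2 → ℝ) x) ω) =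
        fun ω => J t ω - J s ω := by
      funext ω; simp [Fin.sum_univ_two]; ring
    rw [e2] at h
    have := gauss_sq P _ ((hJ.1 t).sub (hJ.1 s)) _ h
    rwa [Real.coe_toNNReal _ (sq_nonneg _)] at this
  have hI : ∀ t s, Integrable (fun ω => (J t ω - J s ω) ^ 2) P := fun t s => (hdiff t s).1.integrable_sq
  have hUV : ∀ ω, (J a ω - J b ω) * (J c ω - J d ω) =
      ((J a ω - J d ω) ^ 2 + (J b ω - J c ω) ^ 2 - (J a ω - J c ω) ^ 2 - (J b ω - J d ω) ^ 2) / 2 := by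
    intro ω; ring
  set S := σ |a - d| ^ 2 + σ |b - c| ^ 2 - σ |a - c| ^ 2 - σ |b - d| ^ 2 with hS
  have hUVi : Integrable (fun ω => (J a ω - J b ω) * (J c ω - J d ω)) P := by
    simp_rw [hUV]
    exact ((((hI a d).add (hI b c)).sub (hI a c)).sub (hI b d)).div_const 2
  have hE : ∫ ω, (J a ω - J b ω) * (J c ω - J d ω) ∂P = S / 2 := by
    simp_rw [hUV]
    have i1 : Integrable (fun ω => (J a ω - J d ω) ^ 2 + (J b ω - J c ω) ^ 2) P :=
      (hI a d).add (hI b c)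
    have i2 : Integrable (fun ω => (J a ω - J d ω) ^ 2 + (J b ω - J c ω) ^ 2 -
      (J a ω - J c ω) ^ 2) P := i1.sub (hI a c)
    rw [integral_div, integral_sub i2 (hI b d), integral_sub i1 (hI a c), integral_add (hI a d) (hI b c),
      (hdiff a d).2, (hdiff b c).2, (hdiff a c).2, (hdiff b d).2]
  have hq : ∀ x : ℝ, 0 ≤ σ |a - b| ^ 2 * (x * x) + S * x + σ |c - d| ^ 2 := by
    intro x
    have h0 : 0 ≤ ∫ ω, (x * (J a ω - J b ω) + (J c ω - J d ω)) ^ 2 ∂P :=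
      integral_nonneg fun ω => sq_nonneg _
    have e : ∀ ω, (x * (J a ω - J b ω) + (J c ω - J d ω)) ^ 2 =
        (x * x) * (J a ω - J b ω) ^ 2 + (2 * x) * ((J a ω - J b ω) * (J c ω - J d ω)) +
          (J c ω - J d ω) ^ 2 := fun ω => by ring
    simp_rw [e] at h0
    rw [integral_add (((hI a b).const_mul _).fun_add (hUVi.const_mul _)) (hI c d),
      integral_add ((hI a b).const_mul _) (hUVi.const_mul _), integral_const_mul,
      integral_const_mul, hE, (hdiff a b).2, (hdiff c d).2] at h0
    linarith
  have hd := discrim_le_zero hq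
  rw [discrim] at hd
  refine abs_le_of_sq_le_sq ?_ (by have := hnn (a - b); have := hnn (c - d); positivity)
  nlinarith



/-- Deterministic properties of the standard deviation function used below. -/
structure SigH (σ : ℝ → ℝ) (α : ℝ) : Prop where
  cont : ContinuousOn σ (Set.Ici 0)
  zero : σ 0 = 0
  pos : ∀ t > (0:ℝ), 0 < σ t
  cs : ∀ a b c d : ℝ, |σ |a - d| ^ 2 + σ |b - c| ^ 2 - σ |a - c| ^ 2 - σ |b - d| ^ 2| ≤
      2 * σ |a - b| * σ |c - d|
  ha : α ∈ Set.Ioo (0:ℝ) 1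
  h1 : ∀ t > (0:ℝ), Tendsto (fun x => σ (t * x) / σ x) atTop (𝓝 (t ^ α))
  h2 : ∃ t₀ β C : ℝ, 0 < t₀ ∧ 0 < β ∧ 0 < C ∧ ∀ t, 0 < t → t < t₀ → σ t ≤ C * t ^ β

lemma SigH.nonneg {σ : ℝ → ℝ} {α : ℝ} (H : SigH σ α) (t : ℝ) (ht : 0 ≤ t) : 0 ≤ σ t := by
  rcases ht.eq_or_lt with h | h
  · rw [← h, H.zero]
  · exact (H.pos _ h).le

lemma SigH.sub' {σ : ℝ → ℝ} {α : ℝ} (H : SigH σ α) (a b d : ℝ) :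
    σ |a - d| ≤ σ |a - b| + σ |b - d| := by
  have h := (abs_le.1 (H.cs a b b d)).2
  simp only [sub_self, abs_zero, H.zero] at h
  have h1 := H.nonneg _ (abs_nonneg (a - b))
  have h2 := H.nonneg _ (abs_nonneg (b - d))
  refine abs_le_of_sq_le_sq' ?_ (by positivity) |>.2
  nlinarith

lemma SigH.sub {σ : ℝ → ℝ} {α : ℝ} (H : SigH σ α) (a b : ℝ) (ha : 0 ≤ a) (hb : 0 ≤ b) :
    σ (a + b) ≤ σ a + σ b := by
  have h := H.sub' a 0 (-b)
  simpa [abs_of_nonneg ha, abs_of_nonneg hb, abs_of_nonneg (add_nonneg ha hb)] using h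

set_option maxHeartbeats 2000000 in
lemma SigH.R1 {σ : ℝ → ℝ} {α : ℝ} (H : SigH σ α) : ∃ C γ γ' x0 : ℝ, 1 ≤ C ∧ 0 < γ ∧ γ ≤ γ' ∧
    γ ≤ α ∧ α ≤ γ' ∧ γ' < 1 ∧ 0 < x0 ∧ ∀ x, x0 ≤ x → ∀ l, 0 ≤ l →
      σ (l * x) ≤ C * max (l ^ γ) (l ^ γ') * σ x := by
  obtain ⟨t₀, β, C, ht₀, hβ, hC, hH2⟩ := H.h2
  obtain ⟨ha0, ha1⟩ := H.ha
  set γ := min (α / 2) β with hγd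
  set γ' := (1 + α) / 2 with hγ'd
  have hγ : 0 < γ := lt_min (by linarith) hβ
  have hγα : γ < α := (min_le_left _ _).trans_lt (by linarith)
  have hγ'α : α < γ' := by rw [hγ'd]; linarith
  have hγ'1 : γ' < 1 := by rw [hγ'd]; linarith
  have ev1 : ∀ᶠ x in atTop, σ (1 / 2 * x) / σ x < (1 / 2) ^ γ :=
    (H.h1 (1 / 2) (by norm_num)).eventually_lt_const
      (Real.rpow_lt_rpow_of_exponent_gt (by norm_num) (by norm_num) hγα)
  have ev2 : ∀ᶠ x in atTop, σ (2 * x) / σ x < 2 ^ γ' :=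
    (H.h1 2 (by norm_num)).eventually_lt_const
      (Real.rpow_lt_rpow_of_exponent_lt (by norm_num) hγ'α)
  obtain ⟨A0, hA0⟩ := eventually_atTop.1 (ev1.and ev2)
  set A := max A0 1 with hA
  have hA1 : 1 ≤ A := le_max_right _ _
  have hhalf : ∀ x, A ≤ x → σ (x / 2) ≤ (1 / 2) ^ γ * σ x := fun x hx => by
    have h := (hA0 x ((le_max_left _ _).trans hx)).1
    rw [div_lt_iff₀ (H.pos x (by linarith))] at h
    rw [show x / 2 = 1 / 2 * x by ring]; exact h.le
  have hdbl : ∀ x, A ≤ x → σ (2 * x) ≤ 2 ^ γ' * σ x := fun x hx => by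
    have h := (hA0 x ((le_max_left _ _).trans hx)).2
    rw [div_lt_iff₀ (H.pos x (by linarith))] at h
    exact h.le
  -- iterate halving
  have hhalfk : ∀ x, ∀ k : ℕ, A ≤ x / 2 ^ k → σ (x / 2 ^ k) ≤ ((1 / 2) ^ γ) ^ k * σ x := by
    intro x k
    induction k with
    | zero => intro _; simp
    | succ k ih =>
      intro hk
      have hk' : A ≤ x / 2 ^ k := by
        rw [pow_succ, ← div_div] at hk
        linarith
      have e : x / 2 ^ (k + 1) = (x / 2 ^ k) / 2 := by rw [pow_succ, div_div]
      rw [e, pow_succ]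
      refine (hhalf _ hk').trans ?_
      have := ih hk'
      have h0 : (0:ℝ) < (1 / 2) ^ γ := by positivity
      nlinarith
  have hdblk : ∀ x, A ≤ x → ∀ k : ℕ, σ (2 ^ k * x) ≤ (2 ^ γ') ^ k * σ x := by
    intro x hx k
    induction k with
    | zero => simp
    | succ k ih =>
      have h2 : A ≤ 2 ^ k * x := by
        have : (1:ℝ) ≤ 2 ^ k := one_le_pow₀ (by norm_num)
        nlinarith
      have := hdbl _ h2
      rw [pow_succ, pow_succ, mul_comm ((2:ℝ) ^ k) 2, mul_assoc]
      refine this.trans ?_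
      have h0 : (0:ℝ) < 2 ^ γ' := by positivity
      nlinarith
  -- bounds on compact intervals
  obtain ⟨ym, hym, hymin⟩ := isCompact_Icc.exists_isMinOn (s := Set.Icc A (2 * A))
    ⟨A, by constructor <;> linarith⟩ (H.cont.mono fun y hy => by
      have := hy.1; simp only [Set.mem_Ici]; linarith)
  obtain ⟨yM, hyM, hymax⟩ := isCompact_Icc.exists_isMaxOn (s := Set.Icc 0 (2 * A))
    ⟨0, by constructor <;> linarith⟩ (H.cont.mono fun y hy => hy.1)
  set mn := σ ym with hmn
  have hmn0 : 0 < mn := H.pos _ (by linarith [hym.1])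
  set mx := σ yM with hmx
  have hmx0 : 0 ≤ mx := H.nonneg _ hyM.1
  set τ := min t₀ 1 with hτ
  have hτ0 : 0 < τ := lt_min ht₀ one_pos
  set C1 := C + mx / τ ^ γ with hC1
  have hC10 : 0 < C1 := by positivity
  have hsmall : ∀ y, 0 ≤ y → y ≤ 2 * A → σ y ≤ C1 * y ^ γ := by
    intro y hy hy2
    rcases hy.eq_or_lt with h0 | h0
    · rw [← h0, H.zero]; positivity
    rcases lt_or_ge y τ with h | h
    · have e1 := hH2 y h0 (h.trans_le (min_le_left _ _))
      have e2 : y ^ β ≤ y ^ γ := Real.rpow_le_rpow_of_exponent_ge h0 (h.le.trans (min_le_right _ _))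
        (min_le_right _ _)
      have e3 : 0 ≤ mx / τ ^ γ * y ^ γ := by positivity
      rw [hC1, add_mul]
      nlinarith
    · have e1 : σ y ≤ mx := hymax ⟨hy, hy2⟩
      have e2 : τ ^ γ ≤ y ^ γ := Real.rpow_le_rpow hτ0.le h hγ.le
      have e3 : mx ≤ mx / τ ^ γ * y ^ γ := by
        rw [div_mul_eq_mul_div, le_div_iff₀ (by positivity)]
        exact mul_le_mul_of_nonneg_left e2 hmx0
      have e4 : 0 ≤ C * y ^ γ := by positivity
      rw [hC1, add_mul]; linarith
  set c1 := mn / (2 * A) ^ γ with hc1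
  have hc10 : 0 < c1 := by positivity
  have hlow : ∀ x, A ≤ x → c1 * x ^ γ ≤ σ x := by
    intro x hx
    obtain ⟨k, hk1, hk2⟩ := exists_nat_pow_near (x := x / A) (y := 2)
      (by rw [le_div_iff₀ (by linarith)]; linarith) (by norm_num)
    have hp : (0:ℝ) < 2 ^ k := by positivity
    rw [le_div_iff₀ (by linarith)] at hk1
    rw [div_lt_iff₀ (by linarith), pow_succ] at hk2
    have h1 : A ≤ x / 2 ^ k := by rw [le_div_iff₀ hp]; linarith
    have h2 : x / 2 ^ k ≤ 2 * A := by rw [div_le_iff₀ hp]; linarith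
    have h3 : mn ≤ σ (x / 2 ^ k) := hymin ⟨h1, h2⟩
    have h4 := hhalfk x k h1
    have h5 : ((1 / 2 : ℝ) ^ γ) ^ k * x ^ γ = (x / 2 ^ k) ^ γ := by
      rw [← Real.rpow_natCast, ← Real.rpow_mul (by norm_num), mul_comm γ, Real.rpow_mul (by norm_num),
        ← Real.mul_rpow (by positivity) (by linarith), Real.rpow_natCast, one_div, inv_pow]
      congr 1; field_simp
    have h6 : (x / 2 ^ k) ^ γ ≤ (2 * A) ^ γ := Real.rpow_le_rpow (by linarith) h2 hγ.le
    have h7 : (0:ℝ) < ((1 / 2 : ℝ) ^ γ) ^ k := by positivity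
    rw [hc1, div_mul_eq_mul_div, div_le_iff₀ (by positivity)]
    have h8 : mn * x ^ γ ≤ ((1 / 2 : ℝ) ^ γ) ^ k * σ x * x ^ γ := by
      exact mul_le_mul_of_nonneg_right (h3.trans h4) (Real.rpow_nonneg (by linarith) _)
    have h9 : ((1 / 2 : ℝ) ^ γ) ^ k * σ x * x ^ γ = σ x * (x / 2 ^ k) ^ γ := by
      rw [← h5]; ring
    have h10 : σ x * (x / 2 ^ k) ^ γ ≤ σ x * (2 * A) ^ γ :=
      mul_le_mul_of_nonneg_left h6 (H.nonneg x (by linarith))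
    linarith
  set q := (1 / 2 : ℝ) ^ γ with hq
  have hq0 : 0 < q := by positivity
  have hq1 : q < 1 := Real.rpow_lt_one (by norm_num) (by norm_num) hγ
  set C2 := C1 / c1 + 1 / (1 - q) with hC2
  have h1q : 0 < 1 - q := by linarith
  have hC20 : 0 < C2 := by positivity
  have hC2q : 1 + C2 * q ≤ C2 := by
    have : 1 / (1 - q) ≤ C2 := by rw [hC2]; have : 0 < C1 / c1 := by positivity
                                  linarith
    rw [div_le_iff₀ h1q] at this
    linarith
  have part1 : ∀ x, A ≤ x → ∀ N : ℕ, ∀ y, 0 ≤ y → y ≤ x → y ≤ 2 ^ N * (2 * A) →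
      σ y ≤ C2 * (y / x) ^ γ * σ x := by
    intro x hx N
    have hx0 : 0 < x := by linarith
    have base : ∀ y, 0 ≤ y → y ≤ 2 * A → σ y ≤ C2 * (y / x) ^ γ * σ x := by
      intro y hy hyA
      have h1 := hsmall y hy hyA
      have h2 := hlow x hx
      rw [Real.div_rpow hy hx0.le]
      have h3 : C1 * y ^ γ = C1 / c1 * (y ^ γ / x ^ γ) * (c1 * x ^ γ) := by
        have : 0 < x ^ γ := by positivity
        field_simp
      rw [h3] at h1
      refine h1.trans ?_
      have h4 : C1 / c1 ≤ C2 := by rw [hC2]; have : 0 < 1 / (1 - q) := by positivity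
                                   linarith
      gcongr
    induction N with
    | zero => intro y hy _ hyA; exact base y hy (by simpa using hyA)
    | succ N ih =>
      intro y hy hyx hyN
      rcases le_or_gt y (2 * A) with h | h
      · exact base y hy h
      have hy0 : 0 < y := by linarith
      obtain ⟨k, hk1, hk2⟩ := exists_nat_pow_near (x := x / y) (y := 2)
        (by rw [le_div_iff₀ hy0]; linarith) (by norm_num)
      rw [le_div_iff₀ hy0] at hk1
      rw [div_lt_iff₀ hy0] at hk2
      have hp : (0:ℝ) < 2 ^ (k + 1) := by positivity
      set h' := x / 2 ^ (k + 1) with hh'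
      have a1 : h' < y := by rw [hh', div_lt_iff₀ hp]; linarith
      have a2 : y ≤ 2 * h' := by
        rw [hh', pow_succ, mul_div_assoc', le_div_iff₀ (by positivity)]; linarith
      have a3 : A ≤ h' := by linarith
      have a4 := hhalfk x (k + 1) a3
      have a5 : q ^ (k + 1) = (h' / x) ^ γ := by
        rw [hq, ← Real.rpow_natCast, ← Real.rpow_mul (by norm_num), mul_comm γ,
          Real.rpow_mul (by norm_num), Real.rpow_natCast]
        congr 1
        rw [hh']; field_simp; simp
      rw [a5] at a4
      have a6 : (h' / x) ^ γ ≤ (y / x) ^ γ := by gcongr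
      have a7 := ih (y - h') (by linarith) (by linarith) (by rw [pow_succ] at hyN; linarith)
      have a8 : ((y - h') / x) ^ γ ≤ q * (y / x) ^ γ := by
        rw [hq, ← Real.mul_rpow (by norm_num) (by positivity)]
        refine Real.rpow_le_rpow (div_nonneg (by linarith) hx0.le) ?_ hγ.le
        rw [one_div, inv_mul_eq_div, div_div, div_le_div_iff₀ hx0 (by positivity)]
        nlinarith
      have a9 := H.sub h' (y - h') (by linarith) (by linarith)
      rw [add_sub_cancel] at a9
      have hs := H.nonneg x hx0.le
      have hY : 0 ≤ (y / x) ^ γ := by positivity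
      calc σ y ≤ σ h' + σ (y - h') := a9
        _ ≤ (y / x) ^ γ * σ x + C2 * (q * (y / x) ^ γ) * σ x := by
          refine add_le_add (a4.trans ?_) (a7.trans ?_)
          · gcongr
          · gcongr
        _ = (1 + C2 * q) * ((y / x) ^ γ * σ x) := by ring
        _ ≤ C2 * ((y / x) ^ γ * σ x) := mul_le_mul_of_nonneg_right hC2q (by positivity)
        _ = _ := by ring
  have part1' : ∀ x, A ≤ x → ∀ y, 0 ≤ y → y ≤ x → σ y ≤ C2 * (y / x) ^ γ * σ x := by
    intro x hx y hy hyx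
    obtain ⟨N, hN⟩ := pow_unbounded_of_one_lt x (by norm_num : (1:ℝ) < 2)
    refine part1 x hx N y hy hyx ?_
    have : (0:ℝ) < 2 ^ N := by positivity
    nlinarith
  refine ⟨1 + C2, γ, γ', A, by linarith, hγ, by linarith, hγα.le, hγ'α.le, hγ'1, by linarith, ?_⟩
  intro x hx l hl
  have hx0 : 0 < x := by linarith
  have hs := H.nonneg x hx0.le
  rcases le_or_gt l 1 with h | h
  · have := part1' x hx (l * x) (by positivity) (by nlinarith)
    rw [mul_div_assoc, div_self hx0.ne', mul_one] at this
    refine this.trans ?_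
    gcongr
    · linarith
    · exact le_max_left _ _
  · obtain ⟨k, hk1, hk2⟩ := exists_nat_pow_near (x := l) (y := 2) h.le (by norm_num)
    have hp : (1:ℝ) ≤ 2 ^ k := one_le_pow₀ (by norm_num)
    have b1 := hdblk x hx k
    have b2 : ((2:ℝ) ^ γ') ^ k ≤ l ^ γ' := by
      rw [← Real.rpow_natCast, ← Real.rpow_mul (by norm_num), mul_comm γ', Real.rpow_mul (by norm_num),
        Real.rpow_natCast]
      exact Real.rpow_le_rpow (by positivity) hk1 (by linarith)
    have b3 : A ≤ 2 ^ k * x := by nlinarith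
    have b4 : 0 ≤ l * x - 2 ^ k * x := by rw [← sub_mul]; exact mul_nonneg (by linarith) hx0.le
    have b5 : l * x - 2 ^ k * x ≤ 2 ^ k * x := by
      rw [pow_succ] at hk2; nlinarith
    have b6 := part1' _ b3 _ b4 b5
    have b7 : ((l * x - 2 ^ k * x) / (2 ^ k * x)) ^ γ ≤ 1 := by
      refine Real.rpow_le_one (by positivity) ?_ hγ.le
      rw [div_le_one (by positivity)]; exact b5
    have b8 := H.sub (2 ^ k * x) (l * x - 2 ^ k * x) (by positivity) b4
    rw [add_sub_cancel] at b8
    have hs2 := H.nonneg (2 ^ k * x) (by positivity)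
    calc σ (l * x) ≤ σ (2 ^ k * x) + σ (l * x - 2 ^ k * x) := b8
      _ ≤ σ (2 ^ k * x) + C2 * 1 * σ (2 ^ k * x) := by
        gcongr
        refine b6.trans ?_
        gcongr
      _ = (1 + C2) * σ (2 ^ k * x) := by ring
      _ ≤ (1 + C2) * (l ^ γ' * σ x) := by
        gcongr
        refine b1.trans ?_
        gcongr
      _ = (1 + C2) * l ^ γ' * σ x := by ring
      _ ≤ _ := by
        gcongr
        exact le_max_right _ _



lemma SigH.abs_sub_le {σ : ℝ → ℝ} {α : ℝ} (H : SigH σ α) (a b : ℝ) (ha : 0 ≤ a) (hb : 0 ≤ b) :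
    |σ a - σ b| ≤ σ |a - b| := by
  rw [abs_le]
  have h1 := H.sub' a b 0
  have h2 := H.sub' b a 0
  simp only [sub_zero, abs_of_nonneg ha, abs_of_nonneg hb, abs_sub_comm b a] at h1 h2
  constructor <;> linarith

lemma maxpow_tendsto {ι : Type*} {l : Filter ι} (e : ι → ℝ) (he : Tendsto e l (𝓝 0)) (γ γ' : ℝ)
    (hγ : 0 < γ) (hγ' : 0 < γ') : Tendsto (fun u => max (e u ^ γ) (e u ^ γ')) l (𝓝 0) := by
  have h1 : Tendsto (fun u => e u ^ γ) l (𝓝 0) := by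
    have := he.rpow_const (p := γ) (Or.inr hγ.le)
    rwa [Real.zero_rpow hγ.ne'] at this
  have h2 : Tendsto (fun u => e u ^ γ') l (𝓝 0) := by
    have := he.rpow_const (p := γ') (Or.inr hγ'.le)
    rwa [Real.zero_rpow hγ'.ne'] at this
  simpa using h1.max h2

lemma SigH.uct {σ : ℝ → ℝ} {α : ℝ} (H : SigH σ α) {ι : Type*} {l : Filter ι} (q x : ι → ℝ) (q0 : ℝ)
    (hq : Tendsto q l (𝓝 q0)) (hx : Tendsto x l atTop) :
    Tendsto (fun u => σ (|q u| * x u) / σ (x u)) l (𝓝 (|q0| ^ α)) := by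
  obtain ⟨C, γ, γ', x0, hC, hγ, hγγ, -, -, -, hx0, hR⟩ := H.R1
  have hlim : Tendsto (fun u => σ (|q0| * x u) / σ (x u)) l (𝓝 (|q0| ^ α)) := by
    rcases (abs_nonneg q0).eq_or_lt with h | h
    · rw [← h, Real.zero_rpow H.ha.1.ne']
      simp only [zero_mul, H.zero, zero_div]
      exact tendsto_const_nhds
    · exact (H.h1 _ h).comp hx
  have he : Tendsto (fun u => |(|q u| - |q0|)|) l (𝓝 0) := by
    have := (hq.abs.sub_const |q0|).abs
    simpa using this
  have hm := (maxpow_tendsto _ he γ γ' hγ (hγ.trans_le hγγ)).const_mul C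
  rw [mul_zero] at hm
  have hd : Tendsto (fun u => σ (|q u| * x u) / σ (x u) - σ (|q0| * x u) / σ (x u)) l (𝓝 0) := by
    refine squeeze_zero_norm' ?_ hm
    filter_upwards [hx.eventually_ge_atTop x0] with u hu
    have hxu : 0 < x u := by linarith
    rw [Real.norm_eq_abs, ← sub_div, abs_div, abs_of_pos (H.pos _ hxu), div_le_iff₀ (H.pos _ hxu)]
    refine (H.abs_sub_le _ _ (by positivity) (by positivity)).trans ?_
    rw [← sub_mul, abs_mul, abs_of_pos hxu]
    exact hR _ hu _ (abs_nonneg _)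
  have := hd.add hlim
  simpa using this

lemma SigH.delta_atTop {σ : ℝ → ℝ} {α : ℝ} (H : SigH σ α) {ι : Type*} {l : Filter ι} (r d : ι → ℝ)
    (hr : Tendsto r l (𝓝 0)) (hd : ∀ᶠ u in l, 0 < d u ∧ r u * d u = σ (d u)) :
    Tendsto d l atTop := by
  rw [tendsto_atTop]
  intro M0
  set M := max M0 1 with hM
  have hM1 : 1 ≤ M := le_max_right _ _
  obtain ⟨ym, hym, hymin⟩ := isCompact_Icc.exists_isMinOn (s := Set.Icc M (2 * M))
    ⟨M, by constructor <;> linarith⟩ (H.cont.mono fun y hy => by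
      have := hy.1; simp only [Set.mem_Ici]; linarith)
  have hmn0 : 0 < σ ym := H.pos _ (by linarith [hym.1])
  have hdk : ∀ t, 0 ≤ t → ∀ k : ℕ, σ (2 ^ k * t) ≤ 2 ^ k * σ t := by
    intro t ht k
    induction k with
    | zero => simp
    | succ k ih =>
      have := H.sub (2 ^ k * t) (2 ^ k * t) (by positivity) (by positivity)
      rw [show (2:ℝ) ^ (k + 1) * t = 2 ^ k * t + 2 ^ k * t by ring, pow_succ]
      linarith
  filter_upwards [hd, hr.eventually_lt_const (show 0 < σ ym / (2 * M) by positivity)] with u hu hru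
  by_contra hcon
  have hlt : d u < M := (not_le.1 hcon).trans_le (le_max_left _ _)
  obtain ⟨hd0, he⟩ := hu
  obtain ⟨k, hk1, hk2⟩ := exists_nat_pow_near (x := 2 * M / d u) (y := 2)
    (by rw [le_div_iff₀ hd0]; linarith) (by norm_num)
  rw [le_div_iff₀ hd0] at hk1
  rw [div_lt_iff₀ hd0, pow_succ] at hk2
  have h1 : σ ym ≤ σ (2 ^ k * d u) := hymin ⟨by linarith, hk1⟩
  have h2 := hdk (d u) hd0.le k
  rw [← he] at h2
  rw [lt_div_iff₀ (by positivity)] at hru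
  have hp : (0:ℝ) < 2 ^ k := by positivity
  have hr0 : 0 < r u := by
    by_contra h
    have := H.pos _ hd0
    nlinarith
  nlinarith

lemma ratio_gen {σ : ℝ → ℝ} {α : ℝ} (H : SigH σ α) (C γ γ' x0 : ℝ) (hγγ : γ ≤ γ')
    (hγ1 : γ' < 1) (hC : 1 ≤ C) (hx0 : 0 < x0) (hR : ∀ x, x0 ≤ x → ∀ l, 0 ≤ l →
      σ (l * x) ≤ C * max (l ^ γ) (l ^ γ') * σ x) (x y a b ε : ℝ) (hx : 0 < x) (hy : x0 ≤ y)
    (hb : 0 < b) (hax : a * x = σ x) (hby : b * y = σ y) (hε : 0 < ε)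
    (h : ε ≤ x / y) : a / b ≤ C * max (ε ^ (γ - 1)) (ε ^ (γ' - 1)) := by
  have hy0 : 0 < y := by linarith
  set w := x / y with hw
  have hw0 : 0 < w := by positivity
  have hxw : w * y = x := by rw [hw]; field_simp
  have h1 := hR y hy w hw0.le
  rw [hxw, ← hax, ← hby, ← hxw] at h1
  have h2 : max (w ^ γ) (w ^ γ') = w * max (w ^ (γ - 1)) (w ^ (γ' - 1)) := by
    rw [mul_max_of_nonneg _ _ hw0.le, Real.rpow_sub_one hw0.ne', Real.rpow_sub_one hw0.ne']
    congr 1 <;> field_simp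
  rw [h2] at h1
  have h3 : max (w ^ (γ - 1)) (w ^ (γ' - 1)) ≤ max (ε ^ (γ - 1)) (ε ^ (γ' - 1)) :=
    max_le_max (Real.rpow_le_rpow_of_nonpos hε h (by linarith))
      (Real.rpow_le_rpow_of_nonpos hε h (by linarith))
  rw [div_le_iff₀ hb]
  have h4 : a * (w * y) ≤ (C * max (w ^ (γ - 1)) (w ^ (γ' - 1)) * b) * (w * y) := by
    refine h1.trans (le_of_eq (by ring))
  have h5 := le_of_mul_le_mul_right h4 (by positivity)
  refine h5.trans ?_
  gcongr

lemma SigH.ratio_zero {σ : ℝ → ℝ} {α : ℝ} (H : SigH σ α) {ι : Type*} {l : Filter ι}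
    (x y a b : ι → ℝ) (hx : Tendsto x l atTop) (hy : Tendsto y l atTop)
    (ha : ∀ᶠ u in l, 0 < a u) (hb : ∀ᶠ u in l, 0 < b u)
    (hax : ∀ᶠ u in l, a u * x u = σ (x u)) (hby : ∀ᶠ u in l, b u * y u = σ (y u))
    (hba : Tendsto (fun u => b u / a u) l (𝓝 0)) : Tendsto (fun u => x u / y u) l (𝓝 0) := by
  obtain ⟨C, γ, γ', x0, hC, hγ, hγγ, -, -, hγ1, hx0, hR⟩ := H.R1
  rw [Metric.tendsto_nhds]
  intro ε hε
  set B := C * max (ε ^ (γ - 1)) (ε ^ (γ' - 1)) with hB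
  have hB0 : 0 < B := by positivity
  filter_upwards [hx.eventually_gt_atTop 0, hy.eventually_ge_atTop x0, ha, hb, hax, hby,
    hba.eventually_lt_const (show 0 < B⁻¹ by positivity)] with u hxu hyu hau hbu h1 h2 h3
  rw [Real.dist_eq, sub_zero, abs_of_nonneg (div_nonneg hxu.le (hx0.le.trans hyu))]
  by_contra hcon
  have := ratio_gen H C γ γ' x0 hγγ hγ1 hC hx0 hR _ _ _ _ ε hxu hyu hbu h1 h2 hε (not_lt.1 hcon)
  rw [← hB] at this
  have h4 : B < (b u / a u)⁻¹ := (lt_inv_comm₀ hB0 (by positivity)).2 h3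
  rw [inv_div] at h4
  linarith

lemma exists_W (C γ γ' s : ℝ) (hγγ : γ ≤ γ') (hγ1 : γ' < 1) (hs : 0 < s) :
    ∃ W : ℝ, 1 ≤ W ∧ C * max (W ^ (γ - 1)) (W ^ (γ' - 1)) < s := by
  have h1 : Tendsto (fun W : ℝ => W ^ (γ - 1)) atTop (𝓝 0) := by
    have := tendsto_rpow_neg_atTop (show 0 < 1 - γ by linarith)
    simpa using this
  have h2 : Tendsto (fun W : ℝ => W ^ (γ' - 1)) atTop (𝓝 0) := by
    have := tendsto_rpow_neg_atTop (show 0 < 1 - γ' by linarith)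
    simpa using this
  have h3 := (h1.max h2).const_mul C
  rw [max_self, mul_zero] at h3
  exact ((eventually_ge_atTop 1).and (h3.eventually_lt_const hs)).exists

lemma SigH.ratio_pos {σ : ℝ → ℝ} {α : ℝ} (H : SigH σ α) {ι : Type*} {l : Filter ι}
    (x y a b : ι → ℝ) (ρ : ℝ) (hρ : 0 < ρ) (hx : Tendsto x l atTop) (hy : Tendsto y l atTop)
    (ha : ∀ᶠ u in l, 0 < a u) (hb : ∀ᶠ u in l, 0 < b u)
    (hax : ∀ᶠ u in l, a u * x u = σ (x u)) (hby : ∀ᶠ u in l, b u * y u = σ (y u))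
    (hba : Tendsto (fun u => b u / a u) l (𝓝 ρ)) :
    Tendsto (fun u => y u / x u) l (𝓝 (ρ ^ (1 / (α - 1)))) := by
  obtain ⟨C, γ, γ', x0, hC, hγ, hγγ, -, -, hγ1, hx0, hR⟩ := H.R1
  obtain ⟨W1, hW1, hW1'⟩ := exists_W C γ γ' (ρ / 2) hγγ hγ1 (by positivity)
  obtain ⟨W2, hW2, hW2'⟩ := exists_W C γ γ' (1 / (2 * ρ)) hγγ hγ1 (by positivity)
  have hbd : ∀ᶠ u in l, y u / x u ∈ Set.Icc (1 / W2) W1 := by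
    filter_upwards [hx.eventually_ge_atTop x0, hy.eventually_ge_atTop x0, ha, hb, hax, hby,
      hba.eventually_lt_const (show ρ < 2 * ρ by linarith),
      hba.eventually_const_lt (show ρ / 2 < ρ by linarith)] with u hxu hyu hau hbu h1 h2 h3 h4
    have hxp : 0 < x u := by linarith
    have hyp : 0 < y u := by linarith
    constructor
    · by_contra hcon
      have hlt := not_le.1 hcon
      have hw : W2 ≤ x u / y u := by
        rw [lt_div_iff₀ (by linarith)] at hlt
        rw [le_div_iff₀ hyp]
        have e : y u / x u * W2 * x u = y u * W2 := by field_simp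
        nlinarith
      have := ratio_gen H C γ γ' x0 hγγ hγ1 hC hx0 hR _ _ _ _ W2 hxp hyu hbu h1 h2
        (by linarith) hw
      have h5 : 1 / (2 * ρ) < a u / b u := by
        rw [div_lt_div_iff₀ (by positivity) hbu]
        rw [div_lt_iff₀ hau] at h3
        linarith
      linarith
    · by_contra hcon
      have := ratio_gen H C γ γ' x0 hγγ hγ1 hC hx0 hR _ _ _ _ W1 hyp hxu hau h2 h1
        (by linarith) (not_le.1 hcon).le
      linarith
  rw [tendsto_iff_ultrafilter]
  intro g hg
  have hgb : Set.Icc (1 / W2) W1 ∈ g.map (fun u => y u / x u) := hg hbd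
  obtain ⟨q0, hq0, hlim⟩ := (isCompact_Icc (a := 1 / W2) (b := W1)).ultrafilter_le_nhds _
    (le_principal_iff.2 hgb)
  have hlim' : Tendsto (fun u => y u / x u) (g : Filter ι) (𝓝 q0) := hlim
  have hq0p : 0 < q0 := lt_of_lt_of_le (by positivity) hq0.1
  have hu := H.uct _ _ q0 hlim' (hx.mono_left hg)
  have hv : Tendsto (fun u => b u / a u * (y u / x u)) (g : Filter ι) (𝓝 (ρ * q0)) :=
    (hba.mono_left hg).mul hlim'
  have heq : q0 ^ α = ρ * q0 := by
    rw [abs_of_pos hq0p] at hu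
    refine tendsto_nhds_unique (hu.congr' ?_) hv
    filter_upwards [hg (hx.eventually_gt_atTop 0), hg (hy.eventually_gt_atTop 0), hg ha, hg hb,
      hg hax, hg hby] with u hxu hyu hau hbu h1 h2
    have hxu : 0 < x u := hxu
    have hyu : 0 < y u := hyu
    have h1 : a u * x u = σ (x u) := h1
    have h2 : b u * y u = σ (y u) := h2
    have hau : 0 < a u := hau
    rw [abs_of_pos (by positivity), div_mul_cancel₀ _ hxu.ne', ← h1, ← h2]
    field_simp
  have hα := H.ha.2
  have hρq : ρ = q0 ^ (α - 1) := by
    rw [Real.rpow_sub_one hq0p.ne', heq]; field_simp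
  have : ρ ^ (1 / (α - 1)) = q0 := by
    rw [hρq, ← Real.rpow_mul hq0p.le, mul_one_div, div_self (by linarith), Real.rpow_one]
  rw [this]
  exact hlim'



lemma SigH.cov_bound {σ : ℝ → ℝ} {α : ℝ} (H : SigH σ α) (a b : ℝ) (m : ℕ) (S : ℝ)
    (hS : ∀ k < m, σ (k * |a|) ≤ S) :
    m * |covFromStd σ a b| ≤ σ (m * |a|) * σ |b| + m * (2 * σ |a| * S) := by
  have hstep : ∀ k : ℕ, k < m → |2 * covFromStd σ a b -
      (σ |b + k * a| ^ 2 - σ |b + ((k:ℝ) - 1) * a| ^ 2 - σ |k * a| ^ 2 + σ |((k:ℝ) - 1) * a| ^ 2)| ≤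
      4 * σ |a| * S := by
    intro k hk
    have h1 := H.cs a 0 (k * a) 0
    have h2 := H.cs a 0 (b + k * a) b
    have e1 : |b + ((k:ℝ) - 1) * a| = |a - (b + k * a)| := by rw [← abs_neg]; congr 1; ring
    have e2 : |((k:ℝ) - 1) * a| = |a - k * a| := by rw [← abs_neg]; congr 1; ring
    have e3 : |(k:ℝ) * a| = k * |a| := by rw [abs_mul, Nat.abs_cast]
    have h3 := hS k hk
    have h4 := H.nonneg _ (abs_nonneg a)
    rw [e1, e2, covFromStd]
    simp only [sub_zero, zero_sub, abs_neg, add_sub_cancel_left, abs_zero, H.zero] at h1 h2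
    rw [e3] at h1 h2 ⊢
    have h5 : σ |a| * σ (k * |a|) ≤ σ |a| * S := mul_le_mul_of_nonneg_left h3 h4
    rw [abs_le] at h1 h2 ⊢
    constructor <;> nlinarith [h1.1, h1.2, h2.1, h2.2]
  set f : ℕ → ℝ := fun k => σ |b + ((k:ℝ) - 1) * a| ^ 2 - σ |((k:ℝ) - 1) * a| ^ 2 with hf
  have hsum : ∑ k ∈ Finset.range m, (f (k + 1) - f k) = f m - f 0 := Finset.sum_range_sub f m
  have hlast : |f m - f 0| ≤ 2 * (σ (m * |a|) * σ |b|) := by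
    have h := H.cs (((m:ℝ) - 1) * a) (-a) 0 (-b)
    have e1 : |((m:ℝ) - 1) * a - -b| = |b + ((m:ℝ) - 1) * a| := by congr 1; ring
    have e2 : |-a - -b| = |b + (((0:ℕ):ℝ) - 1) * a| := by congr 1; push_cast; ring
    have e3 : |-a - 0| = |(((0:ℕ):ℝ) - 1) * a| := by congr 1; push_cast; ring
    have e4 : |((m:ℝ) - 1) * a - -a| = m * |a| := by
      rw [show ((m:ℝ) - 1) * a - -a = m * a by ring, abs_mul, Nat.abs_cast]
    rw [e1, e2, e3, e4, sub_zero, zero_sub, neg_neg] at h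
    simp only [hf]
    refine le_trans (le_of_eq ?_) (h.trans (le_of_eq (by ring)))
    congr 1; ring
  have htot : |∑ k ∈ Finset.range m, (2 * covFromStd σ a b - (f (k + 1) - f k))| ≤
      m * (4 * σ |a| * S) := by
    refine (Finset.abs_sum_le_sum_abs _ _).trans ?_
    have := Finset.sum_le_sum (s := Finset.range m)
      (f := fun k => |2 * covFromStd σ a b - (f (k + 1) - f k)|) (g := fun _ => 4 * σ |a| * S)
      (fun k hk => by
        refine le_trans (le_of_eq ?_) (hstep k (Finset.mem_range.1 hk))
        simp only [hf]; push_cast; rw [add_sub_cancel_right]; congr 1; ring)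
    refine this.trans (by simp)
  rw [Finset.sum_sub_distrib, hsum] at htot
  simp only [Finset.sum_const, Finset.card_range, nsmul_eq_mul] at htot
  have hm : (0:ℝ) ≤ m := Nat.cast_nonneg m
  have key : |(m:ℝ) * covFromStd σ a b| ≤ σ (m * |a|) * σ |b| + m * (2 * σ |a| * S) := by
    rw [abs_le] at htot hlast ⊢
    constructor <;> nlinarith [htot.1, htot.2, hlast.1, hlast.2]
  rwa [abs_mul, abs_of_nonneg hm] at key

lemma SigH.cov_zero {σ : ℝ → ℝ} {α : ℝ} (H : SigH σ α) {ι : Type*} {l : Filter ι}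
    (a b : ι → ℝ) (ha : Tendsto (fun u => |a u|) l atTop) (hb : Tendsto (fun u => |b u|) l atTop)
    (hab : Tendsto (fun u => |a u| / |b u|) l (𝓝 0)) :
    Tendsto (fun u => covFromStd σ (a u) (b u) / (σ |a u| * σ |b u|)) l (𝓝 0) := by
  obtain ⟨C, γ, γ', x0, hC, hγ, hγγ, -, -, hγ1, hx0, hR⟩ := H.R1
  rw [Metric.tendsto_nhds]
  intro ε hε
  have h2 : Tendsto (fun m : ℕ => C * (m:ℝ) ^ (γ' - 1)) atTop (𝓝 0) := by
    have := (tendsto_rpow_neg_atTop (show 0 < 1 - γ' by linarith)).comp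
      (tendsto_natCast_atTop_atTop (R := ℝ))
    have := this.const_mul C
    rw [mul_zero] at this
    refine this.congr fun m => ?_
    simp only [Function.comp_apply, neg_sub]
  obtain ⟨m, hm1, hmε⟩ := ((eventually_ge_atTop 1).and
    (h2.eventually_lt_const (show 0 < ε / 2 by positivity))).exists
  have hm1' : (1:ℝ) ≤ m := by exact_mod_cast hm1
  have hm0 : (0:ℝ) < m := by linarith
  have h3 : Tendsto (fun u => (m:ℝ) * (|a u| / |b u|)) l (𝓝 0) := by
    simpa using hab.const_mul (m:ℝ)
  have h4 := (maxpow_tendsto _ h3 γ γ' hγ (hγ.trans_le hγγ)).const_mul (2 * C)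
  rw [mul_zero] at h4
  filter_upwards [ha.eventually_ge_atTop x0, hb.eventually_ge_atTop x0,
    h4.eventually_lt_const (show 0 < ε / 2 by positivity)] with u hau hbu hu
  have ha0 : 0 < |a u| := by linarith
  have hb0 : 0 < |b u| := by linarith
  have hsa := H.pos _ ha0
  have hsb := H.pos _ hb0
  set q := (m:ℝ) * (|a u| / |b u|) with hq
  have hq0 : 0 ≤ q := by positivity
  have hγ'0 : 0 < γ' := hγ.trans_le hγγ
  have hb1 := H.cov_bound (a u) (b u) m (C * max (q ^ γ) (q ^ γ') * σ |b u|) (by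
    intro k hk
    have hk' : (k:ℝ) ≤ m := by exact_mod_cast hk.le
    have e : (k:ℝ) * |a u| = (k * (|a u| / |b u|)) * |b u| := by field_simp
    rw [e]
    refine (hR _ hbu _ (by positivity)).trans ?_
    have : (k:ℝ) * (|a u| / |b u|) ≤ q := by rw [hq]; gcongr
    gcongr)
  have hb2 : σ (m * |a u|) ≤ C * (m:ℝ) ^ γ' * σ |a u| := by
    refine (hR _ hau m hm0.le).trans (le_of_eq ?_)
    rw [max_eq_right (Real.rpow_le_rpow_of_exponent_le hm1' hγγ)]
  rw [Real.dist_eq, sub_zero, abs_div, abs_of_pos (mul_pos hsa hsb), div_lt_iff₀ (mul_pos hsa hsb)]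
  have hb3 : (m:ℝ) * |covFromStd σ (a u) (b u)| ≤
      m * ((C * (m:ℝ) ^ (γ' - 1) + 2 * C * max (q ^ γ) (q ^ γ')) * (σ |a u| * σ |b u|)) := by
    refine hb1.trans ?_
    have e : (m:ℝ) ^ γ' = m * (m:ℝ) ^ (γ' - 1) := by
      rw [Real.rpow_sub_one hm0.ne']; field_simp
    rw [e] at hb2
    have := mul_le_mul_of_nonneg_right hb2 hsb.le
    nlinarith
  have hb4 := le_of_mul_le_mul_left hb3 hm0
  refine hb4.trans_lt ?_
  exact mul_lt_mul_of_pos_right (by linarith) (mul_pos hsa hsb)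

lemma SigH.cov_lim {σ : ℝ → ℝ} {α : ℝ} (H : SigH σ α) {ι : Type*} {l : Filter ι}
    (x y a b : ι → ℝ) (ρ : ℝ) (hx : Tendsto x l atTop) (hy : Tendsto y l atTop)
    (ha : ∀ᶠ u in l, 0 < a u) (hb : ∀ᶠ u in l, 0 < b u)
    (hax : ∀ᶠ u in l, a u * x u = σ (x u)) (hby : ∀ᶠ u in l, b u * y u = σ (y u))
    (hρ : 0 ≤ ρ) (hba : Tendsto (fun u => b u / a u) l (𝓝 ρ)) (t s : ℝ) :
    Tendsto (fun u => covFromStd σ (x u * t) (y u * s) / (σ (x u) * σ (y u))) l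
      (𝓝 (limCov α ρ t s)) := by
  have hsq : ∀ z : ℝ, |z| ^ (2 * α) = (|z| ^ α) ^ 2 := fun z => by
    rw [mul_comm, Real.rpow_mul (abs_nonneg _)]; norm_cast
  rcases hρ.eq_or_lt with h0 | hpos
  · rw [limCov, if_neg (by rw [← h0]; exact lt_irrefl _)]
    have hw := H.ratio_zero x y a b hx hy ha hb hax hby (by rwa [← h0] at hba)
    rcases eq_or_ne t 0 with rfl | ht
    · simp only [covFromStd, mul_zero, abs_zero, H.zero, zero_sub, abs_neg]
      simpa using tendsto_const_nhds
    rcases eq_or_ne s 0 with rfl | hs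
    · simp only [covFromStd, mul_zero, abs_zero, H.zero, sub_zero]
      simpa using tendsto_const_nhds
    have ht' : 0 < |t| := abs_pos.2 ht
    have hs' : 0 < |s| := abs_pos.2 hs
    have exa : ∀ᶠ u in l, |x u * t| = |t| * x u := by
      filter_upwards [hx.eventually_gt_atTop 0] with u hu
      rw [abs_mul, abs_of_pos hu, mul_comm]
    have eya : ∀ᶠ u in l, |y u * s| = |s| * y u := by
      filter_upwards [hy.eventually_gt_atTop 0] with u hu
      rw [abs_mul, abs_of_pos hu, mul_comm]
    have A1 : Tendsto (fun u => |x u * t|) l atTop :=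
      (hx.const_mul_atTop ht').congr' (by filter_upwards [exa] with u hu; exact hu.symm)
    have A2 : Tendsto (fun u => |y u * s|) l atTop :=
      (hy.const_mul_atTop hs').congr' (by filter_upwards [eya] with u hu; exact hu.symm)
    have A3 : Tendsto (fun u => |x u * t| / |y u * s|) l (𝓝 0) := by
      have := hw.const_mul (|t| / |s|)
      rw [mul_zero] at this
      refine this.congr' ?_
      filter_upwards [exa, eya, hy.eventually_gt_atTop 0] with u h1 h2 h3
      rw [h1, h2]; field_simp
    have B := H.cov_zero _ _ A1 A2 A3
    have U1 := H.uct (fun _ => t) x t tendsto_const_nhds hx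
    have U2 := H.uct (fun _ => s) y s tendsto_const_nhds hy
    have := (B.mul U1).mul U2
    rw [zero_mul, zero_mul] at this
    refine this.congr' ?_
    filter_upwards [exa, eya, hy.eventually_gt_atTop 0, hx.eventually_gt_atTop 0] with u h1 h2 h3 h4
    rw [h1, h2]
    have p1 := H.pos (|t| * x u) (by positivity)
    have p2 := H.pos (|s| * y u) (by positivity)
    have p3 := H.pos _ h3
    have p4 := H.pos _ h4
    generalize σ (|t| * x u) = A at *
    generalize σ (|s| * y u) = B' at *
    generalize covFromStd σ (x u * t) (y u * s) = D at *
    field_simp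
  · rw [limCov, if_pos hpos]
    set L := ρ ^ (1 / (α - 1)) with hL
    have hL0 : 0 < L := by positivity
    have hq := H.ratio_pos x y a b ρ hpos hx hy ha hb hax hby hba
    rw [← hL] at hq
    have U0 := H.uct _ x L hq hx
    have U1 := H.uct (fun _ => t) x t tendsto_const_nhds hx
    have U2 := H.uct (fun u => y u / x u * s) x (L * s) (hq.mul_const s) hx
    have U3 := H.uct (fun u => t - y u / x u * s) x (t - L * s) ((hq.mul_const s).const_sub t) hx
    have hden : ρ ^ (1 / (α - 1) * α) = |L| ^ α := by
      rw [abs_of_pos hL0, hL, Real.rpow_mul hpos.le]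
    rw [hden, hsq, hsq, hsq]
    have hLp : 0 < |L| ^ α := Real.rpow_pos_of_pos (abs_pos.2 hL0.ne') _
    have main := (((U1.pow 2).add (U2.pow 2)).sub (U3.pow 2)).div (U0.const_mul 2) (by positivity)
    refine main.congr' ?_
    filter_upwards [hy.eventually_gt_atTop 0, hx.eventually_gt_atTop 0] with u h3 h4
    have e0 : |y u / x u| * x u = y u := by
      rw [abs_of_pos (by positivity)]; field_simp
    have e1 : |t| * x u = |x u * t| := by rw [abs_mul, abs_of_pos h4, mul_comm]
    have e2 : |y u / x u * s| * x u = |y u * s| := by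
      rw [abs_mul, mul_right_comm, e0, abs_mul, abs_of_pos h3]
    have e3 : |t - y u / x u * s| * x u = |x u * t - y u * s| := by
      rw [← abs_of_pos h4, ← abs_mul, abs_of_pos h4]; congr 1; field_simp
    simp only [Pi.div_apply]
    rw [e0, e1, e2, e3, covFromStd]
    have p3 := H.pos _ h3
    have p4 := H.pos _ h4
    field_simp


lemma incB_of_gauss {Ω : Type*} [MeasurableSpace Ω] (P : Measure Ω) (X : ℝ → Ω → ℝ)
    (M : ℝ) (p : ℕ) (C γ γ' : ℝ) (hC : 0 ≤ C)
    (hM : ∀ (Y : Ω → ℝ), Measurable Y → ∀ v : NNReal, P.map Y = gaussianReal 0 v →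
      ∀ s : ℝ, 0 ≤ s → (v:ℝ) ≤ s ^ 2 → ∀ x : ℝ, 0 < x →
        P {ω | x ≤ |Y ω|} ≤ ENNReal.ofReal (M * (s / x) ^ p))
    (hX : ∀ t, Measurable (X t))
    (hv : ∀ s t, ∃ v : ℝ, v ≤ (C * max (|t - s| ^ γ) (|t - s| ^ γ')) ^ 2 ∧
      P.map (fun ω => X t ω - X s ω) = gaussianReal 0 v.toNNReal) :
    IncB P X (M * C ^ p) p γ γ' := by
  intro s t x hx
  obtain ⟨v, hv1, hv2⟩ := hv s t
  have hm : 0 ≤ max (|t - s| ^ γ) (|t - s| ^ γ') :=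
    le_max_of_le_left (Real.rpow_nonneg (abs_nonneg _) _)
  have := hM (fun ω => X t ω - X s ω) ((hX t).sub (hX s)) _ hv2
    (C * max (|t - s| ^ γ) (|t - s| ^ γ')) (mul_nonneg hC hm)
    (by rw [Real.coe_toNNReal']; exact max_le hv1 (sq_nonneg _)) x hx
  refine this.trans (le_of_eq ?_)
  congr 1
  rw [mul_div_assoc, mul_pow, mul_assoc]

lemma incr_J {Ω : Type*} [MeasurableSpace Ω] (P : Measure Ω)
    (σ : ℝ → ℝ) (hσ0 : σ 0 = 0)
    (J : ℝ → Ω → ℝ) (hJ : IsCenteredGaussian1 P J (covFromStd σ)) (d m s t : ℝ) :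
    P.map (fun ω => J (d * t) ω / m - J (d * s) ω / m) =
      gaussianReal 0 ((σ |d * t - d * s| / m) ^ 2).toNNReal := by
  have h := hJ.2 2 ![d * t, d * s] ![m⁻¹, -m⁻¹]
  have e : (∑ x : Fin 2, ∑ y : Fin 2, (![m⁻¹, -m⁻¹] : Fin 2 → ℝ) x * (![m⁻¹, -m⁻¹] : Fin 2 → ℝ) y *
      covFromStd σ ((![d * t, d * s] : Fin 2 → ℝ) x) ((![d * t, d * s] : Fin 2 → ℝ) y)) =
        (σ |d * t - d * s| / m) ^ 2 := by
    simp [Fin.sum_univ_two, covFromStd, hσ0, abs_sub_comm (d * s) (d * t)]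
    ring
  rw [e] at h
  rw [← h]
  congr 1
  funext ω; simp [Fin.sum_univ_two]; ring

lemma incr_B {Ω : Type*} [MeasurableSpace Ω] {n : ℕ} (P : Measure Ω)
    (α : ℝ) (hα : 0 < α) (ρ : Fin n → Fin n → ℝ) (B : ℝ → Ω → Fin n → ℝ)
    (hB : IsCenteredGaussianVec P B (limCovMat α ρ)) (i : Fin n) (hi : ρ i i = 1) (s t : ℝ) :
    P.map (fun ω => B t ω i - B s ω i) =
      gaussianReal 0 ((|t - s| ^ α) ^ 2).toNNReal := by
  have hsq : ∀ z : ℝ, |z| ^ (2 * α) = (|z| ^ α) ^ 2 := fun z => by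
    rw [mul_comm, Real.rpow_mul (abs_nonneg _)]; norm_cast
  have h := hB.2 2 ![t, s] ![Pi.single i 1, Pi.single i (-1)]
  have hc : ∀ a b, limCovMat α ρ i i a b = ((|a| ^ α) ^ 2 + (|b| ^ α) ^ 2 - (|a - b| ^ α) ^ 2) / 2 := by
    intro a b
    simp [limCovMat, limCov, hi, hsq]
  have h0 : (0:ℝ) ^ α = 0 := Real.zero_rpow hα.ne'
  have e : (∑ a : Fin 2, ∑ b : Fin 2, ∑ k, ∑ j,
      (![Pi.single i 1, Pi.single i (-1)] : Fin 2 → Fin n → ℝ) a k *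
      (![Pi.single i 1, Pi.single i (-1)] : Fin 2 → Fin n → ℝ) b j *
      limCovMat α ρ k j ((![t, s] : Fin 2 → ℝ) a) ((![t, s] : Fin 2 → ℝ) b)) =
        (|t - s| ^ α) ^ 2 := by
    simp [Fin.sum_univ_two, Pi.single_apply, hc, h0, abs_sub_comm s t]
    ring
  rw [e] at h
  rw [← h]
  congr 1
  funext ω; simp [Fin.sum_univ_two, Pi.single_apply]; ring

lemma gaussVec_of_J {Ω : Type*} [MeasurableSpace Ω] {n : ℕ} (P : Measure Ω)
    (K : ℝ → ℝ → ℝ)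
    (J : ℝ → Ω → ℝ) (hJ : IsCenteredGaussian1 P J K) (d m : Fin n → ℝ) :
    IsCenteredGaussianVec P (fun t ω i => J (d i * t) ω / m i)
      (fun i j t s => K (d i * t) (d j * s) / (m i * m j)) := by
  refine ⟨fun t i => (hJ.1 _).div_const _, fun k t c => ?_⟩
  have h := hJ.2 (k * n) (fun q => d (finProdFinEquiv.symm q).2 * t (finProdFinEquiv.symm q).1)
    (fun q => c (finProdFinEquiv.symm q).1 (finProdFinEquiv.symm q).2 / m (finProdFinEquiv.symm q).2)
  have hs : ∀ f : Fin k × Fin n → ℝ, ∑ q : Fin (k * n), f (finProdFinEquiv.symm q) =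
      ∑ a, ∑ i, f (a, i) := by
    intro f
    rw [Equiv.sum_comp finProdFinEquiv.symm f, Fintype.sum_prod_type]
  have e1 : (fun ω => ∑ q : Fin (k * n), c (finProdFinEquiv.symm q).1 (finProdFinEquiv.symm q).2 /
      m (finProdFinEquiv.symm q).2 *
      J (d (finProdFinEquiv.symm q).2 * t (finProdFinEquiv.symm q).1) ω) =
      fun ω => ∑ a, ∑ i, c a i * (J (d i * t a) ω / m i) := by
    funext ω
    rw [hs (fun q => c q.1 q.2 / m q.2 * J (d q.2 * t q.1) ω)]
    refine Finset.sum_congr rfl fun a _ => Finset.sum_congr rfl fun i _ => ?_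
    ring
  rw [e1] at h
  rw [h]
  refine congrArg (fun v : ℝ => gaussianReal 0 v.toNNReal) ?_
  refine (hs (fun q => ∑ q' : Fin (k * n), c q.1 q.2 / m q.2 *
    (c (finProdFinEquiv.symm q').1 (finProdFinEquiv.symm q').2 / m (finProdFinEquiv.symm q').2) *
    K (d q.2 * t q.1) (d (finProdFinEquiv.symm q').2 * t (finProdFinEquiv.symm q').1))).trans ?_
  refine Finset.sum_congr rfl fun a _ => ?_
  refine Eq.trans ?_ Finset.sum_comm
  refine Finset.sum_congr rfl fun i _ => ?_
  refine (hs (fun q' => c a i / m i * (c q'.1 q'.2 / m q'.2) *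
    K (d i * t a) (d q'.2 * t q'.1))).trans ?_
  refine Finset.sum_congr rfl fun b _ => Finset.sum_congr rfl fun j _ => ?_
  simp only [div_eq_mul_inv, mul_inv]
  ring

lemma xbar_scale {Ω : Type*} (J : ℝ → Ω → ℝ) (c r d m t : ℝ) (ω : Ω) (hd : 0 < d) (hm : 0 < m)
    (hr : r * d = m) :
    XbarProc J c r (d * t) ω / m = supF c (fun s => J (d * s) ω / m) t := by
  rw [XbarProc, supF, div_eq_inv_mul, Real.mul_iSup_of_nonneg (inv_nonneg.2 hm.le)]
  let e : Set.Iio t ≃ Set.Iio (d * t) :=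
    { toFun := fun s => ⟨d * s, mul_lt_mul_of_pos_left s.2 hd⟩
      invFun := fun s => ⟨d⁻¹ * s, by
        have := mul_lt_mul_of_pos_left s.2 (inv_pos.2 hd)
        rwa [inv_mul_cancel_left₀ hd.ne'] at this⟩
      left_inv := fun s => by ext; simp [hd.ne']
      right_inv := fun s => by ext; simp [hd.ne'] }
  rw [← e.iSup_comp]
  refine congrArg _ (funext fun s => ?_)
  change m⁻¹ * (c * (J (d * t) ω - J (d * s) ω) - r * (d * t - d * s)) = _
  have : r * (d * t - d * s) = m * (t - s) := by rw [← hr]; ring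
  rw [this]
  field_simp

/-- **Lemma 4 (heavy traffic).** Under H1, H2, N1–N3 and `r i u → 0`, the scaled
reflected processes `X̄ᵟ_u` converge in distribution in `C([0,∞) → ℝⁿ)` to `𝔛_α`. -/
theorem sup_convergence_heavy
    {Ω Ω' : Type*} [MeasurableSpace Ω] [MeasurableSpace Ω']
    (P : Measure Ω) (P' : Measure Ω')
    [IsProbabilityMeasure P] [IsProbabilityMeasure P']
    {n : ℕ} (hn : 0 < n)
    -- the Gaussian input process and its standard deviation function
    (σ : ℝ → ℝ) (hσcont : ContinuousOn σ (Set.Ici 0)) (hσ0 : σ 0 = 0)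
    (hσpos : ∀ t > (0:ℝ), 0 < σ t)
    (J : ℝ → Ω → ℝ) (hJcont : ∀ ω, Continuous fun t => J t ω)
    (hJ0 : ∀ ω, J 0 ω = 0)
    (hJgauss : IsCenteredGaussian1 P J (covFromStd σ))
    -- assumption H1
    (α : ℝ) (hα : α ∈ Set.Ioo (0:ℝ) 1)
    (hH1 : ∀ t > (0:ℝ), Tendsto (fun x => σ (t * x) / σ x) atTop (𝓝 (t ^ α)))
    -- assumption H2
    (t₀ β C : ℝ) (ht₀ : 0 < t₀) (hβ : β ∈ Set.Ioc (0:ℝ) 1) (hC : 0 < C)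
    (hH2 : ∀ t, 0 < t → t < t₀ → σ t ≤ C * t ^ β)
    -- the routing matrix: strictly upper triangular, nonnegative entries,
    -- at most one positive entry per column
    (Pm : Matrix (Fin n) (Fin n) ℝ)
    (hPnn : ∀ i j, 0 ≤ Pm i j)
    (hPut : ∀ i j, j ≤ i → Pm i j = 0)
    (hPcol : ∀ j i i', 0 < Pm i j → 0 < Pm i' j → i = i')
    -- output rates: positive, monotone in u, tending to 0 (heavy traffic)
    (r : Fin n → ℝ → ℝ)
    (hrpos : ∀ i, ∀ u > (0:ℝ), 0 < r i u)
    (hrmono : ∀ i, Monotone (r i) ∨ Antitone (r i))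
    (hrlim : ∀ i, Tendsto (r i) atTop (𝓝 0))
    -- assumption N1
    (hN1 : ∀ i j, 0 < Pm i j → ∀ u > (0:ℝ), r j u < Pm i j * r i u)
    -- assumption N3
    (ρ : Fin n → Fin n → ℝ)
    (hρmem : ∀ i j, i ≤ j → ρ i j ∈ Set.Icc (0:ℝ) 1)
    (hN3 : ∀ i j, i ≤ j → Tendsto (fun u => r j u / r i u) atTop (𝓝 (ρ i j)))
    -- the scaling function δ, solving x δ(x) = σ(δ(x)) near 0
    (δ : ℝ → ℝ) (hδ : ∀ᶠ x in 𝓝[>] (0:ℝ), 0 < δ x ∧ x * δ x = σ (δ x))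
    -- the limiting n-dimensional Gaussian process B_α
    (B : ℝ → Ω' → Fin n → ℝ)
    (hBcont : ∀ ω i, Continuous fun t => B t ω i)
    (hBgauss : IsCenteredGaussianVec P' B (limCovMat α ρ)) :
    -- conclusion: X̄ᵟ_u → 𝔛_α in distribution in C([0,∞) → ℝⁿ)
    TendstoInDistOnCompacts P P' (Set.Ici 0) n
      (fun u ω t i =>
        XbarProc J ((1 - Pm.transpose)⁻¹ i ⟨0, hn⟩) (r i u) (δ (r i u) * t) ω
          / σ (δ (r i u)))
      (fun ω t i =>
        ⨆ s : Set.Iio t,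
          ((1 - Pm.transpose)⁻¹ i ⟨0, hn⟩ * (B t ω i - B (↑s) ω i) - (t - ↑s))) := by
  have H : SigH σ α := ⟨hσcont, hσ0, hσpos, fun a b c d => sig_CS P σ hσ0 hσpos J hJgauss a b c d,
    hα, hH1, ⟨t₀, β, C, ht₀, hβ.1, hC, hH2⟩⟩
  obtain ⟨A, γ, γ', x0, hA, hγ, hγγ, hγα, hαγ', hγ1, hx0, hR⟩ := H.R1
  obtain ⟨p, hp⟩ := exists_nat_ge (4 / γ)
  rw [div_le_iff₀ hγ] at hp
  obtain ⟨M1, hM1, hT1⟩ := gauss_tail p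
  obtain ⟨M2, hM2, hT2⟩ := gauss_tail p
  have hA0 : 0 ≤ A := by linarith
  -- eventual properties of the scaling
  have hrpos' : ∀ i, ∀ᶠ u in atTop, 0 < r i u := fun i => by
    filter_upwards [eventually_gt_atTop 0] with u hu using hrpos i u hu
  have hrlim' : ∀ i, Tendsto (r i) atTop (𝓝[>] 0) := fun i =>
    tendsto_nhdsWithin_iff.2 ⟨hrlim i, hrpos' i⟩
  have hd : ∀ i, ∀ᶠ u in atTop, 0 < δ (r i u) ∧ r i u * δ (r i u) = σ (δ (r i u)) :=
    fun i => (hrlim' i).eventually hδ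
  have hdtop : ∀ i, Tendsto (fun u => δ (r i u)) atTop atTop := fun i =>
    H.delta_atTop (r i) (fun u => δ (r i u)) (hrlim i) (hd i)
  have hgood : ∀ᶠ u in atTop, ∀ i, x0 ≤ δ (r i u) ∧ r i u * δ (r i u) = σ (δ (r i u)) := by
    rw [eventually_all]
    intro i
    filter_upwards [hd i, (hdtop i).eventually_ge_atTop x0] with u h1 h2 using ⟨h2, h1.2⟩
  have hρ1 : ∀ i, ρ i i = 1 := fun i => by
    refine tendsto_nhds_unique (hN3 i i le_rfl) (tendsto_const_nhds.congr' ?_)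
    filter_upwards [hrpos' i] with u hu
    rw [div_self hu.ne']
  have hKlim : ∀ i j t s, Tendsto (fun u => covFromStd σ (δ (r i u) * t) (δ (r j u) * s) /
      (σ (δ (r i u)) * σ (δ (r j u)))) atTop (𝓝 (limCovMat α ρ i j t s)) := by
    have hle : ∀ i j, i ≤ j → ∀ t s, Tendsto (fun u => covFromStd σ (δ (r i u) * t) (δ (r j u) * s) /
        (σ (δ (r i u)) * σ (δ (r j u)))) atTop (𝓝 (limCov α (ρ i j) t s)) := fun i j hij t s =>
      H.cov_lim (fun u => δ (r i u)) (fun u => δ (r j u)) (r i) (r j) (ρ i j) (hdtop i) (hdtop j)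
        (hrpos' i) (hrpos' j) ((hd i).mono fun u h => h.2) ((hd j).mono fun u h => h.2)
        (hρmem i j hij).1 (hN3 i j hij) t s
    intro i j t s
    rw [limCovMat]
    split_ifs with hij
    · exact hle i j hij t s
    · refine (hle j i (le_of_not_ge hij) s t).congr fun u => ?_
      rw [covFromStd, covFromStd, abs_sub_comm, mul_comm (σ (δ (r j u))),
        add_comm (σ |δ (r j u) * s| ^ 2)]
  intro F
  refine tendsto_of_seq_tendsto fun u hu => ?_
  obtain ⟨k0, hk0⟩ := eventually_atTop.1 (hu.eventually hgood)
  rw [← tendsto_add_atTop_iff_nat k0]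
  set w : ℕ → ℝ := fun k => u (k + k0) with hw
  have hwt : Tendsto w atTop atTop := (tendsto_add_atTop_iff_nat k0).2 hu
  have hwg : ∀ k i, x0 ≤ δ (r i (w k)) ∧ r i (w k) * δ (r i (w k)) = σ (δ (r i (w k))) :=
    fun k => hk0 (k + k0) (Nat.le_add_left _ _)
  have hwd : ∀ k i, 0 < δ (r i (w k)) := fun k i => hx0.trans_le (hwg k i).1
  set Z : ℕ → ℝ → Ω → Fin n → ℝ := fun k t ω i => J (δ (r i (w k)) * t) ω / σ (δ (r i (w k))) with hZ
  have hZg : ∀ k, IsCenteredGaussianVec P (Z k) (fun i j t s =>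
      covFromStd σ (δ (r i (w k)) * t) (δ (r j (w k)) * s) /
        (σ (δ (r i (w k))) * σ (δ (r j (w k))))) := fun k =>
    gaussVec_of_J P _ J hJgauss (fun i => δ (r i (w k))) (fun i => σ (δ (r i (w k))))
  have hIncMono : ∀ {Ω₁ : Type _} [MeasurableSpace Ω₁] (Q : Measure Ω₁) (X : ℝ → Ω₁ → ℝ) (D D' : ℝ),
      D ≤ D' → IncB Q X D p γ γ' → IncB Q X D' p γ γ' := by
    intro Ω₁ _ Q X D D' hDD h s t x hx
    refine (h s t x hx).trans (ENNReal.ofReal_le_ofReal ?_)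
    have : 0 ≤ (max (|t - s| ^ γ) (|t - s| ^ γ') / x) ^ p :=
      pow_nonneg (div_nonneg (le_max_of_le_left (Real.rpow_nonneg (abs_nonneg _) _)) hx.le) _
    exact mul_le_mul_of_nonneg_right hDD this
  have hApp : 0 ≤ A ^ p := pow_nonneg hA0 p
  have main := weak_conv P P' γ γ' hγ hγγ hγ1 p hp ((M1 + M2) * A ^ p) (by positivity)
    (fun i => (1 - Pm.transpose)⁻¹ i ⟨0, hn⟩) Z B
    (fun k t => measurable_pi_lambda _ fun i => (hZg k).1 t i)
    (fun t => measurable_pi_lambda _ fun i => hBgauss.1 t i)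
    (fun k ω i => ((hJcont ω).comp (continuous_const.mul continuous_id)).div_const _)
    hBcont ?_ ?_ ?_ F
  · refine (tendsto_congr fun k => ?_).1 main
    refine integral_congr_ae (Eventually.of_forall fun ω => ?_)
    refine congrArg F (congrArg _ ?_)
    funext t i
    exact (xbar_scale J _ _ _ _ _ ω (hwd k i) (hσpos _ (hwd k i)) (hwg k i).2).symm
  · intro k i
    refine hIncMono P _ (M1 * A ^ p) _ (by nlinarith) ?_
    refine incB_of_gauss P _ M1 p A γ γ' hA0 (fun Y hY v hv s hs hvs x hx =>
      hT1 P Y hY v hv s hs hvs x hx) (fun t => (hZg k).1 t i) ?_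
    intro s t
    refine ⟨_, ?_, incr_J P σ hσ0 J hJgauss (δ (r i (w k))) (σ (δ (r i (w k)))) s t⟩
    have hsp := hσpos _ (hwd k i)
    have e : |δ (r i (w k)) * t - δ (r i (w k)) * s| = |t - s| * δ (r i (w k)) := by
      rw [← mul_sub, abs_mul, abs_of_pos (hwd k i), mul_comm]
    rw [e]
    have := hR _ (hwg k i).1 |t - s| (abs_nonneg _)
    refine pow_le_pow_left₀ (div_nonneg (H.nonneg _ (mul_nonneg (abs_nonneg _) (hwd k i).le)) hsp.le) ?_ 2
    rwa [div_le_iff₀ hsp]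
  · intro i
    have : IncB P' (fun t ω => B t ω i) (M2 * A ^ p) p γ γ' := by
      refine incB_of_gauss P' _ M2 p A γ γ' hA0 (fun Y hY v hv s hs hvs x hx =>
        hT2 P' Y hY v hv s hs hvs x hx) (fun t => hBgauss.1 t i) ?_
      intro s t
      refine ⟨_, ?_, incr_B P' α hα.1 ρ B hBgauss i (hρ1 i) s t⟩
      refine pow_le_pow_left₀ (Real.rpow_nonneg (abs_nonneg _) _) ?_ 2
      have h1 : |t - s| ^ α ≤ max (|t - s| ^ γ) (|t - s| ^ γ') := by
        rcases (abs_nonneg (t - s)).eq_or_lt with h0 | h0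
        · rw [← h0, Real.zero_rpow hα.1.ne']
          exact le_max_of_le_left (Real.rpow_nonneg le_rfl _)
        rcases le_total |t - s| 1 with h | h
        · exact le_max_of_le_left (Real.rpow_le_rpow_of_exponent_ge h0 h hγα)
        · exact le_max_of_le_right (Real.rpow_le_rpow_of_exponent_le h hαγ')
      have h2 : 0 ≤ max (|t - s| ^ γ) (|t - s| ^ γ') :=
        le_max_of_le_left (Real.rpow_nonneg (abs_nonneg _) _)
      nlinarith
    intro s t x hx
    refine (this s t x hx).trans (ENNReal.ofReal_le_ofReal ?_)
    have h3 : 0 ≤ (max (|t - s| ^ γ) (|t - s| ^ γ') / x) ^ p :=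
      pow_nonneg (div_nonneg (le_max_of_le_left (Real.rpow_nonneg (abs_nonneg _) _)) hx.le) _
    exact mul_le_mul_of_nonneg_right (by nlinarith) h3
  · exact fdd_conv P P' Z B _ _ hZg hBgauss fun i j t s => (hKlim i j t s).comp hwt
end
end

section
/- Uniform negligibility of the far-past supremum for the scaled Gaussian input (Lemma on sup tails). Assume σ satisfies L1 and L2, and let δ : (0,∞) → (0,∞) satisfy u δ(u) = σ(δ(u)) for all u > 0, δ(u) → 0 as u → ∞, and δ bounded on [u₀,∞) for every u₀ > 0. Then for every C̄ > 0, t ∈ [0,∞), v ∈ ℝ and every u₀ > 0: lim_{𝒯→∞} sup_{u ≥ u₀} ℙ( sup_{−∞<s<−𝒯} ( (C̄/σ(δ(u)))·(J(δ(u)t) − J(δ(u)s)) − (t − s) ) > v ) = 0. -/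
open MeasureTheory ProbabilityTheory Filter Topology

noncomputable section

/-- Halving estimate. -/
lemma aux_half (σ : ℝ → ℝ) (hσcont : ContinuousOn σ (Set.Ici 0))
    (hσpos : ∀ t > (0:ℝ), 0 < σ t) (x0 X b : ℝ) (hx0 : 0 < x0) (hX : x0 ≤ X)
    (hb0 : 0 < b) (hb1 : b < 1)
    (h : ∀ x, 0 < x → x ≤ x0 → σ (x / 2) ≤ b * σ x) :
    ∃ K, 1 ≤ K ∧ ∀ k : ℕ, ∀ x, 0 < x → x ≤ X → σ (x / 2 ^ k) ≤ K * b ^ k * σ x := by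
  have hXpos : 0 < X := hx0.trans_le hX
  obtain ⟨m, hm⟩ := pow_unbounded_of_one_lt (X / x0) (by norm_num : (1:ℝ) < 2)
  have hmx : X < 2 ^ m * x0 := by rwa [div_lt_iff₀ hx0] at hm
  have hsub : Set.Icc (0:ℝ) X ⊆ Set.Ici 0 := fun y hy => hy.1
  have hsub2 : Set.Icc x0 X ⊆ Set.Ici 0 := fun y hy => hx0.le.trans hy.1
  obtain ⟨M, hM⟩ := isCompact_Icc.bddAbove_image (hσcont.mono hsub)
  obtain ⟨z, hz, hzmin⟩ := isCompact_Icc.exists_isMinOn (Set.nonempty_Icc.2 hX) (hσcont.mono hsub2)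
  have hμ : 0 < σ z := hσpos z (hx0.trans_le hz.1)
  have hM' : ∀ y, 0 ≤ y → y ≤ X → σ y ≤ M := fun y h1 h2 => hM ⟨y, ⟨h1, h2⟩, rfl⟩
  have hMpos : 0 < M := (hσpos X hXpos).trans_le (hM' X hXpos.le le_rfl)
  have hz2 : σ z ≤ M := hM' z (hx0.le.trans hz.1) hz.2
  have hbm : 0 < b ^ m := pow_pos hb0 m
  have hbm1 : b ^ m ≤ 1 := pow_le_one₀ hb0.le hb1.le
  set K := M / σ z / b ^ m with hK
  have hK1 : 1 ≤ K := by
    rw [hK, one_le_div hbm]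
    exact hbm1.trans ((one_le_div hμ).2 hz2)
  refine ⟨K, hK1, fun k => ?_⟩
  induction k with
  | zero =>
    intro x hx hxX
    have := hσpos x hx
    simp only [pow_zero, div_one, mul_one]
    nlinarith
  | succ k ih =>
    intro x hx hxX
    by_cases hc : x / 2 ^ k ≤ x0
    · have h1 := h (x / 2 ^ k) (by positivity) hc
      have h2 := ih x hx hxX
      have h3 : x / 2 ^ (k+1) = x / 2 ^ k / 2 := by rw [pow_succ]; field_simp
      rw [h3]
      calc _ ≤ b * σ (x / 2 ^ k) := h1
        _ ≤ b * (K * b ^ k * σ x) := by gcongr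
        _ = _ := by ring
    · push Not at hc
      rw [lt_div_iff₀ (by positivity)] at hc
      have hkm : k < m := by
        have : x0 * 2 ^ k < x0 * 2 ^ m := by linarith
        have := lt_of_mul_lt_mul_left this hx0.le
        exact (pow_lt_pow_iff_right₀ (by norm_num)).1 this
      have hxx0 : x0 ≤ x := by
        have : (1:ℝ) ≤ 2 ^ k := one_le_pow₀ (by norm_num)
        nlinarith
      have h1 : σ (x / 2 ^ (k+1)) ≤ M := by
        apply hM' _ (by positivity)
        refine le_trans (div_le_self hx.le (one_le_pow₀ (by norm_num))) hxX
      have h2 : σ z ≤ σ x := hzmin ⟨hxx0, hxX⟩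
      have h3 : b ^ m ≤ b ^ (k+1) := pow_le_pow_of_le_one hb0.le hb1.le hkm
      have h4 : M = K * b ^ m * σ z := by rw [hK]; field_simp
      have hK0 : 0 ≤ K := by linarith
      calc _ ≤ M := h1
        _ = K * b ^ m * σ z := h4
        _ ≤ _ := by gcongr

/-- Doubling estimate. -/
lemma aux_double (σ : ℝ → ℝ) (hσcont : ContinuousOn σ (Set.Ici 0))
    (hσpos : ∀ t > (0:ℝ), 0 < σ t) (x0 X A : ℝ) (hx0 : 0 < x0) (hX : 2 * x0 ≤ X)
    (t₀ β C : ℝ) (ht₀ : 0 < t₀) (hβ : β ∈ Set.Ioo (0:ℝ) 1) (hC : 0 < C)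
    (hL2 : ∀ t > t₀, σ t ≤ C * t ^ β) (hA0 : 1 ≤ A) (hAβ : (2:ℝ) ^ β ≤ A)
    (h : ∀ x, 0 < x → x ≤ x0 → σ (2 * x) ≤ A * σ x) :
    ∃ K, 1 ≤ K ∧ ∀ n : ℕ, ∀ x, 0 < x → x ≤ X → σ (2 ^ n * x) ≤ K * A ^ n * σ x := by
  have hXpos : 0 < X := by linarith
  have hXx : x0 ≤ X := by linarith
  have hsub : Set.Icc (0:ℝ) t₀ ⊆ Set.Ici 0 := fun y hy => hy.1
  have hsub2 : Set.Icc x0 X ⊆ Set.Ici 0 := fun y hy => hx0.le.trans hy.1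
  obtain ⟨M, hM⟩ := isCompact_Icc.bddAbove_image (hσcont.mono hsub)
  obtain ⟨z, hz, hzmin⟩ := isCompact_Icc.exists_isMinOn (Set.nonempty_Icc.2 hXx) (hσcont.mono hsub2)
  have hμ : 0 < σ z := hσpos z (hx0.trans_le hz.1)
  have hM' : ∀ y, 0 ≤ y → y ≤ t₀ → σ y ≤ M := fun y h1 h2 => hM ⟨y, ⟨h1, h2⟩, rfl⟩
  have hMpos : 0 < M := (hσpos t₀ ht₀).trans_le (hM' t₀ ht₀.le le_rfl)
  have hA0' : 0 < A := by linarith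
  have hXβ : 0 < X ^ β := Real.rpow_pos_of_pos hXpos β
  set K := max 1 ((M + C * X ^ β) / σ z) with hK
  have hK1 : 1 ≤ K := le_max_left _ _
  have hK2 : M + C * X ^ β ≤ K * σ z := by
    rw [← div_le_iff₀ hμ]; exact le_max_right _ _
  refine ⟨K, hK1, fun n => ?_⟩
  induction n with
  | zero =>
    intro x hx hxX
    have := hσpos x hx
    simp only [pow_zero, one_mul, mul_one]
    nlinarith
  | succ n ih =>
    intro x hx hxX
    by_cases hc : x ≤ x0
    · have h1 := h x hx hc
      have h2 := ih (2 * x) (by positivity) (by linarith)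
      have h3 : (2:ℝ) ^ (n+1) * x = 2 ^ n * (2 * x) := by ring
      rw [h3]
      calc _ ≤ K * A ^ n * σ (2 * x) := h2
        _ ≤ K * A ^ n * (A * σ x) := by gcongr
        _ = _ := by ring
    · push Not at hc
      have h2 : σ z ≤ σ x := hzmin ⟨hc.le, hxX⟩
      have hAn : 1 ≤ A ^ (n+1) := one_le_pow₀ hA0
      have hpos : 0 < (2:ℝ) ^ (n+1) * x := by positivity
      have hfin : σ (2 ^ (n+1) * x) ≤ (M + C * X ^ β) * A ^ (n+1) := by
        by_cases ht : 2 ^ (n+1) * x ≤ t₀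
        · have := hM' _ hpos.le ht
          have : 0 < C * X ^ β := by positivity
          nlinarith
        · push Not at ht
          have h5 := hL2 _ ht
          have h6 : ((2:ℝ) ^ (n+1) * x) ^ β ≤ A ^ (n+1) * X ^ β := by
            rw [Real.mul_rpow (by positivity) hx.le]
            have e1 : ((2:ℝ) ^ (n+1)) ^ β = ((2:ℝ) ^ β) ^ (n+1) := by
              rw [← Real.rpow_natCast, ← Real.rpow_mul (by norm_num), mul_comm,
                Real.rpow_mul (by norm_num), Real.rpow_natCast]
            rw [e1]
            have := hβ.1.le
            gcongr
          calc _ ≤ C * ((2:ℝ) ^ (n+1) * x) ^ β := h5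
            _ ≤ C * (A ^ (n+1) * X ^ β) := by gcongr
            _ ≤ _ := by
              have : 0 < M * A ^ (n+1) := by positivity
              nlinarith
      calc _ ≤ (M + C * X ^ β) * A ^ (n+1) := hfin
        _ ≤ (K * σ z) * A ^ (n+1) := by gcongr
        _ ≤ (K * σ x) * A ^ (n+1) := by gcongr
        _ = _ := by ring

/-- Comparison at a fixed factor. -/
lemma aux_fixed (σ : ℝ → ℝ) (hσcont : ContinuousOn σ (Set.Ici 0)) (hσ0 : σ 0 = 0)
    (hσpos : ∀ t > (0:ℝ), 0 < σ t) (lam X : ℝ)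
    (hL1 : ∀ t > (0:ℝ), Tendsto (fun x => σ (t * x) / σ x) (𝓝[>] 0) (𝓝 (t ^ lam)))
    (t : ℝ) (ht : 0 ≤ t) :
    ∃ K, 1 ≤ K ∧ ∀ x, 0 < x → x ≤ X → σ (t * x) ≤ K * σ x := by
  rcases ht.eq_or_lt with rfl | ht
  · refine ⟨1, le_rfl, fun x hx _ => ?_⟩
    have := hσpos x hx
    simp [hσ0, this.le]
  have h1 : ∀ᶠ x in 𝓝[>] (0:ℝ), σ (t * x) / σ x < t ^ lam + 1 :=
    (hL1 t ht).eventually_lt_const (by linarith)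
  obtain ⟨x0, hx0, hx⟩ := (mem_nhdsGT_iff_exists_Ioo_subset).1 h1
  have hx0 : 0 < x0 := hx0
  have hc : ContinuousOn (fun x => σ (t * x) / σ x) (Set.Icc x0 X) := by
    apply ContinuousOn.div
    · apply hσcont.comp (by fun_prop)
      intro y hy
      have : 0 < y := hx0.trans_le hy.1
      show 0 ≤ t * y
      positivity
    · exact hσcont.mono fun y hy => hx0.le.trans hy.1
    · intro y hy
      exact (hσpos y (hx0.trans_le hy.1)).ne'
  obtain ⟨M, hM⟩ := isCompact_Icc.bddAbove_image hc
  refine ⟨max 1 (max (t ^ lam + 1) M), le_max_left _ _, fun x hxp hxX => ?_⟩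
  rw [← div_le_iff₀ (hσpos x hxp)]
  by_cases hcx : x < x0
  · have : σ (t * x) / σ x < t ^ lam + 1 := hx ⟨hxp, hcx⟩
    exact this.le.trans ((le_max_left _ _).trans (le_max_right _ _))
  · push Not at hcx
    have : σ (t * x) / σ x ≤ M := hM ⟨x, ⟨hcx, hxX⟩, rfl⟩
    exact this.trans ((le_max_right _ _).trans (le_max_right _ _))

/-- Combined Potter type bound along dyadic ratios. -/
lemma aux_potter (σ : ℝ → ℝ) (hσcont : ContinuousOn σ (Set.Ici 0))
    (hσpos : ∀ t > (0:ℝ), 0 < σ t)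
    (lam : ℝ) (hlam : lam ∈ Set.Ioo (0:ℝ) 1)
    (hL1 : ∀ t > (0:ℝ), Tendsto (fun x => σ (t * x) / σ x) (𝓝[>] 0) (𝓝 (t ^ lam)))
    (t₀ β C : ℝ) (ht₀ : 0 < t₀) (hβ : β ∈ Set.Ioo (0:ℝ) 1) (hC : 0 < C)
    (hL2 : ∀ t > t₀, σ t ≤ C * t ^ β) (X : ℝ) :
    ∃ K A b : ℝ, 1 ≤ K ∧ 1 ≤ A ∧ A < 2 ∧ 0 < b ∧ b < 1 ∧ ∀ n k : ℕ, ∀ x, 0 < x → x ≤ X →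
      σ (2 ^ n * x / 2 ^ k) ≤ K * A ^ n * b ^ k * σ x := by
  have h2l : (2:ℝ) ^ lam < 2 := by
    simpa using Real.rpow_lt_rpow_of_exponent_lt (by norm_num : (1:ℝ) < 2) hlam.2
  have h2b : (2:ℝ) ^ β < 2 := by
    simpa using Real.rpow_lt_rpow_of_exponent_lt (by norm_num : (1:ℝ) < 2) hβ.2
  have h1l : 1 < (2:ℝ) ^ lam := Real.one_lt_rpow (by norm_num) hlam.1
  have hhl : (1/2:ℝ) ^ lam < 1 := Real.rpow_lt_one (by norm_num) (by norm_num) hlam.1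
  have hhl0 : 0 < (1/2:ℝ) ^ lam := by positivity
  have hprod : (1/2:ℝ) ^ lam * (2:ℝ) ^ lam = 1 := by
    rw [← Real.mul_rpow (by norm_num) (by norm_num)]; norm_num
  obtain ⟨A, hA1, hA2⟩ := exists_between (max_lt h2l h2b)
  obtain ⟨b, hb1, hb2⟩ := exists_between hhl
  have hAl : (2:ℝ) ^ lam < A := (le_max_left _ _).trans_lt hA1
  have hAb : (2:ℝ) ^ β < A := (le_max_right _ _).trans_lt hA1
  have hb0 : 0 < b := hhl0.trans hb1
  have hA0 : 1 ≤ A := by linarith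
  have hAbp : 1 ≤ A * b := by nlinarith
  have e1 : ∀ᶠ x in 𝓝[>] (0:ℝ), σ (2 * x) / σ x < A :=
    (hL1 2 (by norm_num)).eventually_lt_const hAl
  have e2 : ∀ᶠ x in 𝓝[>] (0:ℝ), σ (1/2 * x) / σ x < b :=
    (hL1 (1/2) (by norm_num)).eventually_lt_const hb1
  obtain ⟨x1, hx1, hx⟩ := (mem_nhdsGT_iff_exists_Ioo_subset).1 (e1.and e2)
  have hx1 : 0 < x1 := hx1
  have hh : ∀ x, 0 < x → x ≤ x1 / 2 → σ (x / 2) ≤ b * σ x := by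
    intro x h0 h1
    have := (hx (⟨h0, by linarith⟩ : x ∈ Set.Ioo 0 x1)).2
    rw [div_lt_iff₀ (hσpos x h0)] at this
    rw [show x / 2 = 1 / 2 * x by ring]; exact this.le
  have hd : ∀ x, 0 < x → x ≤ x1 / 2 → σ (2 * x) ≤ A * σ x := by
    intro x h0 h1
    have := (hx (⟨h0, by linarith⟩ : x ∈ Set.Ioo 0 x1)).1
    rw [div_lt_iff₀ (hσpos x h0)] at this
    exact this.le
  obtain ⟨K1, hK1, H1⟩ := aux_half σ hσcont hσpos (x1/2) (max X x1) b (by linarith)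
    (le_trans (by linarith) (le_max_right _ _)) hb0 hb2 hh
  obtain ⟨K2, hK2, H2⟩ := aux_double σ hσcont hσpos (x1/2) (max X x1) A (by linarith)
    (le_trans (by linarith) (le_max_right _ _)) t₀ β C ht₀ hβ hC hL2 hA0 hAb.le hd
  refine ⟨max K1 K2, A, b, hK1.trans (le_max_left _ _), hA0, hA2, hb0, hb2, ?_⟩
  intro n k x hx0 hxX
  have hxX' : x ≤ max X x1 := hxX.trans (le_max_left _ _)
  have hs := hσpos x hx0
  rcases le_total k n with hkn | hkn
  · obtain ⟨m, rfl⟩ := Nat.exists_eq_add_of_le hkn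
    have : (2:ℝ) ^ (k+m) * x / 2 ^ k = 2 ^ m * x := by rw [pow_add]; field_simp
    rw [this]
    have hk : 1 ≤ (A * b) ^ k := one_le_pow₀ hAbp
    calc _ ≤ K2 * A ^ m * σ x := H2 m x hx0 hxX'
      _ ≤ max K1 K2 * A ^ m * σ x := by gcongr; exact le_max_right _ _
      _ ≤ max K1 K2 * A ^ m * σ x * (A * b) ^ k := by
        apply le_mul_of_one_le_right _ hk
        have : 0 < max K1 K2 := lt_max_of_lt_left (by linarith)
        positivity
      _ = _ := by rw [mul_pow, pow_add]; ring
  · obtain ⟨m, rfl⟩ := Nat.exists_eq_add_of_le hkn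
    have : (2:ℝ) ^ n * x / 2 ^ (n + m) = x / 2 ^ m := by rw [pow_add]; field_simp
    rw [this]
    have hk : 1 ≤ (A * b) ^ n := one_le_pow₀ hAbp
    calc _ ≤ K1 * b ^ m * σ x := H1 m x hx0 hxX'
      _ ≤ max K1 K2 * b ^ m * σ x := by gcongr; exact le_max_left _ _
      _ ≤ max K1 K2 * b ^ m * σ x * (A * b) ^ n := by
        apply le_mul_of_one_le_right _ hk
        have : 0 < max K1 K2 := lt_max_of_lt_left (by linarith)
        positivity
      _ = _ := by rw [mul_pow, pow_add]; ring

/-- Polynomial tail of a centered Gaussian. -/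
lemma aux_gauss_tail (p : ℕ) (hp : p ≠ 0) : ∃ M : ℝ, 0 ≤ M ∧ ∀ s : ℝ, 0 ≤ s → ∀ a : ℝ, 0 < a →
    gaussianReal 0 (s ^ 2).toNNReal {x | a ≤ |x|} ≤ ENNReal.ofReal (M * (s / a) ^ p) := by
  refine ⟨∫ x, |x| ^ p ∂(gaussianReal 0 1), by positivity, fun s hs a ha => ?_⟩
  have hint : Integrable (fun x : ℝ => |x| ^ p) (gaussianReal 0 1) := by
    have := (memLp_id_gaussianReal (μ := 0) (v := 1) (p : NNReal)).integrable_norm_pow (p := p)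
      (by exact_mod_cast hp)
    simpa using this
  have hmap : gaussianReal 0 (s ^ 2).toNNReal = (gaussianReal 0 1).map (fun x => s * x) := by
    rw [gaussianReal_map_const_mul]
    congr 1
    · simp
    · ext; simp [sq_nonneg]
  rw [hmap, Measure.map_apply (by fun_prop) (measurableSet_le measurable_const (by fun_prop))]
  have hsub : ((fun x => s * x) ⁻¹' {x | a ≤ |x|}) ⊆ {x : ℝ | a ^ p ≤ s ^ p * |x| ^ p} := by
    intro x hx
    have hx : a ≤ |s * x| := hx
    rw [abs_mul, abs_of_nonneg hs] at hx
    show a ^ p ≤ s ^ p * |x| ^ p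
    rw [← mul_pow]
    gcongr
  have hmark := mul_meas_ge_le_integral_of_nonneg (μ := gaussianReal 0 1)
    (f := fun x : ℝ => s ^ p * |x| ^ p) (ae_of_all _ fun x => by positivity)
    (hint.const_mul _) (a ^ p)
  rw [integral_const_mul] at hmark
  rw [← ENNReal.ofReal_toReal (measure_ne_top (gaussianReal 0 1) _)]
  apply ENNReal.ofReal_le_ofReal
  calc _ ≤ (gaussianReal 0 1).real {x : ℝ | a ^ p ≤ s ^ p * |x| ^ p} := measureReal_mono hsub
    _ ≤ (s ^ p * ∫ x, |x| ^ p ∂(gaussianReal 0 1)) / a ^ p := by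
      rw [le_div_iff₀ (by positivity), mul_comm]; exact hmark
    _ = _ := by rw [div_pow]; ring

lemma aux_incr {Ω : Type*} [MeasurableSpace Ω] (P : Measure Ω)
    (σ : ℝ → ℝ) (hσ0 : σ 0 = 0) (J : ℝ → Ω → ℝ)
    (hJ : IsCenteredGaussian1 P J (covFromStd σ)) (x y : ℝ) :
    P.map (fun ω => J x ω - J y ω) = gaussianReal 0 (σ |x - y| ^ 2).toNNReal := by
  have := hJ.2 2 ![x, y] ![1, -1]
  simp only [Fin.sum_univ_two, covFromStd, Matrix.cons_val_zero, Matrix.cons_val_one,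
    sub_self, abs_zero, hσ0] at this
  rw [abs_sub_comm y x] at this
  convert this using 3
  · ring
  · ring

/-- Deterministic chaining. -/
lemma aux_chain (f : ℝ → ℝ) (hf : Continuous f) (hf0 : f 0 = 0) (a : ℕ → ℝ)
    (ha : ∀ k, 0 ≤ a k) (hs : Summable a)
    (h : ∀ k j : ℕ, j < 2 ^ k → |f ((j + 1) / 2 ^ k) - f (j / 2 ^ k)| ≤ a k)
    (x : ℝ) (hx0 : 0 ≤ x) (hx1 : x ≤ 1) : |f x| ≤ ∑' k, a k := by
  have key : ∀ k j : ℕ, j ≤ 2 ^ k → |f (j / 2 ^ k)| ≤ ∑ i ∈ Finset.range (k+1), a i := by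
    intro k
    induction k with
    | zero =>
      intro j hj
      have hj : j ≤ 1 := by simpa using hj
      interval_cases j
      · simpa [hf0] using ha 0
      · simpa [hf0] using h 0 0 (by norm_num)
    | succ k ih =>
      intro j hj
      rw [Finset.sum_range_succ]
      have hak := ha (k+1)
      rcases Nat.even_or_odd' j with ⟨i, rfl | rfl⟩
      · have hi : i ≤ 2 ^ k := by rw [pow_succ] at hj; omega
        have e : (((2 * i : ℕ) : ℝ)) / 2 ^ (k+1) = i / 2 ^ k := by
          rw [pow_succ]; push_cast; field_simp
        rw [e]
        linarith [ih i hi]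
      · have hi : i ≤ 2 ^ k := by rw [pow_succ] at hj; omega
        have h1 := h (k+1) (2 * i) (by omega)
        have e : (((2 * i : ℕ) : ℝ)) / 2 ^ (k+1) = i / 2 ^ k := by
          rw [pow_succ]; push_cast; field_simp
        rw [e] at h1
        have h2 := ih i hi
        have e2 : (((2 * i + 1 : ℕ) : ℝ)) = ((2 * i : ℕ) : ℝ) + 1 := by push_cast; ring
        rw [e2]
        have h3 := abs_add_le (f ((((2 * i : ℕ) : ℝ) + 1) / 2 ^ (k+1)) - f (i / 2 ^ k))
          (f (i / 2 ^ k))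
        rw [sub_add_cancel] at h3
        linarith
  have key2 : ∀ k : ℕ, |f ((⌊x * 2 ^ k⌋₊ : ℝ) / 2 ^ k)| ≤ ∑' k, a k := by
    intro k
    refine (key k _ ?_).trans (hs.sum_le_tsum _ fun i _ => ha i)
    have : x * 2 ^ k ≤ ((2 ^ k : ℕ) : ℝ) := by
      push_cast
      exact mul_le_of_le_one_left (by positivity) hx1
    exact Nat.floor_le_of_le this
  have hlim : Tendsto (fun k : ℕ => (⌊x * 2 ^ k⌋₊ : ℝ) / 2 ^ k) atTop (𝓝 x) :=
    (tendsto_nat_floor_mul_div_atTop hx0).comp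
      (tendsto_pow_atTop_atTop_of_one_lt (by norm_num : (1:ℝ) < 2))
  exact le_of_tendsto ((hf.abs.tendsto x).comp hlim) (Eventually.of_forall key2)


/-- Probability of failure of the chaining bound on one dyadic block. -/
lemma aux_block {Ω : Type*} [MeasurableSpace Ω] (P : Measure Ω) [IsProbabilityMeasure P]
    (σ : ℝ → ℝ) (J : ℝ → Ω → ℝ) (p : ℕ) (M K A q c d : ℝ) (n : ℕ)
    (hM : 0 ≤ M) (hK : 0 ≤ K) (hA : 0 ≤ A) (hq : 0 < q) (hc : 0 < c) (hd : 0 < d)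
    (hσd : 0 < σ d) (hσnn : ∀ x, 0 ≤ x → 0 ≤ σ x)
    (hqp : q ^ p ≤ 1 / 4)
    (htail : ∀ x y a : ℝ, 0 < a →
      P {ω | a ≤ |J x ω - J y ω|} ≤ ENNReal.ofReal (M * (σ |x - y| / a) ^ p))
    (hpot : ∀ k : ℕ, σ (2 ^ n * d / 2 ^ k) ≤ K * A ^ n * (q ^ 2) ^ k * σ d) :
    P {ω | ∃ k j : ℕ, j < 2 ^ k ∧ σ d * (c * 2 ^ n * q ^ k) ≤
        |J (-(d * 2 ^ n * ((j + 1) / 2 ^ k))) ω - J (-(d * 2 ^ n * (j / 2 ^ k))) ω|}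
      ≤ ENNReal.ofReal (2 * (M * (K / c) ^ p) * ((A / 2) ^ p) ^ n) := by
  set D := M * (K / c) ^ p * ((A / 2) ^ p) ^ n with hD
  have hD0 : 0 ≤ D := by positivity
  have hone : ∀ k j : ℕ, P {ω | σ d * (c * 2 ^ n * q ^ k) ≤
        |J (-(d * 2 ^ n * ((j + 1) / 2 ^ k))) ω - J (-(d * 2 ^ n * (j / 2 ^ k))) ω|}
      ≤ ENNReal.ofReal (D * (1 / 4) ^ k) := by
    intro k j
    refine (htail _ _ _ (by positivity)).trans (ENNReal.ofReal_le_ofReal ?_)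
    have e : |(-(d * 2 ^ n * (((j:ℝ) + 1) / 2 ^ k))) - (-(d * 2 ^ n * (j / 2 ^ k)))|
        = 2 ^ n * d / 2 ^ k := by
      rw [show (-(d * 2 ^ n * (((j:ℝ) + 1) / 2 ^ k))) - (-(d * 2 ^ n * (j / 2 ^ k)))
        = -(2 ^ n * d / 2 ^ k) by ring, abs_neg, abs_of_pos (by positivity)]
    rw [e]
    have h1 : σ (2 ^ n * d / 2 ^ k) / (σ d * (c * 2 ^ n * q ^ k))
        ≤ (K / c) * (A / 2) ^ n * q ^ k := by
      rw [div_le_iff₀ (by positivity)]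
      refine (hpot k).trans (le_of_eq ?_)
      rw [div_pow, ← pow_mul, mul_comm 2 k, pow_mul]
      field_simp
    have h0 : 0 ≤ σ (2 ^ n * d / 2 ^ k) / (σ d * (c * 2 ^ n * q ^ k)) :=
      div_nonneg (hσnn _ (by positivity)) (by positivity)
    calc _ ≤ M * ((K / c) * (A / 2) ^ n * q ^ k) ^ p := by gcongr
      _ = D * (q ^ p) ^ k := by
        rw [hD, mul_pow, mul_pow, ← pow_mul, ← pow_mul, ← pow_mul, ← pow_mul,
          mul_comm n p, mul_comm k p]; ring
      _ ≤ _ := by gcongr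
  have hlev : ∀ k : ℕ, P (⋃ j ∈ Finset.range (2 ^ k), {ω | σ d * (c * 2 ^ n * q ^ k) ≤
        |J (-(d * 2 ^ n * (((j:ℝ) + 1) / 2 ^ k))) ω - J (-(d * 2 ^ n * ((j:ℝ) / 2 ^ k))) ω|})
      ≤ ENNReal.ofReal (D * (1 / 2) ^ k) := by
    intro k
    refine (measure_biUnion_finset_le _ _).trans ?_
    refine (Finset.sum_le_sum fun j _ => hone k j).trans ?_
    rw [Finset.sum_const, Finset.card_range, nsmul_eq_mul,
      ← ENNReal.ofReal_natCast, ← ENNReal.ofReal_mul (by positivity)]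
    apply ENNReal.ofReal_le_ofReal
    push_cast
    rw [mul_left_comm, ← mul_pow]
    norm_num
  calc _ ≤ P (⋃ k : ℕ, ⋃ j ∈ Finset.range (2 ^ k), {ω | σ d * (c * 2 ^ n * q ^ k) ≤
        |J (-(d * 2 ^ n * (((j:ℝ) + 1) / 2 ^ k))) ω - J (-(d * 2 ^ n * ((j:ℝ) / 2 ^ k))) ω|}) := by
        apply measure_mono
        rintro ω ⟨k, j, hj, h⟩
        simp only [Set.mem_iUnion, Finset.mem_range]
        exact ⟨k, j, hj, h⟩
    _ ≤ ∑' k : ℕ, ENNReal.ofReal (D * (1 / 2) ^ k) :=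
        (measure_iUnion_le _).trans (ENNReal.tsum_le_tsum hlev)
    _ = ENNReal.ofReal (∑' k : ℕ, D * (1 / 2) ^ k) :=
        (ENNReal.ofReal_tsum_of_nonneg (fun k => by positivity)
          (summable_geometric_two.mul_left D)).symm
    _ = _ := by
        rw [tsum_mul_left, tsum_geometric_two, hD]; congr 1; ring

/-- **Uniform negligibility of the far-past supremum of the scaled Gaussian input
(Lemma on sup tails, light traffic).** Under L1 and L2, if `δ` solves
`u δ(u) = σ(δ(u))`, `δ(u) → 0` and `δ` is bounded on `[u₀,∞)` for every `u₀ > 0`, then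
for every `C̄ > 0`, `t ≥ 0`, `v ∈ ℝ` and `u₀ > 0`,
`sup_{u ≥ u₀} ℙ( sup_{s < −𝒯} ( (C̄/σ(δ(u))) (J(δ(u)t) − J(δ(u)s)) − (t−s) ) > v ) → 0`
as `𝒯 → ∞`. -/
theorem sup_tail_uniform
    {Ω : Type*} [MeasurableSpace Ω] (P : Measure Ω) [IsProbabilityMeasure P]
    (σ : ℝ → ℝ) (hσcont : ContinuousOn σ (Set.Ici 0)) (hσ0 : σ 0 = 0)
    (hσpos : ∀ t > (0:ℝ), 0 < σ t)
    (J : ℝ → Ω → ℝ) (hJcont : ∀ ω, Continuous fun t => J t ω)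
    (hJ0 : ∀ ω, J 0 ω = 0)
    (hJgauss : IsCenteredGaussian1 P J (covFromStd σ))
    -- assumption L1
    (lam : ℝ) (hlam : lam ∈ Set.Ioo (0:ℝ) 1)
    (hL1 : ∀ t > (0:ℝ), Tendsto (fun x => σ (t * x) / σ x) (𝓝[>] 0) (𝓝 (t ^ lam)))
    -- assumption L2
    (t₀ β C : ℝ) (ht₀ : 0 < t₀) (hβ : β ∈ Set.Ioo (0:ℝ) 1) (hC : 0 < C)
    (hL2 : ∀ t > t₀, σ t ≤ C * t ^ β)
    -- the scaling function δ
    (δ : ℝ → ℝ)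
    (hδ : ∀ u > (0:ℝ), 0 < δ u ∧ u * δ u = σ (δ u))
    (hδ0 : Tendsto δ atTop (𝓝 0))
    (hδbdd : ∀ u₀ > (0:ℝ), BddAbove (δ '' Set.Ici u₀))
    (Cbar : ℝ) (hCbar : 0 < Cbar) (t : ℝ) (ht : 0 ≤ t) (v : ℝ)
    (u₀ : ℝ) (hu₀ : 0 < u₀) :
    Tendsto (fun 𝒯 : ℝ =>
        ⨆ u : Set.Ici u₀,
          (P {ω | v < ⨆ s : Set.Iio (-𝒯),
              (Cbar / σ (δ ↑u) * (J (δ ↑u * t) ω - J (δ ↑u * ↑s) ω) - (t - ↑s))}).toReal)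
      atTop (𝓝 0) := by
  obtain ⟨Δ, hΔ⟩ := hδbdd u₀ hu₀
  obtain ⟨K, A, b, hK, hA1, hA2, hb0, hb1, hpot⟩ :=
    aux_potter σ hσcont hσpos lam hlam hL1 t₀ β C ht₀ hβ hC hL2 Δ
  obtain ⟨Kt, hKt, hfix⟩ := aux_fixed σ hσcont hσ0 hσpos lam Δ hL1 t ht
  have hσnn : ∀ x, 0 ≤ x → 0 ≤ σ x := by
    intro x hx
    rcases hx.eq_or_lt with rfl | hx
    · exact hσ0.ge
    · exact (hσpos x hx).le
  set q := Real.sqrt b with hqdef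
  have hq0 : 0 < q := Real.sqrt_pos.2 hb0
  have hq2 : q ^ 2 = b := Real.sq_sqrt hb0.le
  have hq1 : q < 1 := by nlinarith
  obtain ⟨p, hp⟩ := exists_pow_lt_of_lt_one (by norm_num : (0:ℝ) < 1 / 4) hq1
  have hp0 : p ≠ 0 := by
    rintro rfl
    norm_num at hp
  obtain ⟨M, hM, hgt⟩ := aux_gauss_tail p hp0
  have htail : ∀ x y a : ℝ, 0 < a →
      P {ω | a ≤ |J x ω - J y ω|} ≤ ENNReal.ofReal (M * (σ |x - y| / a) ^ p) := by
    intro x y a ha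
    have h1 := hgt (σ |x - y|) (hσnn _ (abs_nonneg _)) a ha
    have hm : Measurable fun ω => J x ω - J y ω := (hJgauss.1 x).sub (hJgauss.1 y)
    have hms : MeasurableSet {x : ℝ | a ≤ |x|} :=
      measurableSet_le measurable_const (by fun_prop)
    rw [← aux_incr P σ hσ0 J hJgauss x y, Measure.map_apply hm hms] at h1
    exact h1
  have hsumq : Summable fun k : ℕ => q ^ k := summable_geometric_of_lt_one hq0.le hq1
  set S := ∑' k : ℕ, q ^ k with hS
  have hS0 : 0 ≤ S := tsum_nonneg fun k => by positivity
  set c := 1 / (2 * Cbar * (1 + 2 * S)) with hcdef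
  have hc : 0 < c := by positivity
  have hcc : Cbar * c * (1 + 2 * S) = 1 / 2 := by rw [hcdef]; field_simp
  set ρ := (A / 2) ^ p with hρ
  have hρ0 : 0 ≤ ρ := by positivity
  have hρ1 : ρ < 1 := pow_lt_one₀ (by positivity) (by linarith) hp0
  set D := 2 * (M * (K / c) ^ p) with hD
  have hD0 : 0 ≤ D := by positivity
  set g : ℕ → ℝ := fun N => M * (Kt / c) ^ p * ((1 / 2) ^ p) ^ N + D * ρ / (1 - ρ) * ρ ^ N with hg
  have hg0 : ∀ N, 0 ≤ g N := by
    intro N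
    have : 0 < 1 - ρ := by linarith
    simp only [hg]
    positivity
  have hglim : Tendsto g atTop (𝓝 0) := by
    have h1 := (tendsto_pow_atTop_nhds_zero_of_lt_one (by positivity)
      (pow_lt_one₀ (by norm_num) (by norm_num) hp0 : ((1:ℝ) / 2) ^ p < 1)).const_mul
        (M * (Kt / c) ^ p)
    have h2 := (tendsto_pow_atTop_nhds_zero_of_lt_one hρ0 hρ1).const_mul (D * ρ / (1 - ρ))
    simpa [hg] using h1.add h2
  -- the key uniform estimate
  have key : ∀ N : ℕ, -v ≤ 2 ^ N / 2 → ∀ T : ℝ, 2 ^ N ≤ T → ∀ u, u₀ ≤ u →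
      P {ω | v < ⨆ s : Set.Iio (-T),
              (Cbar / σ (δ u) * (J (δ u * t) ω - J (δ u * ↑s) ω) - (t - ↑s))}
        ≤ ENNReal.ofReal (g N) := by
    intro N hN T hT u hu
    set d := δ u with hd
    have hd0 : 0 < d := (hδ u (hu₀.trans_le hu)).1
    have hdΔ : d ≤ Δ := hΔ ⟨u, hu, rfl⟩
    have hσd : 0 < σ d := hσpos d hd0
    set B : ℕ → Set Ω := fun n => {ω | ∃ k j : ℕ, j < 2 ^ k ∧ σ d * (c * 2 ^ n * q ^ k) ≤
        |J (-(d * 2 ^ n * ((j + 1) / 2 ^ k))) ω - J (-(d * 2 ^ n * (j / 2 ^ k))) ω|} with hB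
    have hBn : ∀ n, P (B n) ≤ ENNReal.ofReal (D * ρ ^ n) := fun n =>
      aux_block P σ J p M K A q c d n hM (by linarith) (by linarith) hq0 hc hd0 hσd hσnn hp.le
        htail (fun k => by rw [hq2]; exact hpot n k d hd0 hdΔ)
    set F : Set Ω := {ω | σ d * (c * 2 ^ N) ≤ |J (d * t) ω - J 0 ω|} with hF
    have hFP : P F ≤ ENNReal.ofReal (M * (Kt / c) ^ p * ((1 / 2) ^ p) ^ N) := by
      refine (htail _ _ _ (by positivity)).trans (ENNReal.ofReal_le_ofReal ?_)
      have e : |d * t - 0| = t * d := by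
        rw [sub_zero, abs_of_nonneg (by positivity), mul_comm]
      rw [e]
      have h1 : σ (t * d) / (σ d * (c * 2 ^ N)) ≤ Kt / c * (1 / 2) ^ N := by
        rw [div_le_iff₀ (by positivity)]
        refine (hfix d hd0 hdΔ).trans (le_of_eq ?_)
        rw [div_pow, one_pow]
        field_simp
      have h0 : 0 ≤ σ (t * d) / (σ d * (c * 2 ^ N)) :=
        div_nonneg (hσnn _ (by positivity)) (by positivity)
      calc _ ≤ M * (Kt / c * (1 / 2) ^ N) ^ p := by gcongr
        _ = _ := by rw [mul_pow, ← pow_mul, ← pow_mul, mul_comm N p]; ring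
    have hsub : {ω | v < ⨆ s : Set.Iio (-T),
              (Cbar / σ d * (J (d * t) ω - J (d * ↑s) ω) - (t - ↑s))}
        ⊆ F ∪ ⋃ m : ℕ, B (m + (N + 1)) := by
      intro ω hω
      by_contra hnot
      simp only [Set.mem_union, Set.mem_iUnion, not_or, not_exists] at hnot
      obtain ⟨hnF, hnB⟩ := hnot
      have hnF : |J (d * t) ω| < σ d * (c * 2 ^ N) := by
        have : ¬ (σ d * (c * 2 ^ N) ≤ |J (d * t) ω - J 0 ω|) := hnF
        rw [hJ0, sub_zero] at this
        exact not_le.1 this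
      have hω : v < ⨆ s : Set.Iio (-T),
              (Cbar / σ d * (J (d * t) ω - J (d * ↑s) ω) - (t - ↑s)) := hω
      refine absurd hω (not_lt.2 ?_)
      have : Nonempty (Set.Iio (-T)) := ⟨⟨-T - 1, by simp⟩⟩
      apply ciSup_le
      rintro ⟨s, hs⟩
      have hs : s < -T := hs
      show Cbar / σ d * (J (d * t) ω - J (d * s) ω) - (t - s) ≤ v
      have hNs : (2:ℝ) ^ N < -s := by linarith
      have h1N : (1:ℝ) ≤ 2 ^ N := one_le_pow₀ (by norm_num)
      obtain ⟨n, hn1, hn2⟩ := exists_nat_pow_near (x := -s) (y := (2:ℝ)) (by linarith) (by norm_num)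
      have hNn : N ≤ n := by
        have : (2:ℝ) ^ N < 2 ^ (n+1) := by linarith
        have := (pow_lt_pow_iff_right₀ (by norm_num : (1:ℝ) < 2)).1 this
        omega
      obtain ⟨m, rfl⟩ := Nat.exists_eq_add_of_le hNn
      have hb' : ∀ k j : ℕ, j < 2 ^ k →
          |J (-(d * 2 ^ (N + m + 1) * ((j + 1) / 2 ^ k))) ω
            - J (-(d * 2 ^ (N + m + 1) * (j / 2 ^ k))) ω|
          ≤ σ d * (c * 2 ^ (N + m + 1)) * q ^ k := by
        intro k j hj
        by_contra hcon
        push Not at hcon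
        apply hnB m
        rw [show m + (N + 1) = N + m + 1 by ring]
        exact ⟨k, j, hj, by rw [← mul_assoc]; exact hcon.le⟩
      have hch := aux_chain (fun x => J (-(d * 2 ^ (N + m + 1) * x)) ω)
        ((hJcont ω).comp (by fun_prop)) (by simp [hJ0])
        (fun k => σ d * (c * 2 ^ (N + m + 1)) * q ^ k) (fun k => by positivity)
        (hsumq.mul_left _) hb' (-s / 2 ^ (N + m + 1)) (div_nonneg (by linarith) (by positivity))
        ((div_le_one (by positivity)).2 hn2.le)
      rw [tsum_mul_left] at hch
      have e : -(d * 2 ^ (N + m + 1) * (-s / 2 ^ (N + m + 1))) = d * s := by field_simp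
      simp only [e] at hch
      have hdiff : J (d * t) ω - J (d * s) ω ≤ σ d * (c * 2 ^ (N + m) * (1 + 2 * S)) := by
        have h1 := (abs_le.1 hch).1
        have h2 := (abs_lt.1 hnF).2
        have h3 : (2:ℝ) ^ N ≤ 2 ^ (N + m) := pow_le_pow_right₀ (by norm_num) (by omega)
        have h4 : σ d * (c * 2 ^ N) ≤ σ d * (c * 2 ^ (N + m)) := by gcongr
        have h5 : σ d * (c * 2 ^ (N + m + 1)) * S = σ d * (c * 2 ^ (N + m) * (2 * S)) := by
          rw [pow_succ]; ring
        rw [← hS, h5] at h1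
        linarith
      have hval : Cbar / σ d * (J (d * t) ω - J (d * s) ω) ≤ 2 ^ (N + m) / 2 := by
        calc _ ≤ Cbar / σ d * (σ d * (c * 2 ^ (N + m) * (1 + 2 * S))) := by gcongr
          _ = (Cbar * c * (1 + 2 * S)) * 2 ^ (N + m) := by field_simp
          _ = _ := by rw [hcc]; ring
      have h3 : (2:ℝ) ^ N ≤ 2 ^ (N + m) := pow_le_pow_right₀ (by norm_num) (by omega)
      linarith
    have hU : P (⋃ m : ℕ, B (m + (N + 1))) ≤ ENNReal.ofReal (D * ρ / (1 - ρ) * ρ ^ N) := by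
      refine (measure_iUnion_le _).trans ((ENNReal.tsum_le_tsum fun m => hBn _).trans ?_)
      have e : ∀ m : ℕ, D * ρ ^ (m + (N + 1)) = D * ρ ^ (N + 1) * ρ ^ m := fun m => by
        rw [pow_add]; ring
      simp only [e]
      rw [← ENNReal.ofReal_tsum_of_nonneg (fun k => by positivity)
          ((summable_geometric_of_lt_one hρ0 hρ1).mul_left _), tsum_mul_left,
          tsum_geometric_of_lt_one hρ0 hρ1]
      apply ENNReal.ofReal_le_ofReal (le_of_eq _)
      rw [pow_succ]; ring
    calc _ ≤ P (F ∪ ⋃ m : ℕ, B (m + (N + 1))) := measure_mono hsub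
      _ ≤ P F + P (⋃ m : ℕ, B (m + (N + 1))) := measure_union_le _ _
      _ ≤ _ := add_le_add hFP hU
      _ = _ := by
        have : 0 < 1 - ρ := by linarith
        rw [← ENNReal.ofReal_add (by positivity) (by positivity)]
  rw [Metric.tendsto_atTop]
  intro ε hε
  have hpow : Tendsto (fun N : ℕ => (2:ℝ) ^ N / 2) atTop atTop :=
    (tendsto_pow_atTop_atTop_of_one_lt (by norm_num : (1:ℝ) < 2)).atTop_div_const (by norm_num)
  obtain ⟨N, hN1, hN2⟩ := ((hglim.eventually_lt_const hε).and
    (hpow.eventually_ge_atTop (-v))).exists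
  refine ⟨2 ^ N, fun T hT => ?_⟩
  rw [Real.dist_eq, sub_zero, abs_of_nonneg (Real.iSup_nonneg fun u => ENNReal.toReal_nonneg)]
  refine lt_of_le_of_lt (Real.iSup_le (fun u => ?_) (hg0 N)) hN1
  exact ENNReal.toReal_le_of_le_ofReal (hg0 N) (key N hN2 T hT u u.2)
end
end
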